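/- arXiv:1207.3703 — 6 statements merged into one kernel-verified Lean document; each statement's English description precedes it below -/
import Mathlib

section
/- Let N ≥ 1 and Ω ⊂ ℝ^N a smoothly bounded domain. There exists a universal constant C > 0 (independent of Ω, N, λ, μ) such that for all λ, μ > 0, every stable classical solution (u, v) of the Gelfand system satisfies ∫_Ω e^{u+v} dx ≤ C |Ω| (λ/μ + μ/λ). -/
open MeasureTheory Real
open scoped RealInnerProductSpace

/-- The Laplacian of `u : ℝ^N → ℝ`, computed as the sum of second derivatives
along the standard basis directions. -/
noncomputable def lap {N : ℕ} (u : EuclideanSpace ℝ (Fin N) → ℝ)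
    (x : EuclideanSpace ℝ (Fin N)) : ℝ :=
  ∑ i : Fin N,
    fderiv ℝ (fun y => fderiv ℝ u y (EuclideanSpace.single i 1)) x (EuclideanSpace.single i 1)

/-- A (smoothly bounded) domain: a nonempty bounded open connected subset of `ℝ^N`. -/
def IsBoundedDomain {N : ℕ} (Ω : Set (EuclideanSpace ℝ (Fin N))) : Prop :=
  IsOpen Ω ∧ IsConnected Ω ∧ Bornology.IsBounded Ω

/-- `(u, v)` is a classical solution of the Gelfand system
`-Δu = μ e^v`, `-Δv = λ e^u` in `Ω`, `u = v = 0` on `∂Ω`. -/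
def IsGelfandSolution {N : ℕ} (Ω : Set (EuclideanSpace ℝ (Fin N))) (lam mu : ℝ)
    (u v : EuclideanSpace ℝ (Fin N) → ℝ) : Prop :=
  ContDiffOn ℝ 2 u (closure Ω) ∧ ContDiffOn ℝ 2 v (closure Ω) ∧
  (∀ x ∈ Ω, -lap u x = mu * exp (v x)) ∧
  (∀ x ∈ Ω, -lap v x = lam * exp (u x)) ∧
  (∀ x ∈ frontier Ω, u x = 0) ∧ (∀ x ∈ frontier Ω, v x = 0)

/-- `(u, v)` is a stable classical solution of the Gelfand system: there exist `λ₁ ≥ 0` and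
positive eigenfunctions `φ₁, ψ₁ ∈ C²(Ω̄)` of the linearized system, vanishing on `∂Ω`. -/
def IsStableGelfandSolution {N : ℕ} (Ω : Set (EuclideanSpace ℝ (Fin N))) (lam mu : ℝ)
    (u v : EuclideanSpace ℝ (Fin N) → ℝ) : Prop :=
  IsGelfandSolution Ω lam mu u v ∧
  ∃ (lam1 : ℝ) (φ₁ ψ₁ : EuclideanSpace ℝ (Fin N) → ℝ),
    0 ≤ lam1 ∧
    ContDiffOn ℝ 2 φ₁ (closure Ω) ∧ ContDiffOn ℝ 2 ψ₁ (closure Ω) ∧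
    (∀ x ∈ Ω, 0 < φ₁ x) ∧ (∀ x ∈ Ω, 0 < ψ₁ x) ∧
    (∀ x ∈ Ω, -lap φ₁ x - mu * exp (v x) * ψ₁ x = lam1 * φ₁ x) ∧
    (∀ x ∈ Ω, -lap ψ₁ x - lam * exp (u x) * φ₁ x = lam1 * ψ₁ x) ∧
    (∀ x ∈ frontier Ω, φ₁ x = 0) ∧ (∀ x ∈ frontier Ω, ψ₁ x = 0)

/-! ### Helper functions -/

/-- The `C¹` function `(x₊)²`. -/
noncomputable def pf (x : ℝ) : ℝ := max x 0 ^ 2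

theorem pf_hasDerivAt (x : ℝ) : HasDerivAt pf (2 * max x 0) x := by
  rcases lt_trichotomy x 0 with h | h | h
  · have : pf =ᶠ[nhds x] fun _ => 0 := by
      filter_upwards [gt_mem_nhds h] with y hy
      simp [pf, max_eq_right hy.le]
    rw [max_eq_right h.le, mul_zero]
    exact (hasDerivAt_const x (0 : ℝ)).congr_of_eventuallyEq this
  · subst h
    rw [hasDerivAt_iff_isLittleO_nhds_zero]
    simp only [zero_add, max_self, mul_zero, smul_eq_mul, sub_zero]
    have h1 : (fun h : ℝ => pf h - pf 0) =O[nhds 0] fun h => h ^ 2 := by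
      refine Asymptotics.IsBigO.of_bound 1 (Filter.Eventually.of_forall fun y => ?_)
      simp only [pf, max_self, norm_eq_abs, one_mul]
      rw [abs_of_nonneg (by simp), abs_of_nonneg (by positivity)]
      rcases le_total y 0 with hy | hy
      · simp [max_eq_right hy]; positivity
      · simp [max_eq_left hy]
    exact h1.trans_isLittleO (Asymptotics.isLittleO_pow_id (by norm_num))
  · have : pf =ᶠ[nhds x] fun y => y ^ 2 := by
      filter_upwards [lt_mem_nhds h] with y hy
      simp [pf, max_eq_left hy.le]
    rw [max_eq_left h.le]
    have := (hasDerivAt_pow 2 x).congr_of_eventuallyEq this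
    simpa using this

theorem pf_contDiff : ContDiff ℝ 1 pf := by
  rw [contDiff_one_iff_deriv]
  refine ⟨fun x => (pf_hasDerivAt x).differentiableAt, ?_⟩
  have : deriv pf = fun x => 2 * max x 0 := funext fun x => (pf_hasDerivAt x).deriv
  rw [this]
  fun_prop

/-- Test function. -/
noncomputable def tF (t : ℝ) : ℝ := pf (exp (t / 2) - 2) * exp (-(t / 2))
/-- Its derivative. -/
noncomputable def tF' (t : ℝ) : ℝ :=
  max (exp (t / 2) - 2) 0 - pf (exp (t / 2) - 2) * exp (-(t / 2)) / 2
/-- Companion test function. -/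
noncomputable def tG (t : ℝ) : ℝ := pf (exp (t / 2) - 4 * exp (-(t / 2))) / 4
/-- Its derivative. -/
noncomputable def tG' (t : ℝ) : ℝ :=
  max (exp (t / 2) - 4 * exp (-(t / 2))) 0 * (exp (t / 2) + 4 * exp (-(t / 2))) / 4

theorem tF_contDiff : ContDiff ℝ 1 tF := by
  unfold tF
  have h : ContDiff ℝ 1 fun t : ℝ => exp (t / 2) - 2 := by fun_prop
  exact (pf_contDiff.comp h).mul (by fun_prop)

theorem tG_contDiff : ContDiff ℝ 1 tG := by
  unfold tG
  have h : ContDiff ℝ 1 fun t : ℝ => exp (t / 2) - 4 * exp (-(t / 2)) := by fun_prop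
  exact (pf_contDiff.comp h).div_const 4

theorem exp_half_deriv (t : ℝ) : HasDerivAt (fun t : ℝ => exp (t / 2)) (exp (t / 2) / 2) t := by
  have := ((hasDerivAt_id t).div_const 2).exp
  simpa [div_eq_mul_inv] using this

theorem exp_neg_half_deriv (t : ℝ) :
    HasDerivAt (fun t : ℝ => exp (-(t / 2))) (-(exp (-(t / 2)) / 2)) t := by
  have := ((hasDerivAt_id t).div_const 2).neg.exp
  simpa [div_eq_mul_inv] using this

theorem exp_half_mul (t : ℝ) : exp (t / 2) * exp (-(t / 2)) = 1 := by
  rw [← exp_add]; simp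

theorem tF_hasDerivAt (t : ℝ) : HasDerivAt tF (tF' t) t := by
  have h := ((pf_hasDerivAt _).comp t ((exp_half_deriv t).sub_const 2)).mul (exp_neg_half_deriv t)
  refine h.congr_deriv ?_
  simp only [Function.comp, tF']
  linear_combination (max (exp (t / 2) - 2) 0) * exp_half_mul t

theorem tG_hasDerivAt (t : ℝ) : HasDerivAt tG (tG' t) t := by
  have h := ((pf_hasDerivAt _).comp t
    ((exp_half_deriv t).sub ((exp_neg_half_deriv t).const_mul 4))).div_const 4
  refine h.congr_deriv ?_
  simp only [tG', Pi.sub_apply]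
  ring

theorem tF_zero {t : ℝ} (h : exp (t / 2) ≤ 2) : tF t = 0 := by
  simp [tF, pf, max_eq_right (sub_nonpos.2 h)]

theorem aux_nonpos {t : ℝ} (h : exp (t / 2) ≤ 2) : exp (t / 2) - 4 * exp (-(t / 2)) ≤ 0 := by
  have := exp_half_mul t
  have h1 := exp_pos (t / 2)
  have h2 := exp_pos (-(t / 2))
  nlinarith

theorem tG_zero {t : ℝ} (h : exp (t / 2) ≤ 2) : tG t = 0 := by
  simp [tG, pf, max_eq_right (aux_nonpos h)]

theorem tF'_sq_le (t : ℝ) : tF' t ^ 2 ≤ tG' t := by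
  have h0 := exp_half_mul t
  have h1 := exp_pos (t / 2)
  have h2 := exp_pos (-(t / 2))
  rcases le_total (exp (t / 2)) 2 with h | h
  · simp [tF', tG', pf, max_eq_right (sub_nonpos.2 h), max_eq_right (aux_nonpos h)]
  · have h3 : 0 ≤ exp (t / 2) - 4 * exp (-(t / 2)) := by nlinarith
    have h4 : tF' t = (exp (t / 2) - 4 * exp (-(t / 2))) / 2 := by
      simp only [tF', pf, max_eq_left (sub_nonneg.2 h)]
      linear_combination (-(exp (t / 2)) / 2 + 2) * h0
    rw [h4, tG', max_eq_left h3]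
    nlinarith

theorem tG_le (t : ℝ) : tG t ≤ exp (t / 2) ^ 2 / 4 := by
  have h1 := exp_pos (t / 2)
  have h2 := exp_pos (-(t / 2))
  unfold tG pf
  have : max (exp (t / 2) - 4 * exp (-(t / 2))) 0 ≤ exp (t / 2) := max_le (by linarith) h1.le
  have h3 : 0 ≤ max (exp (t / 2) - 4 * exp (-(t / 2))) 0 := le_max_right _ _
  gcongr

theorem tF_nonneg (t : ℝ) : 0 ≤ tF t := by unfold tF pf; positivity

theorem le_tF (t : ℝ) : exp (t / 2) ≤ tF t + 4 := by
  have h0 := exp_half_mul t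
  have h1 := exp_pos (t / 2)
  have h2 := exp_pos (-(t / 2))
  rcases le_total (exp (t / 2)) 2 with h | h
  · linarith [tF_nonneg t]
  · have : tF t = exp (t / 2) - 4 + 4 * exp (-(t / 2)) := by
      simp only [tF, pf, max_eq_left (sub_nonneg.2 h)]
      linear_combination (exp (t / 2) - 4) * h0
    linarith

/-! ### Divergence theorem for compactly supported fields -/

theorem integral_fderiv_zero {N : ℕ} {Ω K : Set (EuclideanSpace ℝ (Fin N))} (hΩ : IsOpen Ω)
    (hK : IsCompact K) (hKΩ : K ⊆ Ω) {z : EuclideanSpace ℝ (Fin N) → ℝ}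
    (hz : ContDiffOn ℝ 1 z Ω) (hz0 : ∀ x ∈ Ω, x ∉ K → z x = 0) (e : EuclideanSpace ℝ (Fin N)) :
    IntegrableOn (fun x => fderiv ℝ z x e) Ω ∧ ∫ x in Ω, fderiv ℝ z x e = 0 := by
  set w := Ω.indicator z with hw
  have hw0 : ∀ x, x ∉ K → w x = 0 := by
    intro x hx
    by_cases h : x ∈ Ω
    · rw [hw, Set.indicator_of_mem h, hz0 x h hx]
    · rw [hw, Set.indicator_of_notMem h]
  have hwz : ∀ x ∈ Ω, w =ᶠ[nhds x] z := by
    intro x hx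
    filter_upwards [hΩ.mem_nhds hx] with y hy
    rw [hw, Set.indicator_of_mem hy]
  have hwe : ∀ x, x ∉ K → w =ᶠ[nhds x] fun _ => 0 := by
    intro x hx
    filter_upwards [hK.isClosed.isOpen_compl.mem_nhds hx] with y hy using hw0 y hy
  have hwC : ContDiff ℝ 1 w := by
    rw [contDiff_iff_contDiffAt]
    intro x
    by_cases hx : x ∈ K
    · exact (hz.contDiffAt (hΩ.mem_nhds (hKΩ hx))).congr_of_eventuallyEq (hwz x (hKΩ hx))
    · exact contDiffAt_const.congr_of_eventuallyEq (hwe x hx)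
  have hwS : HasCompactSupport w := HasCompactSupport.intro hK hw0
  have hfc : Continuous fun x => fderiv ℝ w x e :=
    (hwC.continuous_fderiv (by norm_num)).clm_apply continuous_const
  have hfS : HasCompactSupport fun x => fderiv ℝ w x e := by
    refine HasCompactSupport.intro hK fun x hx => ?_
    rw [(hwe x hx).fderiv_eq]; simp
  have hfi : Integrable fun x => fderiv ℝ w x e := hfc.integrable_of_hasCompactSupport hfS
  have hwi : Integrable w := hwC.continuous.integrable_of_hasCompactSupport hwS
  have hint : ∫ x, fderiv ℝ w x e = 0 := by
    have := integral_mul_fderiv_eq_neg_fderiv_mul_of_integrable (μ := (volume : Measure (EuclideanSpace ℝ (Fin N))))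
      (f := w) (g := fun _ => (1 : ℝ)) (v := e)
      (by simpa using hfi) (by simp) (by simpa using hwi)
      (fun x _ => (hwC.differentiable (by norm_num)) x) (fun x _ => by fun_prop)
    simpa using this
  have heq : Set.EqOn (fun x => fderiv ℝ w x e) (fun x => fderiv ℝ z x e) Ω := by
    intro x hx
    simp only [(hwz x hx).fderiv_eq]
  refine ⟨hfi.integrableOn.congr_fun heq hΩ.measurableSet, ?_⟩
  rw [← setIntegral_congr_fun hΩ.measurableSet heq, setIntegral_eq_integral_of_forall_compl_eq_zero,
    hint]
  intro x hx
  rw [(hwe x fun h => hx (hKΩ h)).fderiv_eq]; simp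

/-- Pointwise differential inequality in one direction. -/
theorem field_deriv_le {N : ℕ} {u φ ψ : EuclideanSpace ℝ (Fin N) → ℝ}
    {x e : EuclideanSpace ℝ (Fin N)}
    (hu : DifferentiableAt ℝ u x) (hφ : DifferentiableAt ℝ φ x) (hψ : DifferentiableAt ℝ ψ x)
    (hu2 : DifferentiableAt ℝ (fun y => fderiv ℝ u y e) x)
    (hφ2 : DifferentiableAt ℝ (fun y => fderiv ℝ φ y e) x)
    (hψ2 : DifferentiableAt ℝ (fun y => fderiv ℝ ψ y e) x)
    (pφ : 0 < φ x) (pψ : 0 < ψ x) :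
    fderiv ℝ (fun y => tF (u y) ^ 2 * (fderiv ℝ φ y e * (φ y)⁻¹ + fderiv ℝ ψ y e * (ψ y)⁻¹)
      - 2 * (tG (u y) * fderiv ℝ u y e)) x e ≤
    tF (u x) ^ 2 * (fderiv ℝ (fun y => fderiv ℝ φ y e) x e * (φ x)⁻¹
        + fderiv ℝ (fun y => fderiv ℝ ψ y e) x e * (ψ x)⁻¹)
      - 2 * (tG (u x) * fderiv ℝ (fun y => fderiv ℝ u y e) x e) := by
  have hF := (tF_hasDerivAt (u x)).comp_hasFDerivAt x hu.hasFDerivAt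
  have hG := (tG_hasDerivAt (u x)).comp_hasFDerivAt x hu.hasFDerivAt
  have iφ := (hasDerivAt_inv pφ.ne').comp_hasFDerivAt x hφ.hasFDerivAt
  have iψ := (hasDerivAt_inv pψ.ne').comp_hasFDerivAt x hψ.hasFDerivAt
  have H := ((hF.pow 2).mul ((hφ2.hasFDerivAt.mul iφ).add (hψ2.hasFDerivAt.mul iψ))).sub
    ((hG.mul hu2.hasFDerivAt).const_mul 2)
  have H' := congrArg (fun L => L e) H.fderiv
  refine (le_of_eq H').trans ?_
  simp only [Function.comp, sub_apply, add_apply,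
    smul_apply, smul_eq_mul, nsmul_eq_mul, Pi.add_apply, Pi.mul_apply]
  have hle := tF'_sq_le (u x)
  generalize fderiv ℝ (fun y => fderiv ℝ u y e) x e = u2
  generalize fderiv ℝ (fun y => fderiv ℝ φ y e) x e = p2
  generalize fderiv ℝ (fun y => fderiv ℝ ψ y e) x e = q2
  generalize fderiv ℝ u x e = u1 at *
  generalize fderiv ℝ φ x e = p1 at *
  generalize fderiv ℝ ψ x e = q1 at *
  have e1 : (φ x ^ 2)⁻¹ = (φ x)⁻¹ ^ 2 := by rw [inv_pow]
  have e2 : (ψ x ^ 2)⁻¹ = (ψ x)⁻¹ ^ 2 := by rw [inv_pow]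
  rw [e1, e2]
  generalize (φ x)⁻¹ = a
  generalize (ψ x)⁻¹ = b
  generalize tF (u x) = F at *
  generalize tF' (u x) = F' at *
  generalize tG (u x) = G at *
  generalize tG' (u x) = G' at *
  norm_num
  nlinarith [sq_nonneg (F' * u1 - F * p1 * a), sq_nonneg (F' * u1 - F * q1 * b),
    mul_le_mul_of_nonneg_right hle (sq_nonneg u1)]

theorem c1_of_c2 {N : ℕ} {Ω : Set (EuclideanSpace ℝ (Fin N))} (hΩ : IsOpen Ω)
    {u : EuclideanSpace ℝ (Fin N) → ℝ} (hu : ContDiffOn ℝ 2 u (closure Ω))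
    (e : EuclideanSpace ℝ (Fin N)) : ContDiffOn ℝ 1 (fun y => fderiv ℝ u y e) Ω :=
  ((hu.mono subset_closure).fderiv_of_isOpen hΩ (by norm_num)).clm_apply contDiffOn_const

/-- The integrated stability estimate. -/
theorem key {N : ℕ} {Ω : Set (EuclideanSpace ℝ (Fin N))} (hΩ : IsBoundedDomain Ω)
    {α β : ℝ} (hα : 0 < α) (hβ : 0 < β) {u v φ ψ : EuclideanSpace ℝ (Fin N) → ℝ} {l : ℝ}
    (hl : 0 ≤ l)
    (cu : ContDiffOn ℝ 2 u (closure Ω)) (cv : ContDiffOn ℝ 2 v (closure Ω))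
    (cφ : ContDiffOn ℝ 2 φ (closure Ω)) (cψ : ContDiffOn ℝ 2 ψ (closure Ω))
    (pφ : ∀ x ∈ Ω, 0 < φ x) (pψ : ∀ x ∈ Ω, 0 < ψ x)
    (eu : ∀ x ∈ Ω, -lap u x = β ^ 2 * exp (v x)) (bu : ∀ x ∈ frontier Ω, u x = 0)
    (eφ : ∀ x ∈ Ω, -lap φ x - β ^ 2 * exp (v x) * ψ x = l * φ x)
    (eψ : ∀ x ∈ Ω, -lap ψ x - α ^ 2 * exp (u x) * φ x = l * ψ x) :
    IntegrableOn (fun x => exp (u x / 2) * exp (v x / 2) * tF (u x) ^ 2) Ω ∧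
    IntegrableOn (fun x => exp (u x + v x)) Ω ∧
    α * ∫ x in Ω, exp (u x / 2) * exp (v x / 2) * tF (u x) ^ 2
      ≤ β / 4 * ∫ x in Ω, exp (u x + v x) := by
  obtain ⟨ho, -, hb⟩ := hΩ
  have hcomp : IsCompact (closure Ω) := hb.isCompact_closure
  have icont : ∀ f : EuclideanSpace ℝ (Fin N) → ℝ, ContinuousOn f (closure Ω) →
      IntegrableOn f Ω := fun f hf => (hf.integrableOn_compact hcomp).mono_set subset_closure
  have ku := cu.continuousOn
  have kv := cv.continuousOn
  have i1 : IntegrableOn (fun x => exp (u x / 2) * exp (v x / 2) * tF (u x) ^ 2) Ω := by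
    refine icont _ ?_
    have := tF_contDiff.continuous.comp_continuousOn ku
    have h2 : ContinuousOn (fun x => tF (u x)) (closure Ω) := this
    fun_prop
  have i2 : IntegrableOn (fun x => exp (u x + v x)) Ω := icont _ (by fun_prop)
  refine ⟨i1, i2, ?_⟩
  set K := closure Ω ∩ {x | 2 ≤ exp (u x / 2)} with hKdef
  have hK : IsCompact K := by
    refine hcomp.of_isClosed_subset ?_ Set.inter_subset_left
    have h : ContinuousOn (fun x => exp (u x / 2)) (closure Ω) := by fun_prop
    exact h.preimage_isClosed_of_isClosed isClosed_closure isClosed_Ici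
  have hKΩ : K ⊆ Ω := by
    rintro x ⟨hx, h2⟩
    by_contra hn
    have : x ∈ frontier Ω := by rw [ho.frontier_eq]; exact ⟨hx, hn⟩
    simp only [Set.mem_ofPred_eq, bu x this] at h2
    norm_num at h2
  have hsm : ∀ x ∈ Ω, x ∉ K → exp (u x / 2) ≤ 2 := by
    intro x hx hn
    by_contra hc
    exact hn ⟨subset_closure hx, (not_le.1 hc).le⟩
  set z : Fin N → EuclideanSpace ℝ (Fin N) → ℝ := fun i y =>
    tF (u y) ^ 2 * (fderiv ℝ φ y (EuclideanSpace.single i 1) * (φ y)⁻¹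
      + fderiv ℝ ψ y (EuclideanSpace.single i 1) * (ψ y)⁻¹)
      - 2 * (tG (u y) * fderiv ℝ u y (EuclideanSpace.single i 1)) with hz
  have c1 : ∀ {w : EuclideanSpace ℝ (Fin N) → ℝ}, ContDiffOn ℝ 2 w (closure Ω) →
      ContDiffOn ℝ 1 w Ω := fun hw => (hw.mono subset_closure).of_le (by norm_num)
  have hzC : ∀ i, ContDiffOn ℝ 1 (z i) Ω := by
    intro i
    have hF : ContDiffOn ℝ 1 (fun y => tF (u y)) Ω := tF_contDiff.comp_contDiffOn (c1 cu)
    have hG : ContDiffOn ℝ 1 (fun y => tG (u y)) Ω := tG_contDiff.comp_contDiffOn (c1 cu)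
    have a1 := (c1 cφ).inv fun x hx => (pφ x hx).ne'
    have a2 := (c1 cψ).inv fun x hx => (pψ x hx).ne'
    exact ((hF.pow 2).mul (((c1_of_c2 ho cφ _).mul a1).add ((c1_of_c2 ho cψ _).mul a2))).sub
      (contDiffOn_const.mul (hG.mul (c1_of_c2 ho cu _)))
  have hz0 : ∀ i, ∀ x ∈ Ω, x ∉ K → z i x = 0 := by
    intro i x hx hn
    simp [hz, tF_zero (hsm x hx hn), tG_zero (hsm x hx hn)]
  have hdiv := fun i => integral_fderiv_zero ho hK hKΩ (hzC i) (hz0 i) (EuclideanSpace.single i 1)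
  have hsum : ∫ x in Ω, ∑ i, fderiv ℝ (z i) x (EuclideanSpace.single i 1) = 0 := by
    rw [integral_finsetSum _ fun i _ => (hdiv i).1]
    exact Finset.sum_eq_zero fun i _ => (hdiv i).2
  have hsi : IntegrableOn (fun x => ∑ i, fderiv ℝ (z i) x (EuclideanSpace.single i 1)) Ω :=
    integrable_finsetSum _ fun i _ => (hdiv i).1
  have hpt : ∀ x ∈ Ω, ∑ i, fderiv ℝ (z i) x (EuclideanSpace.single i 1) ≤
      2 * (β ^ 2 / 4 * exp (u x + v x))
        - 2 * (α * β * (exp (u x / 2) * exp (v x / 2) * tF (u x) ^ 2)) := by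
    intro x hx
    have d1 : ∀ {w : EuclideanSpace ℝ (Fin N) → ℝ}, ContDiffOn ℝ 2 w (closure Ω) →
      DifferentiableAt ℝ w x := fun hw =>
        ((c1 hw).differentiableOn (by norm_num)).differentiableAt (ho.mem_nhds hx)
    have d2 : ∀ {w : EuclideanSpace ℝ (Fin N) → ℝ}, ContDiffOn ℝ 2 w (closure Ω) → ∀ e,
      DifferentiableAt ℝ (fun y => fderiv ℝ w y e) x := fun hw e =>
        ((c1_of_c2 ho hw e).differentiableOn (by norm_num)).differentiableAt (ho.mem_nhds hx)
    have h1 : ∑ i, fderiv ℝ (z i) x (EuclideanSpace.single i 1) ≤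
        tF (u x) ^ 2 * (lap φ x * (φ x)⁻¹ + lap ψ x * (ψ x)⁻¹) - 2 * (tG (u x) * lap u x) := by
      refine (Finset.sum_le_sum fun i _ => field_deriv_le (d1 cu) (d1 cφ) (d1 cψ) (d2 cu _)
        (d2 cφ _) (d2 cψ _) (pφ x hx) (pψ x hx)).trans (le_of_eq ?_)
      simp only [lap, Finset.sum_sub_distrib, ← Finset.mul_sum, Finset.sum_add_distrib,
        ← Finset.sum_mul]
    refine h1.trans ?_
    have ea : exp (u x) = exp (u x / 2) ^ 2 := by rw [← exp_nat_mul]; congr 1; push_cast; ring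
    have eb : exp (v x) = exp (v x / 2) ^ 2 := by rw [← exp_nat_mul]; congr 1; push_cast; ring
    have h2 := eu x hx
    have h3 := eφ x hx
    have h4 := eψ x hx
    have hp := pφ x hx
    have hq := pψ x hx
    have hG := tG_le (u x)
    rw [exp_add]
    rw [ea] at h4 ⊢
    rw [eb] at h2 h3 ⊢
    have pa := exp_pos (u x / 2)
    have pb := exp_pos (v x / 2)
    generalize exp (u x / 2) = a at *
    generalize exp (v x / 2) = b at *
    have k1 : lap u x = -(β ^ 2 * b ^ 2) := by linarith
    have k2 : lap φ x = -(β ^ 2 * b ^ 2 * ψ x) - l * φ x := by linarith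
    have k3 : lap ψ x = -(α ^ 2 * a ^ 2 * φ x) - l * ψ x := by linarith
    have k4 : lap φ x * (φ x)⁻¹ + lap ψ x * (ψ x)⁻¹ ≤ -(2 * (α * β * (a * b))) := by
      rw [k2, k3]
      have : -(2 * (α * β * (a * b))) - ((-(β ^ 2 * b ^ 2 * ψ x) - l * φ x) * (φ x)⁻¹ +
          (-(α ^ 2 * a ^ 2 * φ x) - l * ψ x) * (ψ x)⁻¹)
          = (β * b * ψ x - α * a * φ x) ^ 2 / (φ x * ψ x) + 2 * l := by
        field_simp
        ring
      have h5 : 0 ≤ (β * b * ψ x - α * a * φ x) ^ 2 / (φ x * ψ x) + 2 * l := by positivity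
      linarith
    have k5 := mul_le_mul_of_nonneg_left k4 (sq_nonneg (tF (u x)))
    have k6 := mul_le_mul_of_nonneg_left hG (by positivity : 0 ≤ β ^ 2 * b ^ 2)
    rw [k1]
    nlinarith
  have hmono := setIntegral_mono_on hsi
    (((i2.const_mul (β ^ 2 / 4)).const_mul 2).sub ((i1.const_mul (α * β)).const_mul 2))
    ho.measurableSet hpt
  simp only [Pi.sub_apply] at hmono
  rw [hsum, integral_sub ((i2.const_mul (β ^ 2 / 4)).const_mul 2)
    ((i1.const_mul (α * β)).const_mul 2)] at hmono
  simp only [integral_const_mul] at hmono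
  refine le_of_mul_le_mul_left ?_ hβ
  linarith

theorem final_pointwise {a b p q r : ℝ} (hr : 0 < r) (ha : 0 < a) (hb : 0 < b)
    (hp : 0 ≤ p) (hq : 0 ≤ q) (hap : a ≤ p + 4) (hbq : b ≤ q + 4) :
    3 / 4 * (a ^ 2 * b ^ 2) ≤ r⁻¹ * (a * b * p ^ 2) + r * (b * a * q ^ 2)
      + 256 * (r + r⁻¹) ^ 2 := by
  have hs : 0 < r⁻¹ := by positivity
  have hrs : r * r⁻¹ = 1 := mul_inv_cancel₀ hr.ne'
  generalize r⁻¹ = s at *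
  have h1 : p * q ≤ (s * p ^ 2 + r * q ^ 2) / 2 := by
    have : 0 ≤ s * (p - r * q) ^ 2 := by positivity
    nlinarith
  have h2 : 4 * p ≤ s * p ^ 2 / 2 + 8 * r := by
    have : 0 ≤ s * (p - 4 * r) ^ 2 := by positivity
    nlinarith
  have h3 : 4 * q ≤ r * q ^ 2 / 2 + 8 * s := by
    have : 0 ≤ r * (q - 4 * s) ^ 2 := by positivity
    nlinarith
  have h4 : 2 ≤ r + s := by nlinarith [sq_nonneg (r - s)]
  have h5 : a * b ≤ (p + 4) * (q + 4) := by gcongr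
  have h6 : a * b ≤ (s * p ^ 2 + r * q ^ 2) + 16 * (r + s) := by nlinarith
  have h7 := mul_le_mul_of_nonneg_left h6 (by positivity : 0 ≤ a * b)
  nlinarith [sq_nonneg (a * b / 2 - 16 * (r + s))]

/-- **Lemma 2.** There is a universal constant `C > 0` such that every
stable classical solution of the Gelfand system satisfies
`∫_Ω e^{u+v} ≤ C |Ω| (λ/μ + μ/λ)`. -/
theorem exp_sum_integral_bound :
    ∃ C : ℝ, 0 < C ∧
      ∀ (N : ℕ), 1 ≤ N →
        ∀ (Ω : Set (EuclideanSpace ℝ (Fin N))), IsBoundedDomain Ω →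
          ∀ (lam mu : ℝ), 0 < lam → 0 < mu →
            ∀ (u v : EuclideanSpace ℝ (Fin N) → ℝ),
              IsStableGelfandSolution Ω lam mu u v →
              ∫ x in Ω, exp (u x + v x) ≤
                C * (volume Ω).toReal * (lam / mu + mu / lam) := by
  refine ⟨2048, by norm_num, ?_⟩
  rintro N - Ω hΩ lam mu hlam hmu u v ⟨⟨cu, cv, eu, ev, bu, bv⟩, l, φ, ψ, hl, cφ, cψ, pφ, pψ, eφ, eψ, -, -⟩
  obtain ⟨α, hα, rfl⟩ : ∃ α : ℝ, 0 < α ∧ α ^ 2 = lam := ⟨√lam, sqrt_pos.2 hlam, sq_sqrt hlam.le⟩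
  obtain ⟨β, hβ, rfl⟩ : ∃ β : ℝ, 0 < β ∧ β ^ 2 = mu := ⟨√mu, sqrt_pos.2 hmu, sq_sqrt hmu.le⟩
  obtain ⟨i1, i2, k1⟩ := key hΩ hα hβ hl cu cv cφ cψ pφ pψ eu bu eφ eψ
  obtain ⟨j1, -, k2⟩ := key hΩ hβ hα hl cv cu cψ cφ pψ pφ ev bv eψ eφ
  have hfin : volume Ω ≠ ⊤ := hΩ.2.2.measure_lt_top.ne
  have hcomm : (fun x => exp (v x + u x)) = fun x => exp (u x + v x) := by
    funext x; rw [add_comm]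
  rw [hcomm] at k2
  set r := β / α with hr
  have hrpos : 0 < r := by positivity
  have hri : r⁻¹ = α / β := by rw [hr, inv_div]
  have ic : IntegrableOn (fun _ : EuclideanSpace ℝ (Fin N) => 256 * (r + r⁻¹) ^ 2) Ω :=
    integrableOn_const hfin
  have hmono := setIntegral_mono_on (i2.const_mul (3 / 4))
    (((i1.const_mul r⁻¹).add (j1.const_mul r)).add ic) hΩ.1.measurableSet (fun x _ => by
      have ea : exp (u x + v x) = exp (u x / 2) ^ 2 * exp (v x / 2) ^ 2 := by
        rw [← exp_nat_mul, ← exp_nat_mul, ← exp_add]; congr 1; push_cast; ring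
      rw [ea]
      exact final_pointwise hrpos (exp_pos _) (exp_pos _) (tF_nonneg _) (tF_nonneg _)
        (le_tF (u x)) (le_tF (v x)))
  have hsplit := integral_add (μ := volume.restrict Ω) ((i1.const_mul r⁻¹).add (j1.const_mul r)) ic
  have hsplit2 := integral_add (μ := volume.restrict Ω) (i1.const_mul r⁻¹) (j1.const_mul r)
  simp only [Pi.add_apply] at hsplit hsplit2 hmono
  rw [hsplit, hsplit2] at hmono
  simp only [integral_const_mul, setIntegral_const, smul_eq_mul] at hmono
  have hV : volume.real Ω = (volume Ω).toReal := rfl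
  rw [hV] at hmono
  have hV0 : 0 ≤ (volume Ω).toReal := ENNReal.toReal_nonneg
  generalize (volume Ω).toReal = V at *
  generalize ∫ x in Ω, exp (u x + v x) = A at *
  generalize ∫ x in Ω, exp (u x / 2) * exp (v x / 2) * tF (u x) ^ 2 = X at *
  generalize ∫ x in Ω, exp (v x / 2) * exp (u x / 2) * tF (v x) ^ 2 = Y at *
  have hX : r⁻¹ * X ≤ A / 4 := by
    have := mul_le_mul_of_nonneg_left k1 (by positivity : 0 ≤ 1 / β)
    rw [hri]
    calc α / β * X = 1 / β * (α * X) := by ring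
      _ ≤ 1 / β * (β / 4 * A) := this
      _ = A / 4 := by field_simp
  have hY : r * Y ≤ A / 4 := by
    have := mul_le_mul_of_nonneg_left k2 (by positivity : 0 ≤ 1 / α)
    calc r * Y = 1 / α * (β * Y) := by rw [hr]; ring
      _ ≤ 1 / α * (α / 4 * A) := this
      _ = A / 4 := by field_simp
  have hA : A ≤ V * (1024 * (r + r⁻¹) ^ 2) := by linarith
  have hm : 1024 * (r + r⁻¹) ^ 2 ≤ 2048 * (α ^ 2 / β ^ 2 + β ^ 2 / α ^ 2) := by
    have e1 : α ^ 2 / β ^ 2 = r⁻¹ ^ 2 := by rw [hri, div_pow]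
    have e2 : β ^ 2 / α ^ 2 = r ^ 2 := by rw [hr, div_pow]
    rw [e1, e2]
    nlinarith [sq_nonneg (r - r⁻¹)]
  have := mul_le_mul_of_nonneg_left hm hV0
  linarith
end

section
/- Let Ω ⊂ ℝ^N be a smoothly bounded domain, λ, μ > 0, and (u, v) ∈ C²(Ω̄)² a classical solution of the Gelfand system. Then λ ∫_Ω e^u (e^v − 1) dx = ∫_Ω ∇v · ∇(e^v − 1) dx = 4 ∫_Ω |∇(e^{v/2} − 1)|² dx; in particular λ ∫_Ω e^{u+v} dx ≥ 4 ∫_Ω |∇(e^{v/2} − 1)|² dx. -/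
open MeasureTheory Real
open scoped RealInnerProductSpace

namespace GelfandAux

open Set Filter Topology

/-- Truncation of the identity, vanishing for `s ≤ ε`. -/
noncomputable def eta (ε s : ℝ) : ℝ := max s ε - 2 * ε + ε ^ 2 / max s ε

/-- Derivative of `eta`. -/
noncomputable def etad (ε s : ℝ) : ℝ := 1 - (ε / max s ε) ^ 2

lemma eta_zero {ε s : ℝ} (hε : 0 < ε) (h : s ≤ ε) : eta ε s = 0 := by
  simp only [eta, max_eq_right h]; field_simp; ring

lemma etad_zero {ε s : ℝ} (hε : 0 < ε) (h : s ≤ ε) : etad ε s = 0 := by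
  simp only [etad, max_eq_right h]; field_simp; ring

lemma eta_hasDerivAt {ε : ℝ} (hε : 0 < ε) (s : ℝ) : HasDerivAt (eta ε) (etad ε s) s := by
  have key : ∀ t : ℝ, ε ≤ t → HasDerivAt (fun s : ℝ => s - 2 * ε + ε ^ 2 / s) (etad ε t) t := by
    intro t ht
    have ht0 : t ≠ 0 := by linarith
    have h1 := ((hasDerivAt_id t).sub_const (2 * ε)).add
      ((hasDerivAt_const t (ε ^ 2)).div (hasDerivAt_id t) ht0)
    refine h1.congr_deriv ?_
    simp only [etad, max_eq_left ht, id]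
    field_simp
    ring
  have hge : ∀ t : ℝ, ε ≤ t → eta ε t = t - 2 * ε + ε ^ 2 / t := by
    intro t ht; simp [eta, max_eq_left ht]
  rcases lt_trichotomy s ε with h | h | h
  · rw [etad_zero hε h.le]
    refine (hasDerivAt_const s (0 : ℝ)).congr_of_eventuallyEq ?_
    filter_upwards [Iio_mem_nhds h] with t ht using eta_zero hε (le_of_lt ht)
  · subst h
    have h1 : HasDerivWithinAt (eta s) (etad s s) (Iic s) s := by
      rw [etad_zero hε le_rfl]
      exact (hasDerivWithinAt_const s (Iic s) (0 : ℝ)).congr (fun t ht => eta_zero hε ht)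
        (eta_zero hε le_rfl)
    have h2 : HasDerivWithinAt (eta s) (etad s s) (Ici s) s :=
      (key s le_rfl).hasDerivWithinAt.congr (fun t ht => hge t ht) (hge s le_rfl)
    have := h1.union h2
    rwa [Iic_union_Ici, hasDerivWithinAt_univ] at this
  · refine (key s h.le).congr_of_eventuallyEq ?_
    filter_upwards [Ioi_mem_nhds h] with t ht using hge t (le_of_lt ht)

lemma etad_continuous {ε : ℝ} (hε : 0 < ε) : Continuous (etad ε) := by
  unfold etad
  have : ∀ s : ℝ, max s ε ≠ 0 := fun s => (lt_max_of_lt_right hε).ne'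
  fun_prop (disch := exact this _)

lemma eta_continuous {ε : ℝ} (hε : 0 < ε) : Continuous (eta ε) :=
  continuous_iff_continuousAt.2 fun s => (eta_hasDerivAt hε s).continuousAt

lemma etad_nonneg {ε s : ℝ} (hε : 0 < ε) : 0 ≤ etad ε s := by
  have h : ε / max s ε ≤ 1 := div_le_one_of_le₀ (le_max_right _ _) (by positivity)
  have h0 : 0 ≤ ε / max s ε := by positivity
  unfold etad; nlinarith

lemma etad_anti {ε δ s : ℝ} (hε : 0 < ε) (h : ε ≤ δ) (hs : 0 < s) : etad δ s ≤ etad ε s := by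
  have hδ : 0 < δ := by linarith
  have h1 : ε / max s ε ≤ δ / max s δ := by
    rw [div_le_div_iff₀ (by positivity) (by positivity)]
    rcases le_total s ε with a | a <;> rcases le_total s δ with b | b <;> simp [a, b] <;> nlinarith
  have h0 : 0 ≤ ε / max s ε := by positivity
  unfold etad; nlinarith

lemma eta_abs_le {ε s : ℝ} (hε : 0 < ε) (hs : 0 < s) : |eta ε s| ≤ s := by
  rcases le_total s ε with a | a
  · simp [eta_zero hε a, hs.le]
  · have e : eta ε s = (s - ε) ^ 2 / s := by
      simp only [eta, max_eq_left a]; field_simp; ring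
    rw [e, abs_of_nonneg (by positivity), div_le_iff₀ hs]
    nlinarith

lemma eta_tendsto {s : ℝ} (hs : 0 < s) {e : ℕ → ℝ} (he : Tendsto e atTop (𝓝 0)) :
    Tendsto (fun n => eta (e n) s) atTop (𝓝 s) := by
  have : ContinuousAt (fun ε => eta ε s) 0 := by
    unfold eta
    have : max s 0 ≠ 0 := by rw [max_eq_left hs.le]; exact hs.ne'
    fun_prop (disch := assumption)
  have h2 := this.tendsto.comp he
  simpa [eta, max_eq_left hs.le, Function.comp_def] using h2

lemma etad_tendsto {s : ℝ} (hs : 0 < s) {e : ℕ → ℝ} (he : Tendsto e atTop (𝓝 0)) :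
    Tendsto (fun n => etad (e n) s) atTop (𝓝 1) := by
  have : ContinuousAt (fun ε => etad ε s) 0 := by
    unfold etad
    have : max s 0 ≠ 0 := by rw [max_eq_left hs.le]; exact hs.ne'
    fun_prop (disch := assumption)
  have h2 := this.tendsto.comp he
  simpa [etad, max_eq_left hs.le, Function.comp_def] using h2

variable {N : ℕ}

/-- Second derivative is nonnegative at a local minimum. -/
lemma second_deriv_nonneg {v : EuclideanSpace ℝ (Fin N) → ℝ} {x e : EuclideanSpace ℝ (Fin N)}
    (hv : ContDiffAt ℝ 2 v x) (hmin : IsLocalMin v x) :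
    0 ≤ fderiv ℝ (fun y => fderiv ℝ v y e) x e := by
  by_contra hneg
  push Not at hneg
  have hdiff : ∀ᶠ y in 𝓝 x, DifferentiableAt ℝ v y := by
    filter_upwards [hv.eventually (by simp)] with y hy using hy.differentiableAt (by simp)
  have hdd : DifferentiableAt ℝ (fun y => fderiv ℝ v y e) x := by
    have h1 : ContDiffAt ℝ 1 (fderiv ℝ v) x := hv.fderiv_right (by norm_num)
    exact (h1.differentiableAt (by simp)).clm_apply (differentiableAt_const e)
  let l : ℝ → EuclideanSpace ℝ (Fin N) := fun t => x + t • e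
  have hl : ∀ t, HasDerivAt l e t := fun t => by
    have h := ((hasDerivAt_id t).smul_const e).const_add x
    rw [one_smul] at h
    exact h
  have hl0 : l 0 = x := by simp [l]
  have hlc : Tendsto l (𝓝 0) (𝓝 x) := by
    have := (hl 0).continuousAt.tendsto; rwa [hl0] at this
  let g : ℝ → ℝ := fun t => v (l t)
  have hg1 : ∀ᶠ t in 𝓝 (0 : ℝ), deriv g t = fderiv ℝ v (l t) e := by
    filter_upwards [hlc.eventually hdiff] with t ht
    exact (ht.hasFDerivAt.comp_hasDerivAt t (hl t)).deriv
  have hg2 : deriv (deriv g) 0 = fderiv ℝ (fun y => fderiv ℝ v y e) x e := by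
    rw [Filter.EventuallyEq.deriv_eq hg1]
    have h := hdd.hasFDerivAt
    rw [← hl0] at h
    have := (h.comp_hasDerivAt 0 (hl 0)).deriv
    rw [hl0] at this
    exact this
  have hgmin : IsLocalMin g 0 := by
    have : ∀ᶠ t in 𝓝 (0 : ℝ), v x ≤ v (l t) := hlc.eventually hmin
    filter_upwards [this] with t ht
    simpa [g, hl0] using ht
  have hgc : ContinuousAt g 0 := by
    have h : ContinuousAt v (l 0) := by rw [hl0]; exact hv.continuousAt
    exact h.comp (hl 0).continuousAt
  have hgmax : IsLocalMax g 0 :=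
    isLocalMax_of_deriv_deriv_neg (by rw [hg2]; exact hneg) hgmin.deriv_eq_zero hgc
  have hconst : g =ᶠ[𝓝 0] fun _ => g 0 := by
    filter_upwards [hgmin, hgmax] with t h1 h2 using le_antisymm h2 h1
  have : deriv (deriv g) 0 = 0 := by
    have h1 : deriv g =ᶠ[𝓝 0] deriv (fun _ => g 0) := hconst.deriv
    rw [h1.deriv_eq]; simp
  rw [hg2] at this
  linarith

lemma v_pos {Ω : Set (EuclideanSpace ℝ (Fin N))} (hΩ : IsBoundedDomain Ω)
    {v : EuclideanSpace ℝ (Fin N) → ℝ} (hv : ContDiffOn ℝ 2 v (closure Ω))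
    (hlap : ∀ x ∈ Ω, 0 < -lap v x) (hb : ∀ x ∈ frontier Ω, v x = 0) :
    ∀ x ∈ Ω, 0 < v x := by
  obtain ⟨ho, hc, hbd⟩ := hΩ
  have hcomp : IsCompact (closure Ω) := hbd.isCompact_closure
  have nomin : ∀ x ∈ Ω, ¬ ∀ y ∈ closure Ω, v x ≤ v y := by
    intro x hx hm
    have hloc : IsLocalMin v x := by
      filter_upwards [ho.mem_nhds hx] with y hy using hm y (subset_closure hy)
    have hcd : ContDiffAt ℝ 2 v x :=
      hv.contDiffAt (mem_of_superset (ho.mem_nhds hx) subset_closure)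
    have h1 := hlap x hx
    have h2 : 0 ≤ lap v x := Finset.sum_nonneg fun i _ => second_deriv_nonneg hcd hloc
    linarith
  obtain ⟨z, hz, hzm⟩ := hcomp.exists_isMinOn hc.nonempty.closure hv.continuousOn
  have hzf : z ∈ frontier Ω := by
    rw [ho.frontier_eq]
    exact ⟨hz, fun h => nomin z h hzm⟩
  intro x hx
  by_contra hneg
  push Not at hneg
  refine nomin x hx fun y hy => ?_
  have := hzm hy
  simp only [mem_ofPred_eq, hb z hzf] at this
  linarith

lemma integrable_aux {Ω K : Set (EuclideanSpace ℝ (Fin N))} (hK : IsCompact K) (hKΩ : K ⊆ Ω)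
    {f : EuclideanSpace ℝ (Fin N) → ℝ} (hf : ContinuousOn f Ω) (h0 : ∀ x ∉ K, f x = 0) :
    Integrable f := by
  rw [← integrableOn_iff_integrable_of_support_subset (s := K)]
  · exact (hf.mono hKΩ).integrableOn_compact hK
  · intro x hx; by_contra h; exact hx (h0 x h)

/-- Divergence-type statement for compactly supported functions. -/
lemma integral_lineDeriv_zero {f f' : EuclideanSpace ℝ (Fin N) → ℝ} {e : EuclideanSpace ℝ (Fin N)}
    (hf : Integrable f) (hf' : Integrable f') (h : ∀ x, HasLineDerivAt ℝ f (f' x) x e) :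
    ∫ x, f' x = 0 := by
  have := integral_bilinear_hasLineDerivAt_right_eq_neg_left_of_integrable
    (μ := (volume : Measure (EuclideanSpace ℝ (Fin N))))
    (f := f) (f' := f') (g := fun _ => (1 : ℝ)) (g' := fun _ => (0 : ℝ)) (v := e)
    (B := ContinuousLinearMap.mul ℝ ℝ) (by simpa using hf') (by simp) (by simpa using hf)
    (fun x _ => h x) (fun x _ => by simpa [HasLineDerivAt] using hasDerivAt_const (0:ℝ) (1:ℝ))
  simpa using this

lemma grad_normsq (v : EuclideanSpace ℝ (Fin N) → ℝ) (x : EuclideanSpace ℝ (Fin N)) :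
    ‖gradient v x‖ ^ 2 = ∑ i, (fderiv ℝ v x (EuclideanSpace.single i 1)) ^ 2 := by
  rw [EuclideanSpace.real_norm_sq_eq]
  refine Finset.sum_congr rfl fun i _ => ?_
  congr 1
  rw [← inner_gradient_left, EuclideanSpace.inner_single_right]
  simp

/-- Truncated integration by parts. -/
lemma trunc_ibp {Ω : Set (EuclideanSpace ℝ (Fin N))} (hΩ : IsBoundedDomain Ω)
    {v : EuclideanSpace ℝ (Fin N) → ℝ} (hv : ContDiffOn ℝ 2 v (closure Ω))
    (hb : ∀ x ∈ frontier Ω, v x = 0) {ε : ℝ} (hε : 0 < ε) :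
    IntegrableOn (fun x => etad ε (exp (v x) - 1) * (exp (v x) * ‖gradient v x‖ ^ 2)) Ω ∧
    ∫ x in Ω, etad ε (exp (v x) - 1) * (exp (v x) * ‖gradient v x‖ ^ 2) =
      ∫ x in Ω, -lap v x * eta ε (exp (v x) - 1) := by
  obtain ⟨ho, hc, hbd⟩ := hΩ
  have hcomp : IsCompact (closure Ω) := hbd.isCompact_closure
  have hvΩ : ContDiffOn ℝ 2 v Ω := hv.mono subset_closure
  have hvc : ContinuousOn v Ω := hvΩ.continuousOn
  have hcd : ∀ x ∈ Ω, ContDiffAt ℝ 2 v x := fun x hx => hvΩ.contDiffAt (ho.mem_nhds hx)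
  -- the compact set
  let K : Set (EuclideanSpace ℝ (Fin N)) := closure Ω ∩ (fun x => exp (v x) - 1) ⁻¹' Ici ε
  have hwc : ContinuousOn (fun x => exp (v x) - 1) (closure Ω) :=
    (Real.continuous_exp.comp_continuousOn hv.continuousOn).sub continuousOn_const
  have hKcl : IsClosed K := hwc.preimage_isClosed_of_isClosed isClosed_closure isClosed_Ici
  have hK : IsCompact K := hcomp.of_isClosed_subset hKcl inter_subset_left
  have hKΩ : K ⊆ Ω := by
    rintro x ⟨hx, hx2⟩
    by_contra hn
    have : x ∈ frontier Ω := by rw [ho.frontier_eq]; exact ⟨hx, hn⟩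
    simp only [mem_preimage, mem_Ici, hb x this] at hx2
    simp at hx2; linarith
  have hKout : ∀ x ∈ Ω, x ∉ K → exp (v x) - 1 ≤ ε := by
    intro x hx hn
    by_contra h
    push Not at h
    exact hn ⟨subset_closure hx, h.le⟩
  let d : Fin N → EuclideanSpace ℝ (Fin N) → ℝ :=
    fun i x => fderiv ℝ v x (EuclideanSpace.single i 1)
  have hd : ∀ i, ContDiffOn ℝ 1 (d i) Ω := fun i x hx => by
    have h1 : ContDiffAt ℝ 1 (fderiv ℝ v) x := (hcd x hx).fderiv_right (by norm_num)
    exact (h1.clm_apply contDiffAt_const).contDiffWithinAt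
  let dd : Fin N → EuclideanSpace ℝ (Fin N) → ℝ :=
    fun i x => fderiv ℝ (d i) x (EuclideanSpace.single i 1)
  have hdd : ∀ i, ContinuousOn (dd i) Ω := fun i =>
    ((hd i).continuousOn_fderiv_of_isOpen ho (by simp)).clm_apply continuousOn_const
  have hdc : ∀ i, ContinuousOn (d i) Ω := fun i => (hd i).continuousOn
  have hetac : ContinuousOn (fun x => eta ε (exp (v x) - 1)) Ω :=
    (eta_continuous hε).comp_continuousOn (hwc.mono subset_closure)
  have hetadc : ContinuousOn (fun x => etad ε (exp (v x) - 1)) Ω :=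
    (etad_continuous hε).comp_continuousOn (hwc.mono subset_closure)
  have hexpc : ContinuousOn (fun x => exp (v x)) Ω := Real.continuous_exp.comp_continuousOn hvc
  -- pieces
  have int1 : ∀ i, IntegrableOn (fun x => dd i x * eta ε (exp (v x) - 1)) Ω := by
    intro i
    rw [← integrable_indicator_iff ho.measurableSet]
    refine integrable_aux hK hKΩ (((hdd i).mul hetac).congr fun x hx => indicator_of_mem hx _) ?_
    intro x hx
    by_cases hxΩ : x ∈ Ω
    · simp [indicator_of_mem hxΩ, eta_zero hε (hKout x hxΩ hx)]
    · exact indicator_of_notMem hxΩ _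
  have int2 : ∀ i, IntegrableOn
      (fun x => etad ε (exp (v x) - 1) * (exp (v x) * d i x ^ 2)) Ω := by
    intro i
    rw [← integrable_indicator_iff ho.measurableSet]
    refine integrable_aux hK hKΩ ((hetadc.mul (hexpc.mul ((hdc i).pow 2))).congr
      fun x hx => indicator_of_mem hx _) ?_
    intro x hx
    by_cases hxΩ : x ∈ Ω
    · simp [indicator_of_mem hxΩ, etad_zero hε (hKout x hxΩ hx)]
    · exact indicator_of_notMem hxΩ _
  have int0 : ∀ i, IntegrableOn (fun x => d i x * eta ε (exp (v x) - 1)) Ω := by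
    intro i
    rw [← integrable_indicator_iff ho.measurableSet]
    refine integrable_aux hK hKΩ (((hdc i).mul hetac).congr fun x hx => indicator_of_mem hx _) ?_
    intro x hx
    by_cases hxΩ : x ∈ Ω
    · simp [indicator_of_mem hxΩ, eta_zero hε (hKout x hxΩ hx)]
    · exact indicator_of_notMem hxΩ _
  have ibp : ∀ i, ∫ x in Ω, (dd i x * eta ε (exp (v x) - 1) +
      etad ε (exp (v x) - 1) * (exp (v x) * d i x ^ 2)) = 0 := by
    intro i
    rw [← integral_indicator ho.measurableSet]
    refine integral_lineDeriv_zero (e := EuclideanSpace.single i 1)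
      ((integrable_indicator_iff ho.measurableSet).2 (int0 i))
      ((integrable_indicator_iff ho.measurableSet).2 ((int1 i).add (int2 i))) ?_
    intro x
    by_cases hxΩ : x ∈ Ω
    · rw [indicator_of_mem hxΩ]
      have h1 : HasFDerivAt (d i) (fderiv ℝ (d i) x) x :=
        (((hd i).contDiffAt (ho.mem_nhds hxΩ)).differentiableAt (by simp)).hasFDerivAt
      have h2 : HasFDerivAt v (fderiv ℝ v x) x :=
        ((hcd x hxΩ).differentiableAt (by simp)).hasFDerivAt
      have h3 := (eta_hasDerivAt hε (exp (v x) - 1)).comp_hasFDerivAt x (h2.exp.sub_const 1)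
      have h4 := (h1.mul h3).congr_of_eventuallyEq
        (f₁ := Ω.indicator (fun x => d i x * eta ε (exp (v x) - 1))) (by
          filter_upwards [ho.mem_nhds hxΩ] with y hy
          rw [indicator_of_mem hy]; rfl)
      have h5 := h4.hasLineDerivAt (EuclideanSpace.single i 1)
      refine HasDerivAt.congr_deriv h5 ?_
      simp only [ContinuousLinearMap.add_apply, ContinuousLinearMap.smul_apply, smul_eq_mul,
        Function.comp_apply, d, dd]
      ring
    · have hxK : x ∉ K := fun h => hxΩ (hKΩ h)
      rw [indicator_of_notMem hxΩ]
      have h4 : HasFDerivAt (Ω.indicator (fun x => d i x * eta ε (exp (v x) - 1)))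
          (0 : EuclideanSpace ℝ (Fin N) →L[ℝ] ℝ) x := by
        refine (hasFDerivAt_const (0 : ℝ) x).congr_of_eventuallyEq ?_
        filter_upwards [hKcl.isOpen_compl.mem_nhds hxK] with y hy
        by_cases hyΩ : y ∈ Ω
        · simp [indicator_of_mem hyΩ, eta_zero hε (hKout y hyΩ hy)]
        · exact indicator_of_notMem hyΩ _
      simpa using h4.hasLineDerivAt (EuclideanSpace.single i 1)
  have e1 : (fun x => etad ε (exp (v x) - 1) * (exp (v x) * ‖gradient v x‖ ^ 2)) =
      fun x => ∑ i, etad ε (exp (v x) - 1) * (exp (v x) * d i x ^ 2) := by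
    funext x
    rw [grad_normsq, Finset.mul_sum, Finset.mul_sum]
  have e2 : (fun x => -lap v x * eta ε (exp (v x) - 1)) =
      fun x => ∑ i, -(dd i x * eta ε (exp (v x) - 1)) := by
    funext x
    rw [Finset.sum_neg_distrib, ← Finset.sum_mul, neg_mul]
    rfl
  rw [e1, e2]
  refine ⟨integrable_finsetSum _ fun i _ => int2 i, ?_⟩
  rw [integral_finsetSum _ fun i _ => int2 i, integral_finsetSum (f := fun i x => -(dd i x * eta ε (exp (v x) - 1))) _
      fun i _ => (int1 i).neg]
  refine Finset.sum_congr rfl fun i _ => ?_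
  have := ibp i
  rw [integral_add (int1 i) (int2 i)] at this
  rw [integral_neg]
  linarith

lemma main_ibp {Ω : Set (EuclideanSpace ℝ (Fin N))} (hΩ : IsBoundedDomain Ω)
    {lam : ℝ} (hlam : 0 < lam)
    {u v : EuclideanSpace ℝ (Fin N) → ℝ}
    (hu : ContinuousOn u (closure Ω)) (hv : ContDiffOn ℝ 2 v (closure Ω))
    (hlap : ∀ x ∈ Ω, -lap v x = lam * exp (u x))
    (hb : ∀ x ∈ frontier Ω, v x = 0) :
    ∫ x in Ω, exp (v x) * ‖gradient v x‖ ^ 2 =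
      ∫ x in Ω, lam * (exp (u x) * (exp (v x) - 1)) := by
  have hpos := v_pos hΩ hv (fun x hx => by rw [hlap x hx]; positivity) hb
  have ho := hΩ.1
  have hm : MeasurableSet Ω := ho.measurableSet
  have hcomp : IsCompact (closure Ω) := hΩ.2.2.isCompact_closure
  have hwpos : ∀ x ∈ Ω, 0 < exp (v x) - 1 := fun x hx => by
    have := Real.add_one_lt_exp (hpos x hx).ne'
    linarith [hpos x hx]
  let e : ℕ → ℝ := fun n => 1 / ((n : ℝ) + 1)
  have hepos : ∀ n, 0 < e n := fun n => by positivity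
  have he0 : Tendsto e atTop (𝓝 0) := tendsto_one_div_add_atTop_nhds_zero_nat
  have heanti : ∀ m n, m ≤ n → e n ≤ e m := fun m n h => one_div_le_one_div_of_le
    (by positivity) (by exact_mod_cast Nat.succ_le_succ h)
  have hgc : ContinuousOn (fun x => lam * (exp (u x) * (exp (v x) - 1))) (closure Ω) := by
    have hvc := hv.continuousOn
    fun_prop
  have hgi : IntegrableOn (fun x => lam * (exp (u x) * (exp (v x) - 1))) Ω :=
    (hgc.integrableOn_compact hcomp).mono_set subset_closure
  -- right side limit
  have hR : Tendsto (fun n => ∫ x in Ω, -lap v x * eta (e n) (exp (v x) - 1)) atTop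
      (𝓝 (∫ x in Ω, lam * (exp (u x) * (exp (v x) - 1)))) := by
    have hcongr : ∀ n, ∫ x in Ω, -lap v x * eta (e n) (exp (v x) - 1) =
        ∫ x in Ω, lam * exp (u x) * eta (e n) (exp (v x) - 1) := fun n =>
      setIntegral_congr_fun hm fun x hx => by simp only [hlap x hx]
    simp_rw [hcongr]
    refine tendsto_integral_of_dominated_convergence _ ?_ hgi ?_ ?_
    · intro n
      have hvc := hv.continuousOn.mono (subset_closure (s := Ω))
      have huc := hu.mono (subset_closure (s := Ω))
      have h1 : ContinuousOn (fun x => eta (e n) (exp (v x) - 1)) Ω :=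
        (eta_continuous (hepos n)).comp_continuousOn (by fun_prop)
      have h2 : ContinuousOn (fun x => lam * exp (u x) * eta (e n) (exp (v x) - 1)) Ω := by
        fun_prop
      exact h2.aestronglyMeasurable hm
    · intro n
      refine (ae_restrict_iff' hm).2 (Eventually.of_forall fun x hx => ?_)
      rw [norm_mul, norm_of_nonneg (by positivity), mul_assoc]
      have := eta_abs_le (hepos n) (hwpos x hx)
      rw [Real.norm_eq_abs]
      gcongr
    · refine (ae_restrict_iff' hm).2 (Eventually.of_forall fun x hx => ?_)
      simpa [mul_assoc] using (eta_tendsto (hwpos x hx) he0).const_mul (lam * exp (u x))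
  have hF0 : ∀ x, 0 ≤ exp (v x) * ‖gradient v x‖ ^ 2 := fun x => by positivity
  have hcont : ContinuousOn (fun x => exp (v x) * ‖gradient v x‖ ^ 2) Ω := by
    have hvΩ : ContDiffOn ℝ 2 v Ω := hv.mono subset_closure
    have hvc := hvΩ.continuousOn
    have hg : ContinuousOn (gradient v) Ω :=
      (InnerProductSpace.toDual ℝ _).symm.continuous.comp_continuousOn
        (hvΩ.continuousOn_fderiv_of_isOpen ho (by norm_num))
    fun_prop
  have hL : Tendsto (fun n => ∫⁻ x in Ω, ENNReal.ofReal
      (etad (e n) (exp (v x) - 1) * (exp (v x) * ‖gradient v x‖ ^ 2))) atTop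
      (𝓝 (∫⁻ x in Ω, ENNReal.ofReal (exp (v x) * ‖gradient v x‖ ^ 2))) := by
    refine lintegral_tendsto_of_tendsto_of_monotone ?_ ?_ ?_
    · intro n
      exact (trunc_ibp hΩ hv hb (hepos n)).1.aestronglyMeasurable.aemeasurable.ennreal_ofReal
    · refine (ae_restrict_iff' hm).2 (Eventually.of_forall fun x hx => ?_)
      intro m n hmn
      exact ENNReal.ofReal_le_ofReal (mul_le_mul_of_nonneg_right
        (etad_anti (hepos n) (heanti m n hmn) (hwpos x hx)) (hF0 x))
    · refine (ae_restrict_iff' hm).2 (Eventually.of_forall fun x hx => ?_)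
      refine (ENNReal.continuous_ofReal.tendsto _).comp ?_
      simpa using (etad_tendsto (hwpos x hx) he0).mul_const (exp (v x) * ‖gradient v x‖ ^ 2)
  have hLe : ∀ n, ∫⁻ x in Ω, ENNReal.ofReal
      (etad (e n) (exp (v x) - 1) * (exp (v x) * ‖gradient v x‖ ^ 2)) =
      ENNReal.ofReal (∫ x in Ω, -lap v x * eta (e n) (exp (v x) - 1)) := by
    intro n
    rw [← (trunc_ibp hΩ hv hb (hepos n)).2, ofReal_integral_eq_lintegral_ofReal
      (trunc_ibp hΩ hv hb (hepos n)).1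
      (Eventually.of_forall fun x => mul_nonneg (etad_nonneg (hepos n)) (hF0 x))]
  simp_rw [hLe] at hL
  have := tendsto_nhds_unique hL ((ENNReal.continuous_ofReal.tendsto _).comp hR)
  rw [integral_eq_lintegral_of_nonneg_ae (Eventually.of_forall hF0)
    (hcont.aestronglyMeasurable hm), this, ENNReal.toReal_ofReal]
  exact setIntegral_nonneg hm fun x hx => by
    have := hwpos x hx
    positivity

lemma grad_comp {v : EuclideanSpace ℝ (Fin N) → ℝ} {x : EuclideanSpace ℝ (Fin N)}
    (hv : DifferentiableAt ℝ v x) {φ : ℝ → ℝ} {c : ℝ} (hφ : HasDerivAt φ c (v x)) :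
    gradient (fun y => φ (v y)) x = c • gradient v x := by
  have h := (hφ.comp_hasFDerivAt x hv.hasFDerivAt).fderiv
  unfold gradient
  have h' : fderiv ℝ (fun y => φ (v y)) x = c • fderiv ℝ v x := h
  rw [h']
  simp

end GelfandAux

/-- For a classical solution of the Gelfand system,
`λ ∫ e^u (e^v − 1) = ∫ ∇v · ∇(e^v − 1) = 4 ∫ |∇(e^{v/2} − 1)|²`; in particular
`λ ∫ e^{u+v} ≥ 4 ∫ |∇(e^{v/2} − 1)|²`. -/
theorem integration_by_parts_identity {N : ℕ}
    (Ω : Set (EuclideanSpace ℝ (Fin N))) (hΩ : IsBoundedDomain Ω)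
    (lam mu : ℝ) (hlam : 0 < lam) (hmu : 0 < mu)
    (u v : EuclideanSpace ℝ (Fin N) → ℝ)
    (huv : IsGelfandSolution Ω lam mu u v) :
    lam * ∫ x in Ω, exp (u x) * (exp (v x) - 1) =
        ∫ x in Ω, ⟪gradient v x, gradient (fun y => exp (v y) - 1) x⟫ ∧
    (∫ x in Ω, ⟪gradient v x, gradient (fun y => exp (v y) - 1) x⟫) =
        4 * ∫ x in Ω, ‖gradient (fun y => exp (v y / 2) - 1) x‖ ^ 2 ∧
    lam * ∫ x in Ω, exp (u x + v x) ≥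
        4 * ∫ x in Ω, ‖gradient (fun y => exp (v y / 2) - 1) x‖ ^ 2 := by
  obtain ⟨hu, hv, -, hlap, -, hb⟩ := huv
  have hm : MeasurableSet Ω := hΩ.1.measurableSet
  have hcomp : IsCompact (closure Ω) := hΩ.2.2.isCompact_closure
  have hmain := GelfandAux.main_ibp hΩ hlam hu.continuousOn hv hlap hb
  have hdiff : ∀ x ∈ Ω, DifferentiableAt ℝ v x := fun x hx =>
    ((hv.mono subset_closure).contDiffAt (hΩ.1.mem_nhds hx)).differentiableAt (by simp)
  have e1 : ∫ x in Ω, ⟪gradient v x, gradient (fun y => exp (v y) - 1) x⟫ =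
      ∫ x in Ω, exp (v x) * ‖gradient v x‖ ^ 2 := by
    refine setIntegral_congr_fun hm fun x hx => ?_
    have h := GelfandAux.grad_comp (hdiff x hx) ((Real.hasDerivAt_exp (v x)).sub_const 1)
    simp only [h, inner_smul_right, real_inner_self_eq_norm_sq]
  have e2 : 4 * ∫ x in Ω, ‖gradient (fun y => exp (v y / 2) - 1) x‖ ^ 2 =
      ∫ x in Ω, exp (v x) * ‖gradient v x‖ ^ 2 := by
    rw [← integral_const_mul]
    refine setIntegral_congr_fun hm fun x hx => ?_
    have h := GelfandAux.grad_comp (φ := fun s => exp (s / 2) - 1) (hdiff x hx)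
      ((((hasDerivAt_id (v x)).div_const 2).exp).sub_const 1)
    have h2 : exp (v x) = exp (v x / 2) ^ 2 := by rw [← Real.exp_nat_mul]; congr 1; push_cast; ring
    simp only [h, norm_smul, id, Real.norm_eq_abs, mul_pow, sq_abs, h2]
    ring
  have hA : lam * ∫ x in Ω, exp (u x) * (exp (v x) - 1) =
      ∫ x in Ω, exp (v x) * ‖gradient v x‖ ^ 2 := by
    rw [hmain, integral_const_mul]
  refine ⟨by rw [hA, e1], by rw [e1, e2], ?_⟩
  rw [e2, ← hA, ge_iff_le]
  have huc := hu.continuousOn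
  have hvc := hv.continuousOn
  refine mul_le_mul_of_nonneg_left ?_ hlam.le
  have i1 : ContinuousOn (fun x => exp (u x) * (exp (v x) - 1)) (closure Ω) := by fun_prop
  have i2 : ContinuousOn (fun x => exp (u x + v x)) (closure Ω) := by fun_prop
  refine integral_mono ((i1.integrableOn_compact hcomp).mono_set subset_closure)
    ((i2.integrableOn_compact hcomp).mono_set subset_closure) fun x => ?_
  simp only [Real.exp_add]
  have := Real.exp_pos (u x)
  nlinarith
end

section
/- Let Ω ⊂ ℝ^N be a smoothly bounded domain, λ, μ > 0, and (u, v) a stable classical solution of the Gelfand system. Then λ ∫_Ω e^{u+v} dx ≥ 4 √(λμ) ∫_Ω e^{(u+v)/2} (e^{v/2} − 1)² dx. -/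
open MeasureTheory Real
open scoped RealInnerProductSpace

open Filter Topology

/-- The integral of a directional derivative of a compactly supported `C¹` function vanishes. -/
lemma integral_fderiv_apply_zero {N : ℕ} (Z : EuclideanSpace ℝ (Fin N) → ℝ)
    (hZ : ContDiff ℝ 1 Z) (hc : HasCompactSupport Z) (e : EuclideanSpace ℝ (Fin N)) :
    Integrable (fun x => fderiv ℝ Z x e) ∧ ∫ x, fderiv ℝ Z x e = 0 := by
  have hcont : Continuous (fun x => fderiv ℝ Z x e) :=
    (hZ.continuous_fderiv (by norm_num)).clm_apply continuous_const
  have hi : Integrable (fun x => fderiv ℝ Z x e) :=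
    hcont.integrable_of_hasCompactSupport (hc.fderiv_apply (𝕜 := ℝ) e)
  refine ⟨hi, ?_⟩
  have h := integral_mul_fderiv_eq_neg_fderiv_mul_of_integrable (μ := volume) (𝕜 := ℝ)
    (f := fun _ : EuclideanSpace ℝ (Fin N) => (1 : ℝ)) (g := Z) (v := e)
    (by simp) (by simpa using hi)
    (by simpa using hZ.continuous.integrable_of_hasCompactSupport hc)
    (fun x _ => by fun_prop) (fun x _ => (hZ.differentiable (by norm_num)) x)
  simpa using h

lemma hasDerivAt_line {N : ℕ} {f : EuclideanSpace ℝ (Fin N) → ℝ} {x : EuclideanSpace ℝ (Fin N)}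
    (hf : DifferentiableAt ℝ f x) (e : EuclideanSpace ℝ (Fin N)) :
    HasDerivAt (fun t : ℝ => f (x + t • e)) (fderiv ℝ f x e) 0 :=
  hf.hasFDerivAt.hasLineDerivAt e

/-- Primitive of a continuous function. -/
lemma prim_facts (d : ℝ → ℝ) (hd : Continuous d) :
    (∀ t, HasDerivAt (fun t => ∫ s in (0:ℝ)..t, d s) (d t) t) ∧
    ContDiff ℝ 1 (fun t => ∫ s in (0:ℝ)..t, d s) := by
  have h : ∀ t, HasDerivAt (fun t => ∫ s in (0:ℝ)..t, d s) (d t) t := fun t =>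
    (hd.integral_hasStrictDerivAt 0 t).hasDerivAt
  refine ⟨h, contDiff_one_iff_deriv.2 ⟨fun t => (h t).differentiableAt, ?_⟩⟩
  have : deriv (fun t => ∫ s in (0:ℝ)..t, d s) = d := funext fun t => (h t).deriv
  rw [this]; exact hd

lemma pointwise_ineq (P g f q c : ℝ) (hf : 0 < f) :
    (2 * g * c * q + g ^ 2 * P) / f - g ^ 2 * q * q / f ^ 2 ≤ c ^ 2 + g ^ 2 * (P / f) := by
  have : c ^ 2 + g ^ 2 * (P / f) - ((2 * g * c * q + g ^ 2 * P) / f - g ^ 2 * q * q / f ^ 2)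
      = (c - g * q / f) ^ 2 := by
    field_simp
    ring
  nlinarith [sq_nonneg (c - g * q / f)]

lemma amgm_exp (lam mu u v f p : ℝ) (hlam : 0 < lam) (hmu : 0 < mu) (hf : 0 < f) (hp : 0 < p) :
    2 * (Real.sqrt (lam * mu) * exp ((u + v) / 2)) ≤
      mu * exp v * p / f + lam * exp u * f / p := by
  set a := Real.sqrt (mu * exp v * p / f) with ha
  set b := Real.sqrt (lam * exp u * f / p) with hb
  have hA : 0 ≤ mu * exp v * p / f := by positivity
  have hB : 0 ≤ lam * exp u * f / p := by positivity
  have hab : a * b = Real.sqrt (lam * mu) * exp ((u + v) / 2) := by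
    rw [ha, hb, ← Real.sqrt_mul hA, Real.exp_half, ← Real.sqrt_mul (by positivity), Real.exp_add]
    congr 1
    field_simp
  have h1 : a ^ 2 = mu * exp v * p / f := Real.sq_sqrt hA
  have h2 : b ^ 2 = lam * exp u * f / p := Real.sq_sqrt hB
  nlinarith [sq_nonneg (a - b)]

section key
variable {N : ℕ}

/-- The stability estimate tested with `g (v)`. -/
lemma key_estimate
    (Ω : Set (EuclideanSpace ℝ (Fin N))) (hΩ : IsBoundedDomain Ω)
    (lam mu : ℝ) (hlam : 0 < lam) (hmu : 0 < mu)
    (u v : EuclideanSpace ℝ (Fin N) → ℝ)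
    (huv : IsStableGelfandSolution Ω lam mu u v)
    (g G d : ℝ → ℝ) (ε : ℝ) (hε : 0 < ε)
    (hg : ContDiff ℝ 1 g) (hG : ContDiff ℝ 1 G)
    (hg' : ∀ t, HasDerivAt g (d t) t) (hG' : ∀ t, HasDerivAt G (d t ^ 2) t)
    (hg0 : ∀ t, |t| < ε → g t = 0) (hG0 : ∀ t, |t| < ε → G t = 0) :
    0 ≤ ∫ x in Ω, (lam * exp (u x) * G (v x) -
      Real.sqrt (lam * mu) * (exp ((u x + v x) / 2) * g (v x) ^ 2)) := by
  classical
  obtain ⟨⟨hu2, hv2, hu, hv, hub, hvb⟩, lam1, φ, ψ, hl1, hφ2, hψ2, hφp, hψp, hφ, hψ, -, -⟩ := huv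
  obtain ⟨hΩo, -, hΩb⟩ := hΩ
  have hcl : IsCompact (closure Ω) := hΩb.isCompact_closure
  set K : Set (EuclideanSpace ℝ (Fin N)) := closure Ω ∩ (fun x => |v x|) ⁻¹' Set.Ici ε with hK
  have hKcl : IsClosed K := (hv2.continuousOn.abs).preimage_isClosed_of_isClosed
    isClosed_closure isClosed_Ici
  have hKc : IsCompact K := hcl.of_isClosed_subset hKcl Set.inter_subset_left
  have hKΩ : K ⊆ Ω := by
    rintro x ⟨hx, hxv⟩
    by_contra hxΩ
    have : x ∈ frontier Ω := ⟨hx, by rwa [hΩo.interior_eq]⟩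
    have h0 := hvb x this
    simp only [Set.mem_preimage, Set.mem_Ici, h0, abs_zero] at hxv
    linarith
  have hsmall : ∀ x ∈ Ω, x ∉ K → |v x| < ε := by
    intro x hx hxK
    by_contra h
    exact hxK ⟨subset_closure hx, not_lt.1 h⟩
  have at2 : ∀ f : EuclideanSpace ℝ (Fin N) → ℝ, ContDiffOn ℝ 2 f (closure Ω) → ∀ x ∈ Ω,
      ContDiffAt ℝ 2 f x := fun f hf x hx =>
    (hf.mono subset_closure).contDiffAt (hΩo.mem_nhds hx)
  have at1 : ∀ f : EuclideanSpace ℝ (Fin N) → ℝ, ContDiffOn ℝ 2 f (closure Ω) → ∀ x ∈ Ω, ∀ e,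
      ContDiffAt ℝ 1 (fun y => fderiv ℝ f y e) x := fun f hf x hx e =>
    ((at2 f hf x hx).fderiv_right (m := 1) (by norm_num)).clm_apply contDiffAt_const
  let e : Fin N → EuclideanSpace ℝ (Fin N) := fun i => EuclideanSpace.single i 1
  let W : Fin N → EuclideanSpace ℝ (Fin N) → ℝ := fun i y =>
    g (v y) ^ 2 * fderiv ℝ φ y (e i) / φ y + g (v y) ^ 2 * fderiv ℝ ψ y (e i) / ψ y
      - 2 * (G (v y) * fderiv ℝ v y (e i))
  let Z : Fin N → EuclideanSpace ℝ (Fin N) → ℝ := fun i => Ω.indicator (W i)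
  have hZ0 : ∀ i, ∀ x, x ∉ K → Z i x = 0 := by
    intro i x hx
    by_cases hxΩ : x ∈ Ω
    · have h := hsmall x hxΩ hx
      simp [Z, W, hxΩ, hg0 _ h, hG0 _ h]
    · simp [Z, hxΩ]
  have hZW : ∀ i, ∀ x ∈ Ω, Z i =ᶠ[𝓝 x] W i := by
    intro i x hx
    filter_upwards [hΩo.mem_nhds hx] with y hy
    simp [Z, hy]
  have hZnull : ∀ i, ∀ x, x ∉ K → Z i =ᶠ[𝓝 x] fun _ => 0 := by
    intro i x hx
    filter_upwards [hKcl.isOpen_compl.mem_nhds hx] with y hy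
    exact hZ0 i y hy
  have hW1 : ∀ i, ∀ x ∈ Ω, ContDiffAt ℝ 1 (W i) x := by
    intro i x hx
    have v1 : ContDiffAt ℝ 1 v x := (at2 v hv2 x hx).of_le (by norm_num)
    have φ1 : ContDiffAt ℝ 1 φ x := (at2 φ hφ2 x hx).of_le (by norm_num)
    have ψ1 : ContDiffAt ℝ 1 ψ x := (at2 ψ hψ2 x hx).of_le (by norm_num)
    have gv : ContDiffAt ℝ 1 (fun y => g (v y)) x := hg.contDiffAt.comp x v1
    have Gv : ContDiffAt ℝ 1 (fun y => G (v y)) x := hG.contDiffAt.comp x v1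
    exact ((((gv.pow 2).mul (at1 φ hφ2 x hx (e i))).div φ1 (hφp x hx).ne').add
      (((gv.pow 2).mul (at1 ψ hψ2 x hx (e i))).div ψ1 (hψp x hx).ne')).sub
      (contDiffAt_const.mul (Gv.mul (at1 v hv2 x hx (e i))))
  have hZ1 : ∀ i, ContDiff ℝ 1 (Z i) := by
    intro i
    rw [contDiff_iff_contDiffAt]
    intro x
    by_cases hx : x ∈ K
    · exact (hW1 i x (hKΩ hx)).congr_of_eventuallyEq (hZW i x (hKΩ hx))
    · exact contDiffAt_const.congr_of_eventuallyEq (hZnull i x hx)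
  have hZc : ∀ i, HasCompactSupport (Z i) := fun i => HasCompactSupport.intro hKc (hZ0 i)
  have hint : ∀ i, Integrable (fun x => fderiv ℝ (Z i) x (e i)) ∧
      ∫ x, fderiv ℝ (Z i) x (e i) = 0 := fun i =>
    integral_fderiv_apply_zero (Z i) (hZ1 i) (hZc i) (e i)
  have hsum : ∫ x in Ω, ∑ i, fderiv ℝ (Z i) x (e i) = 0 := by
    rw [setIntegral_eq_integral_of_forall_compl_eq_zero, integral_finsetSum]
    · exact Finset.sum_eq_zero fun i _ => (hint i).2
    · exact fun i _ => (hint i).1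
    · intro x hx
      refine Finset.sum_eq_zero fun i _ => ?_
      rw [(hZnull i x (fun h => hx (hKΩ h))).fderiv_eq]
      simp
  -- pointwise inequality
  have hpt : ∀ x ∈ Ω, ∑ i, fderiv ℝ (Z i) x (e i) ≤
      2 * (lam * exp (u x) * G (v x) -
      Real.sqrt (lam * mu) * (exp ((u x + v x) / 2) * g (v x) ^ 2)) := by
    intro x hx
    have dv : DifferentiableAt ℝ v x := (at2 v hv2 x hx).differentiableAt (by norm_num)
    have dφ : DifferentiableAt ℝ φ x := (at2 φ hφ2 x hx).differentiableAt (by norm_num)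
    have dψ : DifferentiableAt ℝ ψ x := (at2 ψ hψ2 x hx).differentiableAt (by norm_num)
    have fp := hφp x hx
    have pp := hψp x hx
    have hterm : ∀ i, fderiv ℝ (Z i) x (e i) ≤
        g (v x) ^ 2 * (fderiv ℝ (fun y => fderiv ℝ φ y (e i)) x (e i) / φ x) +
        g (v x) ^ 2 * (fderiv ℝ (fun y => fderiv ℝ ψ y (e i)) x (e i) / ψ x) -
        2 * (G (v x) * fderiv ℝ (fun y => fderiv ℝ v y (e i)) x (e i)) := by
      intro i
      rw [(hZW i x hx).fderiv_eq]
      have L := hasDerivAt_line ((hW1 i x hx).differentiableAt (by norm_num)) (e i)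
      have Lv := hasDerivAt_line dv (e i)
      have Lφ := hasDerivAt_line dφ (e i)
      have Lψ := hasDerivAt_line dψ (e i)
      have Lv2 := hasDerivAt_line ((at1 v hv2 x hx (e i)).differentiableAt (by norm_num)) (e i)
      have Lφ2 := hasDerivAt_line ((at1 φ hφ2 x hx (e i)).differentiableAt (by norm_num)) (e i)
      have Lψ2 := hasDerivAt_line ((at1 ψ hψ2 x hx (e i)).differentiableAt (by norm_num)) (e i)
      have Lg : HasDerivAt (fun t : ℝ => g (v (x + t • e i)))
          (d (v x) * fderiv ℝ v x (e i)) 0 :=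
        HasDerivAt.comp (h := fun t : ℝ => v (x + t • e i)) (0 : ℝ) (by simpa using hg' (v x)) Lv
      have LG : HasDerivAt (fun t : ℝ => G (v (x + t • e i)))
          (d (v x) ^ 2 * fderiv ℝ v x (e i)) 0 :=
        HasDerivAt.comp (h := fun t : ℝ => v (x + t • e i)) (0 : ℝ) (by simpa using hG' (v x)) Lv
      have R := ((((Lg.fun_pow 2).fun_mul Lφ2).fun_div Lφ (by simpa using fp.ne')).fun_add
        (((Lg.fun_pow 2).fun_mul Lψ2).fun_div Lψ (by simpa using pp.ne'))).fun_sub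
        ((LG.fun_mul Lv2).const_mul 2)
      have E := L.unique R
      rw [E]
      simp only [zero_smul, add_zero]
      have i1 := pointwise_ineq (fderiv ℝ (fun y => fderiv ℝ φ y (e i)) x (e i)) (g (v x)) (φ x)
        (fderiv ℝ φ x (e i)) (d (v x) * fderiv ℝ v x (e i)) fp
      have i2 := pointwise_ineq (fderiv ℝ (fun y => fderiv ℝ ψ y (e i)) x (e i)) (g (v x)) (ψ x)
        (fderiv ℝ ψ x (e i)) (d (v x) * fderiv ℝ v x (e i)) pp
      refine le_trans (le_of_eq ?_) (le_trans (sub_le_sub_right (add_le_add i1 i2)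
        (2 * (d (v x) ^ 2 * fderiv ℝ v x (e i) * fderiv ℝ v x (e i)
          + G (v x) * fderiv ℝ (fun y => fderiv ℝ v y (e i)) x (e i)))) (le_of_eq ?_))
      · push_cast
        field_simp
      · ring
    have hs := Finset.sum_le_sum (s := Finset.univ) fun i _ => hterm i
    refine hs.trans ?_
    have hv' := hv x hx
    have hφ' := hφ x hx
    have hψ' := hψ x hx
    have hsumeq : ∑ i, (g (v x) ^ 2 * (fderiv ℝ (fun y => fderiv ℝ φ y (e i)) x (e i) / φ x) +
        g (v x) ^ 2 * (fderiv ℝ (fun y => fderiv ℝ ψ y (e i)) x (e i) / ψ x) -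
        2 * (G (v x) * fderiv ℝ (fun y => fderiv ℝ v y (e i)) x (e i))) =
        g (v x) ^ 2 * (lap φ x / φ x) + g (v x) ^ 2 * (lap ψ x / ψ x)
          - 2 * (G (v x) * lap v x) := by
      simp only [Finset.sum_sub_distrib, Finset.sum_add_distrib, ← Finset.mul_sum,
        ← Finset.sum_div]
      rfl
    rw [hsumeq]
    have e1 : lap φ x / φ x = - (mu * exp (v x) * ψ x / φ x) - lam1 := by
      field_simp; linarith
    have e2 : lap ψ x / ψ x = - (lam * exp (u x) * φ x / ψ x) - lam1 := by
      field_simp; linarith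
    have e3 : lap v x = - (lam * exp (u x)) := by linarith
    rw [e1, e2, e3]
    have am := amgm_exp lam mu (u x) (v x) (φ x) (ψ x) hlam hmu fp pp
    have := mul_le_mul_of_nonneg_left am (sq_nonneg (g (v x)))
    have := mul_nonneg (sq_nonneg (g (v x))) hl1
    linarith
  have huc : ContinuousOn u (closure Ω) := hu2.continuousOn
  have hvc : ContinuousOn v (closure Ω) := hv2.continuousOn
  have hRint : IntegrableOn (fun x => lam * exp (u x) * G (v x) -
      Real.sqrt (lam * mu) * (exp ((u x + v x) / 2) * g (v x) ^ 2)) Ω := by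
    refine (ContinuousOn.integrableOn_compact hcl ?_).mono_set subset_closure
    have c1 : ContinuousOn (fun x => G (v x)) (closure Ω) := hG.continuous.comp_continuousOn hvc
    have c2 : ContinuousOn (fun x => g (v x)) (closure Ω) := hg.continuous.comp_continuousOn hvc
    exact ((continuousOn_const.mul huc.rexp).mul c1).sub
      (continuousOn_const.mul (((huc.add hvc).div_const 2).rexp.mul (c2.pow 2)))
  have hfin : ∫ x in Ω, ∑ i, fderiv ℝ (Z i) x (e i) ≤ ∫ x in Ω, 2 * (lam * exp (u x) * G (v x) -
      Real.sqrt (lam * mu) * (exp ((u x + v x) / 2) * g (v x) ^ 2)) := by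
    refine setIntegral_mono_on ?_ (hRint.const_mul 2) hΩo.measurableSet hpt
    exact (integrable_finsetSum _ fun i _ => (hint i).1).integrableOn
  rw [hsum, integral_const_mul] at hfin
  linarith

end key

/-- Cut-off vanishing near `0`. -/
noncomputable def cutoff (n : ℕ) (t : ℝ) : ℝ := min 1 (max 0 (((n : ℝ) + 1) * |t| - 1))

/-- Derivative of the test nonlinearity. -/
noncomputable def dcut (n : ℕ) (t : ℝ) : ℝ := cutoff n t * (exp (t / 2) / 2)

lemma cutoff_cont (n : ℕ) : Continuous (cutoff n) := by
  unfold cutoff; fun_prop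

lemma dcut_cont (n : ℕ) : Continuous (dcut n) := by
  have := cutoff_cont n
  unfold dcut; fun_prop

lemma cutoff_nonneg (n : ℕ) (t : ℝ) : 0 ≤ cutoff n t := le_min zero_le_one (le_max_left _ _)

lemma cutoff_le_one (n : ℕ) (t : ℝ) : cutoff n t ≤ 1 := min_le_left _ _

lemma cutoff_small (n : ℕ) (t : ℝ) (ht : |t| < 1 / ((n : ℝ) + 1)) : cutoff n t = 0 := by
  have h : ((n : ℝ) + 1) * |t| - 1 ≤ 0 := by
    rw [lt_div_iff₀ (by positivity)] at ht
    linarith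
  simp [cutoff, max_eq_left h]

lemma cutoff_tendsto (t : ℝ) (ht : t ≠ 0) : Tendsto (fun n => cutoff n t) atTop (𝓝 1) := by
  refine tendsto_const_nhds.congr' ?_
  obtain ⟨m, hm⟩ := exists_nat_gt (2 / |t|)
  have h0 : 0 < |t| := abs_pos.2 ht
  filter_upwards [eventually_ge_atTop m] with n hn
  have h2 : (m : ℝ) ≤ n := by exact_mod_cast hn
  rw [div_lt_iff₀ h0] at hm
  have h3 : 1 ≤ ((n : ℝ) + 1) * |t| - 1 := by nlinarith
  rw [cutoff, max_eq_right (by linarith), min_eq_left h3]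

lemma prim_small (d : ℝ → ℝ) (ε : ℝ) (h : ∀ t, |t| < ε → d t = 0) (t : ℝ) (ht : |t| < ε) :
    ∫ s in (0:ℝ)..t, d s = 0 := by
  refine intervalIntegral.integral_zero_ae (Eventually.of_forall fun s hs => h s ?_)
  refine lt_of_le_of_lt ?_ ht
  have := Set.abs_sub_left_of_mem_uIcc (Set.uIoc_subset_uIcc hs)
  simpa using this

lemma integral_exp_half (t : ℝ) : ∫ s in (0:ℝ)..t, exp (s / 2) / 2 = exp (t / 2) - 1 := by
  have h : ∀ s ∈ Set.uIcc 0 t, HasDerivAt (fun s : ℝ => exp (s / 2)) (exp (s / 2) / 2) s := by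
    intro s _
    have := ((hasDerivAt_id s).div_const 2).exp
    simpa [div_eq_mul_inv] using this
  rw [intervalIntegral.integral_eq_sub_of_hasDerivAt h
    (Continuous.intervalIntegrable (by fun_prop) _ _)]
  simp

lemma dcut_abs_le (n : ℕ) (s : ℝ) : ‖dcut n s‖ ≤ exp (s / 2) / 2 := by
  have h0 := cutoff_nonneg n s
  have h1 := cutoff_le_one n s
  have h2 : 0 < exp (s / 2) / 2 := by positivity
  rw [dcut, Real.norm_of_nonneg (mul_nonneg h0 h2.le)]
  nlinarith

lemma gcut_abs_le (n : ℕ) (t : ℝ) : |∫ s in (0:ℝ)..t, dcut n s| ≤ |exp (t / 2) - 1| := by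
  rw [← integral_exp_half t]
  exact intervalIntegral.norm_integral_le_abs_of_norm_le
    (Eventually.of_forall fun s => dcut_abs_le n s)
    (Continuous.intervalIntegrable (by fun_prop) _ _)

lemma gcut_tendsto (t : ℝ) :
    Tendsto (fun n => ∫ s in (0:ℝ)..t, dcut n s) atTop (𝓝 (exp (t / 2) - 1)) := by
  rw [← integral_exp_half t]
  refine intervalIntegral.tendsto_integral_filter_of_dominated_convergence
    (fun s => exp (s / 2) / 2) ?_ ?_ ?_ ?_
  · exact Eventually.of_forall fun n => (dcut_cont n).aestronglyMeasurable
  · exact Eventually.of_forall fun n => Eventually.of_forall fun s _ => dcut_abs_le n s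
  · exact Continuous.intervalIntegrable (by fun_prop) _ _
  · have : ∀ᵐ s : ℝ, s ≠ 0 := by simp [ae_iff]
    filter_upwards [this] with s hs _
    simpa [dcut] using (cutoff_tendsto s hs).mul_const (exp (s / 2) / 2)

lemma Gcut_le (n : ℕ) (t : ℝ) : ∫ s in (0:ℝ)..t, dcut n s ^ 2 ≤ exp t / 4 := by
  have hc : Continuous fun s => dcut n s ^ 2 := (dcut_cont n).pow 2
  rcases le_total 0 t with ht | ht
  · have h1 : ∫ s in (0:ℝ)..t, dcut n s ^ 2 ≤ ∫ s in (0:ℝ)..t, exp s / 4 := by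
      refine intervalIntegral.integral_mono_on ht (hc.intervalIntegrable _ _)
        (Continuous.intervalIntegrable (by fun_prop) _ _) fun s _ => ?_
      have h := dcut_abs_le n s
      have h2 : dcut n s ^ 2 ≤ (exp (s / 2) / 2) ^ 2 := sq_le_sq' (by
        have := neg_abs_le (dcut n s); rw [Real.norm_eq_abs] at h; linarith)
        ((le_abs_self _).trans h)
      refine h2.trans (le_of_eq ?_)
      rw [div_pow, ← Real.exp_nat_mul]
      norm_num
      congr 1
      ring
    refine h1.trans ?_
    rw [intervalIntegral.integral_div, integral_exp, exp_zero]
    linarith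
  · rw [intervalIntegral.integral_symm]
    have h0 : 0 ≤ ∫ s in t..(0:ℝ), dcut n s ^ 2 :=
      intervalIntegral.integral_nonneg ht fun s _ => sq_nonneg _
    have := exp_pos t
    linarith

/-- For a stable classical solution of the Gelfand system,
`λ ∫ e^{u+v} ≥ 4 √(λμ) ∫ e^{(u+v)/2} (e^{v/2} − 1)²`. -/
theorem stable_exp_inequality {N : ℕ}
    (Ω : Set (EuclideanSpace ℝ (Fin N))) (hΩ : IsBoundedDomain Ω)
    (lam mu : ℝ) (hlam : 0 < lam) (hmu : 0 < mu)
    (u v : EuclideanSpace ℝ (Fin N) → ℝ)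
    (huv : IsStableGelfandSolution Ω lam mu u v) :
    lam * ∫ x in Ω, exp (u x + v x) ≥
      4 * Real.sqrt (lam * mu) *
        ∫ x in Ω, exp ((u x + v x) / 2) * (exp (v x / 2) - 1) ^ 2 := by
  have hcl : IsCompact (closure Ω) := hΩ.2.2.isCompact_closure
  have hm : MeasurableSet Ω := hΩ.1.measurableSet
  have huc : ContinuousOn u (closure Ω) := huv.1.1.continuousOn
  have hvc : ContinuousOn v (closure Ω) := huv.1.2.1.continuousOn
  have hio : ∀ f : EuclideanSpace ℝ (Fin N) → ℝ, ContinuousOn f (closure Ω) →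
      IntegrableOn f Ω := fun f hf => (hf.integrableOn_compact hcl).mono_set subset_closure
  let g : ℕ → ℝ → ℝ := fun n t => ∫ s in (0:ℝ)..t, dcut n s
  let G : ℕ → ℝ → ℝ := fun n t => ∫ s in (0:ℝ)..t, dcut n s ^ 2
  have cg : ∀ n, ContinuousOn (fun x => g n (v x)) (closure Ω) := fun n =>
    (prim_facts _ (dcut_cont n)).2.continuous.comp_continuousOn hvc
  have cG : ∀ n, ContinuousOn (fun x => G n (v x)) (closure Ω) := fun n =>
    (prim_facts _ ((dcut_cont n).pow 2)).2.continuous.comp_continuousOn hvc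
  have hstep : ∀ n, Real.sqrt (lam * mu) * ∫ x in Ω, exp ((u x + v x) / 2) * g n (v x) ^ 2 ≤
      lam / 4 * ∫ x in Ω, exp (u x + v x) := by
    intro n
    have hd0 : ∀ t, |t| < 1 / ((n : ℝ) + 1) → dcut n t = 0 := fun t ht => by
      simp [dcut, cutoff_small n t ht]
    have hk := key_estimate Ω hΩ lam mu hlam hmu u v huv (g n) (G n) (dcut n) (1 / ((n : ℝ) + 1))
      (by positivity) (prim_facts _ (dcut_cont n)).2 (prim_facts _ ((dcut_cont n).pow 2)).2
      (prim_facts _ (dcut_cont n)).1 (prim_facts _ ((dcut_cont n).pow 2)).1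
      (prim_small _ _ hd0) (prim_small _ _ fun t ht => by simp [hd0 t ht])
    have cgn := cg n
    have cGn := cG n
    have i1 : IntegrableOn (fun x => lam * exp (u x) * G n (v x)) Ω :=
      hio _ ((continuousOn_const.mul huc.rexp).mul cGn)
    have i2 : IntegrableOn (fun x => Real.sqrt (lam * mu) *
      (exp ((u x + v x) / 2) * g n (v x) ^ 2)) Ω :=
      hio _ (continuousOn_const.mul (((huc.add hvc).div_const 2).rexp.mul (cgn.pow 2)))
    have i3 : IntegrableOn (fun x => lam / 4 * exp (u x + v x)) Ω := hio _ (by fun_prop)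
    rw [integral_sub i1 i2, integral_const_mul] at hk
    have hle : ∫ x in Ω, lam * exp (u x) * G n (v x) ≤ ∫ x in Ω, lam / 4 * exp (u x + v x) := by
      refine setIntegral_mono_on i1 i3 hm fun x _ => ?_
      have := mul_le_mul_of_nonneg_left (Gcut_le n (v x)) (mul_pos hlam (exp_pos (u x))).le
      refine this.trans (le_of_eq ?_)
      rw [exp_add]; ring
    rw [integral_const_mul] at hle
    linarith
  have hlim : Tendsto (fun n => ∫ x in Ω, exp ((u x + v x) / 2) * g n (v x) ^ 2) atTop
      (𝓝 (∫ x in Ω, exp ((u x + v x) / 2) * (exp (v x / 2) - 1) ^ 2)) := by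
    refine tendsto_integral_of_dominated_convergence
      (fun x => exp ((u x + v x) / 2) * (exp (v x / 2) - 1) ^ 2) ?_ ?_ ?_ ?_
    · intro n
      have cgn := cg n
      exact (hio (fun x => exp ((u x + v x) / 2) * g n (v x) ^ 2)
        (((huc.add hvc).div_const 2).rexp.mul (cgn.pow 2))).1
    · exact hio _ (by fun_prop)
    · intro n
      refine Eventually.of_forall fun x => ?_
      rw [Real.norm_of_nonneg (by positivity)]
      exact mul_le_mul_of_nonneg_left (sq_le_sq.2 (gcut_abs_le n (v x))) (exp_pos _).le
    · exact Eventually.of_forall fun x => ((gcut_tendsto (v x)).pow 2).const_mul _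
  have := le_of_tendsto (hlim.const_mul (Real.sqrt (lam * mu))) (Eventually.of_forall hstep)
  linarith
end

section
/- Let Ω ⊂ ℝ^N be a smoothly bounded domain, λ, μ > 0, and (u, v) a stable classical solution of the Gelfand system. Then λ ∫_Ω e^{u+v} dx + 8 √(λμ) ∫_Ω e^{(u+v)/2} dx ≥ 2 √(λμ) ∫_Ω e^{(u+v)/2} e^{v} dx, and symmetrically μ ∫_Ω e^{u+v} dx + 8 √(λμ) ∫_Ω e^{(u+v)/2} dx ≥ 2 √(λμ) ∫_Ω e^{(u+v)/2} e^{u} dx. -/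
open MeasureTheory Real
open scoped RealInnerProductSpace

/-- The cut-off of the exponential used to build test functions. -/
lemma exists_testfun : ∃ h h' g : ℝ → ℝ, Continuous h' ∧ (∀ t, HasDerivAt h (h' t) t) ∧
    (∀ t, HasDerivAt g (h' t ^ 2) t) ∧ (∀ t ≤ 1/4, h t = 0) ∧ (∀ t ≤ 1/4, g t = 0) ∧
    (∀ t, 4 * g t ≤ exp t) ∧ (∀ t, exp t / 2 - 2 ≤ h t ^ 2) := by
  set χ : ℝ → ℝ := fun s => max 0 (min 1 (4 * s - 1)) with hχ
  set h' : ℝ → ℝ := fun s => χ s * (exp (s / 2) / 2) with hh'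
  have hχ0 : ∀ s, 0 ≤ χ s := fun s => le_max_left _ _
  have hχ1 : ∀ s, χ s ≤ 1 := fun s => max_le (by norm_num) (min_le_left _ _)
  have hχz : ∀ s ≤ 1/4, χ s = 0 := fun s hs =>
    max_eq_left ((min_le_right _ _).trans (by linarith))
  have hχo : ∀ s, 1/2 ≤ s → χ s = 1 := fun s hs => by
    simp only [hχ]
    rw [min_eq_left (by linarith)]; norm_num
  have hc : Continuous h' := by simp only [hh', hχ]; fun_prop
  have hc2 : Continuous (fun s => h' s ^ 2) := hc.pow 2
  set h : ℝ → ℝ := fun t => ∫ s in (1/4 : ℝ)..t, h' s with hh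
  set g : ℝ → ℝ := fun t => ∫ s in (1/4 : ℝ)..t, h' s ^ 2 with hg
  have hd : ∀ t, HasDerivAt h (h' t) t := fun t => (hc.integral_hasStrictDerivAt _ t).hasDerivAt
  have gd : ∀ t, HasDerivAt g (h' t ^ 2) t :=
    fun t => (hc2.integral_hasStrictDerivAt _ t).hasDerivAt
  have h'z : ∀ s ≤ 1/4, h' s = 0 := fun s hs => by simp [hh', hχz s hs]
  have hz : ∀ t ≤ 1/4, h t = 0 := fun t ht => by
    simp only [hh]
    rw [intervalIntegral.integral_congr (g := fun _ => (0:ℝ))]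
    · simp
    · intro s hs
      rw [Set.uIcc_of_ge ht] at hs
      exact h'z s hs.2
  have gz : ∀ t ≤ 1/4, g t = 0 := fun t ht => by
    simp only [hg]
    rw [intervalIntegral.integral_congr (g := fun _ => (0:ℝ))]
    · simp
    · intro s hs
      rw [Set.uIcc_of_ge ht] at hs
      simp [h'z s hs.2]
  have esq : ∀ s : ℝ, exp (s/2) ^ 2 = exp s := fun s => by
    rw [← Real.exp_nat_mul]; congr 1; push_cast; ring
  have hmono : Monotone h := monotone_of_deriv_nonneg (fun t => (hd t).differentiableAt)
    (fun t => by rw [(hd t).deriv]; exact mul_nonneg (hχ0 t) (by positivity))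
  refine ⟨h, h', g, hc, hd, gd, hz, gz, ?_, ?_⟩
  · have hF : ∀ t, HasDerivAt (fun t => exp t - 4 * g t) (exp t - 4 * h' t ^ 2) t :=
      fun t => (Real.hasDerivAt_exp t).sub ((gd t).const_mul 4)
    have hm : Monotone (fun t => exp t - 4 * g t) :=
      monotone_of_deriv_nonneg (fun t => (hF t).differentiableAt) (fun t => by
        rw [(hF t).deriv]
        simp only [hh']
        have : χ t ^ 2 ≤ 1 := pow_le_one₀ (hχ0 t) (hχ1 t)
        have e := esq t
        have := mul_le_mul_of_nonneg_right this (Real.exp_pos t).le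
        have : 4 * (χ t * (exp (t/2) / 2)) ^ 2 = χ t ^ 2 * exp t := by rw [← e]; ring
        linarith)
    intro t
    rcases le_total t (1/4) with ht | ht
    · rw [gz t ht]; have := Real.exp_pos t; linarith
    · have := hm ht
      simp only [gz (1/4) le_rfl] at this
      have := Real.exp_pos (1/4)
      linarith
  · intro t
    have e := esq t
    have c1 := esq (1/2)
    have c2 := esq 1
    have hc1 : exp ((1:ℝ)/2) ≤ 2 := by
      have := Real.exp_one_lt_d9
      have := Real.exp_pos ((1:ℝ)/2)
      nlinarith
    have hcp := Real.exp_pos ((1:ℝ)/2/2)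
    have hap := Real.exp_pos (t/2)
    rcases le_total (exp (t/2)) 2 with ha | ha
    · have := sq_nonneg (h t)
      nlinarith
    · have ht : 1/2 ≤ t := by
        by_contra hlt
        push Not at hlt
        have : exp (t/2) < exp ((1:ℝ)/2/2) := Real.exp_lt_exp.2 (by linarith)
        nlinarith
      have hm : MonotoneOn (fun t => h t - exp (t/2)) (Set.Ici (1/2)) := by
        have hG : ∀ t, HasDerivAt (fun t => h t - exp (t/2)) (h' t - exp (t/2) * (1/2)) t :=
          fun t => (hd t).sub (((hasDerivAt_id t).div_const 2).exp)
        apply monotoneOn_of_deriv_nonneg (convex_Ici _)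
        · exact fun t _ => (hG t).continuousAt.continuousWithinAt
        · exact fun t _ => (hG t).differentiableAt.differentiableWithinAt
        · intro s hs
          rw [interior_Ici] at hs
          rw [(hG s).deriv]
          simp only [hh', hχo s hs.le]
          linarith
      have h1 := hm (Set.mem_Ici.2 le_rfl) (Set.mem_Ici.2 ht) ht
      have h2 : 0 ≤ h (1/2) := by
        rw [← hz (1/4) le_rfl]; exact hmono (by norm_num)
      simp only at h1
      have h3 : exp (t/2) - exp ((1:ℝ)/2/2) ≤ h t := by linarith
      have h4 : exp ((1:ℝ)/2/2) ≤ exp (t/2) := by nlinarith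
      have h5 : (exp (t/2) - exp ((1:ℝ)/2/2))^2 ≤ h t ^ 2 :=
        pow_le_pow_left₀ (by linarith) h3 2
      nlinarith [sq_nonneg (exp (t/2) - 2 * exp ((1:ℝ)/2/2))]

/-- The integral of a directional derivative of a compactly supported `C¹` function vanishes. -/
lemma integral_dir_deriv_zero {N : ℕ} (W : EuclideanSpace ℝ (Fin N) → ℝ) (hW : ContDiff ℝ 1 W)
    (hs : HasCompactSupport W) (e : EuclideanSpace ℝ (Fin N)) :
    Integrable (fun x => fderiv ℝ W x e) ∧ ∫ x, fderiv ℝ W x e = 0 := by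
  have hi : Integrable (fun x => fderiv ℝ W x e) := by
    apply Continuous.integrable_of_hasCompactSupport
    · exact (hW.continuous_fderiv (by norm_num)).clm_apply continuous_const
    · exact hs.fderiv_apply ℝ e
  refine ⟨hi, ?_⟩
  have := integral_mul_fderiv_eq_neg_fderiv_mul_of_integrable (μ := volume) (𝕜 := ℝ)
    (f := fun _ : EuclideanSpace ℝ (Fin N) => (1:ℝ)) (g := W) (v := e)
    (by simp) (by simpa using hi)
    (by simpa using hW.continuous.integrable_of_hasCompactSupport hs)
    (fun x _ => differentiableAt_const _) (fun x _ => hW.differentiable (by norm_num) x)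
  simpa using this

/-- The pointwise derivative of the vector field. -/
lemma field_deriv {E : Type*} [NormedAddCommGroup E] [NormedSpace ℝ E]
    {u p q a b c : E → ℝ} {h h' g : ℝ → ℝ} (x e : E)
    (hd : ∀ t, HasDerivAt h (h' t) t) (gd : ∀ t, HasDerivAt g (h' t ^ 2) t)
    (hu : DifferentiableAt ℝ u x) (hp : DifferentiableAt ℝ p x) (hq : DifferentiableAt ℝ q x)
    (ha : DifferentiableAt ℝ a x) (hb : DifferentiableAt ℝ b x) (hc : DifferentiableAt ℝ c x)
    (hp0 : 0 < p x) (hq0 : 0 < q x)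
    (eu : fderiv ℝ u x e = a x) (ep : fderiv ℝ p x e = b x) (eq : fderiv ℝ q x e = c x) :
    fderiv ℝ (fun y => h (u y) ^ 2 * (b y / p y + c y / q y) - 2 * g (u y) * a y) x e ≤
      h (u x) ^ 2 * (fderiv ℝ b x e / p x + fderiv ℝ c x e / q x)
        - 2 * g (u x) * fderiv ℝ a x e := by
  have line : ∀ {f : E → ℝ}, DifferentiableAt ℝ f x →
      HasDerivAt (fun t : ℝ => f (x + t • e)) (fderiv ℝ f x e) 0 := fun {f} hf =>
    hf.hasFDerivAt.hasLineDerivAt e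
  have z : x + (0:ℝ) • e = x := by simp
  have dh : HasDerivAt (fun t : ℝ => h (u (x + t • e))) (h' (u x) * a x) 0 := by
    have := (hd (u (x + (0:ℝ) • e))).comp (0:ℝ) (line hu)
    simpa [Function.comp_def, eu] using this
  have dg : HasDerivAt (fun t : ℝ => g (u (x + t • e))) (h' (u x) ^ 2 * a x) 0 := by
    have := (gd (u (x + (0:ℝ) • e))).comp (0:ℝ) (line hu)
    simpa [Function.comp_def, eu] using this
  have hF : DifferentiableAt ℝ
      (fun y => h (u y) ^ 2 * (b y / p y + c y / q y) - 2 * g (u y) * a y) x := by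
    have h1 : DifferentiableAt ℝ (fun y => h (u y)) x :=
      (hd (u x)).differentiableAt.comp x hu
    have h2 : DifferentiableAt ℝ (fun y => g (u y)) x :=
      (gd (u x)).differentiableAt.comp x hu
    have ip : DifferentiableAt ℝ (fun y => (p y)⁻¹) x :=
      (differentiableAt_inv hp0.ne').comp x hp
    have iq : DifferentiableAt ℝ (fun y => (q y)⁻¹) x :=
      (differentiableAt_inv hq0.ne').comp x hq
    simp only [div_eq_mul_inv]
    exact ((h1.pow 2).mul ((hb.mul ip).add (hc.mul iq))).sub
      ((h2.const_mul 2).mul ha)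
  have key := (line hF).unique
    (((dh.pow 2).mul (((line hb).div (line hp) (by simpa using hp0.ne')).add
      ((line hc).div (line hq) (by simpa using hq0.ne')))).sub
      ((dg.const_mul 2).mul (line ha)))
  rw [key]
  simp only [z, ep, eq, Pi.add_apply, Pi.div_apply, Pi.pow_apply]
  have i1 : 0 ≤ (h (u x) * (b x / p x) - h' (u x) * a x) ^ 2 := sq_nonneg _
  have i2 : 0 ≤ (h (u x) * (c x / q x) - h' (u x) * a x) ^ 2 := sq_nonneg _
  have e1 : (fderiv ℝ b x e * p x - b x * b x) / p x ^ 2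
      = fderiv ℝ b x e / p x - (b x / p x) ^ 2 := by field_simp
  have e2 : (fderiv ℝ c x e * q x - c x * c x) / q x ^ 2
      = fderiv ℝ c x e / q x - (c x / q x) ^ 2 := by field_simp
  rw [e1, e2]
  norm_num
  nlinarith

/-- One half of the main result. -/
lemma one_sided {N : ℕ}
    (Ω : Set (EuclideanSpace ℝ (Fin N))) (hΩ : IsBoundedDomain Ω)
    (lam mu : ℝ) (hlam : 0 < lam) (hmu : 0 < mu)
    (u v : EuclideanSpace ℝ (Fin N) → ℝ)
    (huv : IsStableGelfandSolution Ω lam mu u v) :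
    mu * (∫ x in Ω, exp (u x + v x)) +
        8 * Real.sqrt (lam * mu) * ∫ x in Ω, exp ((u x + v x) / 2) ≥
      2 * Real.sqrt (lam * mu) * ∫ x in Ω, exp ((u x + v x) / 2) * exp (u x) := by
  obtain ⟨ho, -, hbd⟩ := hΩ
  obtain ⟨⟨cu, cv, eu, ev, bu, bv⟩, lam1, p, q, hl1, cp, cq, pp, pq, ep, eq, bp, bq⟩ := huv
  obtain ⟨h, h', g, hc, hd, gd, hz, gz, hg4, hh2⟩ := exists_testfun
  have hcpt : IsCompact (closure Ω) := hbd.isCompact_closure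
  have at2 : ∀ {f : EuclideanSpace ℝ (Fin N) → ℝ}, ContDiffOn ℝ 2 f (closure Ω) →
      ∀ x ∈ Ω, ContDiffAt ℝ 2 f x := fun {f} hf x hx =>
    hf.contDiffAt (Filter.mem_of_superset (ho.mem_nhds hx) subset_closure)
  have at1 : ∀ {f : EuclideanSpace ℝ (Fin N) → ℝ}, ContDiffOn ℝ 2 f (closure Ω) →
      ∀ e, ∀ x ∈ Ω, ContDiffAt ℝ 1 (fun y => fderiv ℝ f y e) x := fun {f} hf e x hx =>
    ((at2 hf x hx).fderiv_right (m := 1) (by norm_num)).clm_apply contDiffAt_const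
  have hC1 : ContDiff ℝ 1 h := by
    rw [contDiff_one_iff_deriv]
    exact ⟨fun t => (hd t).differentiableAt, by
      rw [show deriv h = h' from funext fun t => (hd t).deriv]; exact hc⟩
  have gC1 : ContDiff ℝ 1 g := by
    rw [contDiff_one_iff_deriv]
    exact ⟨fun t => (gd t).differentiableAt, by
      rw [show deriv g = fun t => h' t ^ 2 from funext fun t => (gd t).deriv]; exact hc.pow 2⟩
  set K : Set (EuclideanSpace ℝ (Fin N)) := closure Ω ∩ u ⁻¹' Set.Ici (1/4) with hK
  have Kcl : IsClosed K := cu.continuousOn.preimage_isClosed_of_isClosed isClosed_closure isClosed_Ici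
  have Kc : IsCompact K := hcpt.of_isClosed_subset Kcl Set.inter_subset_left
  have KΩ : K ⊆ Ω := by
    rintro x ⟨hx, hux⟩
    by_contra hn
    have : x ∈ frontier Ω := by rw [ho.frontier_eq]; exact ⟨hx, hn⟩
    have h0 := bu x this
    simp only [Set.mem_preimage, Set.mem_Ici, h0] at hux
    norm_num at hux
  let e : Fin N → EuclideanSpace ℝ (Fin N) := fun i => EuclideanSpace.single i 1
  let V : Fin N → EuclideanSpace ℝ (Fin N) → ℝ := fun i y =>
    h (u y) ^ 2 * (fderiv ℝ p y (e i) / p y + fderiv ℝ q y (e i) / q y)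
      - 2 * g (u y) * fderiv ℝ u y (e i)
  let W : Fin N → EuclideanSpace ℝ (Fin N) → ℝ := fun i => Ω.indicator (V i)
  have Wz : ∀ i, ∀ x ∉ K, W i x = 0 := by
    intro i x hx
    by_cases hxΩ : x ∈ Ω
    · have : u x ≤ 1/4 := by
        by_contra hlt
        push Not at hlt
        exact hx ⟨subset_closure hxΩ, hlt.le⟩
      simp [W, V, hxΩ, hz _ this, gz _ this]
    · simp [W, hxΩ]
  have WV : ∀ i, ∀ x ∈ Ω, W i =ᶠ[nhds x] V i := fun i x hx => by
    filter_upwards [ho.mem_nhds hx] with y hy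
    simp [W, hy]
  have WC : ∀ i, ContDiff ℝ 1 (W i) := by
    intro i
    rw [contDiff_iff_contDiffAt]
    intro x
    by_cases hx : x ∈ K
    · have hxΩ := KΩ hx
      refine ContDiffAt.congr_of_eventuallyEq ?_ (WV i x hxΩ)
      have u1 := (at2 cu x hxΩ).of_le (m := 1) (by norm_num)
      have p1 := (at2 cp x hxΩ).of_le (m := 1) (by norm_num)
      have q1 := (at2 cq x hxΩ).of_le (m := 1) (by norm_num)
      exact (((hC1.contDiffAt.comp x u1).pow 2).mul
        (((at1 cp (e i) x hxΩ).div p1 (pp x hxΩ).ne').add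
          ((at1 cq (e i) x hxΩ).div q1 (pq x hxΩ).ne'))).sub
        ((contDiffAt_const.mul (gC1.contDiffAt.comp x u1)).mul (at1 cu (e i) x hxΩ))
    · refine ContDiffAt.congr_of_eventuallyEq (contDiffAt_const (c := (0:ℝ))) ?_
      filter_upwards [Kcl.isOpen_compl.mem_nhds hx] with y hy
      exact Wz i y hy
  have Ws : ∀ i, HasCompactSupport (W i) := fun i => HasCompactSupport.intro Kc (Wz i)
  have WI := fun i => integral_dir_deriv_zero (W i) (WC i) (Ws i) (e i)
  have DI : Integrable (fun x => ∑ i, fderiv ℝ (W i) x (e i)) :=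
    integrable_finsetSum _ fun i _ => (WI i).1
  have D0 : ∫ x, ∑ i, fderiv ℝ (W i) x (e i) = 0 := by
    rw [integral_finsetSum _ fun i _ => (WI i).1]
    exact Finset.sum_eq_zero fun i _ => (WI i).2
  have DΩ : ∫ x in Ω, ∑ i, fderiv ℝ (W i) x (e i) = 0 := by
    rw [setIntegral_eq_integral_of_forall_compl_eq_zero, D0]
    intro x hx
    refine Finset.sum_eq_zero fun i _ => ?_
    have : W i =ᶠ[nhds x] fun _ => 0 := by
      filter_upwards [Kcl.isOpen_compl.mem_nhds (fun hk => hx (KΩ hk))] with y hy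
      exact Wz i y hy
    rw [this.fderiv_eq]; simp
  have intg : ∀ {f : EuclideanSpace ℝ (Fin N) → ℝ}, ContinuousOn f (closure Ω) →
      IntegrableOn f Ω := fun {f} hf => (hf.integrableOn_compact hcpt).mono_set subset_closure
  have ku := cu.continuousOn
  have kv := cv.continuousOn
  have I1 : IntegrableOn (fun x => exp (u x + v x)) Ω := intg (by fun_prop)
  have I2 : IntegrableOn (fun x => exp ((u x + v x) / 2)) Ω := intg (by fun_prop)
  have I3 : IntegrableOn (fun x => exp ((u x + v x) / 2) * exp (u x)) Ω := intg (by fun_prop)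
  set s := Real.sqrt (lam * mu) with hs
  have s0 : 0 ≤ s := Real.sqrt_nonneg _
  have s2 : s ^ 2 = lam * mu := Real.sq_sqrt (by positivity)
  have pt : ∀ x ∈ Ω, 2 * ∑ i, fderiv ℝ (W i) x (e i) ≤
      mu * exp (u x + v x) + 8 * s * exp ((u x + v x) / 2)
        - 2 * s * (exp ((u x + v x) / 2) * exp (u x)) := by
    intro x hx
    have P := pp x hx
    have Q := pq x hx
    have A : ∑ i, fderiv ℝ (W i) x (e i) ≤
        h (u x) ^ 2 * (lap p x / p x + lap q x / q x) - 2 * g (u x) * lap u x := by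
      have : h (u x) ^ 2 * (lap p x / p x + lap q x / q x) - 2 * g (u x) * lap u x
          = ∑ i, (h (u x) ^ 2 * (fderiv ℝ (fun y => fderiv ℝ p y (e i)) x (e i) / p x
              + fderiv ℝ (fun y => fderiv ℝ q y (e i)) x (e i) / q x)
              - 2 * g (u x) * fderiv ℝ (fun y => fderiv ℝ u y (e i)) x (e i)) := by
        rw [Finset.sum_sub_distrib, ← Finset.mul_sum, ← Finset.mul_sum, Finset.sum_add_distrib,
          ← Finset.sum_div, ← Finset.sum_div]
        rfl
      rw [this]
      refine Finset.sum_le_sum fun i _ => ?_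
      rw [(WV i x hx).fderiv_eq]
      exact field_deriv x (e i) hd gd ((at2 cu x hx).differentiableAt (by norm_num))
        ((at2 cp x hx).differentiableAt (by norm_num))
        ((at2 cq x hx).differentiableAt (by norm_num))
        ((at1 cu (e i) x hx).differentiableAt (by norm_num))
        ((at1 cp (e i) x hx).differentiableAt (by norm_num))
        ((at1 cq (e i) x hx).differentiableAt (by norm_num)) P Q rfl rfl rfl
    have e1 : lap p x = -(mu * exp (v x) * q x + lam1 * p x) := by linarith [ep x hx]
    have e2 : lap q x = -(lam * exp (u x) * p x + lam1 * q x) := by linarith [eq x hx]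
    have e3 : lap u x = -(mu * exp (v x)) := by linarith [eu x hx]
    have E2 : exp ((u x + v x)/2) ^ 2 = exp (u x) * exp (v x) := by
      rw [← Real.exp_nat_mul, ← Real.exp_add]; congr 1; push_cast; ring
    have E1 : exp (u x + v x) = exp (u x) * exp (v x) := Real.exp_add _ _
    set m := exp ((u x + v x)/2) with hm
    have m0 : 0 < m := Real.exp_pos _
    have U0 := Real.exp_pos (u x)
    have V0 := Real.exp_pos (v x)
    have B : lap p x / p x + lap q x / q x ≤ - (2 * s * m) := by
      rw [e1, e2]
      have r : -(mu * exp (v x) * q x + lam1 * p x) / p x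
          + -(lam * exp (u x) * p x + lam1 * q x) / q x
          = -(mu * exp (v x) * (q x / p x) + lam * exp (u x) * (p x / q x)) - 2 * lam1 := by
        field_simp; ring
      rw [r]
      set α := mu * exp (v x) * (q x / p x) with hα
      set β := lam * exp (u x) * (p x / q x) with hβ
      have α0 : 0 < α := by positivity
      have β0 : 0 < β := by positivity
      have αβ : α * β = (s * m) ^ 2 := by
        rw [mul_pow, s2, E2, hα, hβ]; field_simp
      have : 2 * (s * m) ≤ α + β := by
        apply le_of_sq_le_sq _ (by positivity)
        nlinarith [sq_nonneg (α - β)]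
      linarith
    have C := mul_le_mul_of_nonneg_left B (sq_nonneg (h (u x)))
    have D := mul_le_mul_of_nonneg_left (hh2 (u x)) (mul_nonneg s0 m0.le)
    have F := mul_le_mul_of_nonneg_left (hg4 (u x)) (mul_pos hmu V0).le
    rw [e3] at A
    rw [E1]
    nlinarith
  have M : ∫ x in Ω, 2 * ∑ i, fderiv ℝ (W i) x (e i) ≤
      ∫ x in Ω, (mu * exp (u x + v x) + 8 * s * exp ((u x + v x) / 2)
        - 2 * s * (exp ((u x + v x) / 2) * exp (u x))) :=
    setIntegral_mono_on (DI.integrableOn.const_mul 2)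
      (((I1.const_mul mu).add (I2.const_mul (8 * s))).sub (I3.const_mul (2 * s)))
      ho.measurableSet pt
  have I12 : IntegrableOn
      (fun x => mu * exp (u x + v x) + 8 * s * exp ((u x + v x) / 2)) Ω :=
    (I1.const_mul mu).add (I2.const_mul (8 * s))
  rw [integral_const_mul, DΩ, integral_sub I12
    (I3.const_mul (2 * s)), integral_add (I1.const_mul mu) (I2.const_mul (8 * s)),
    integral_const_mul, integral_const_mul, integral_const_mul] at M
  linarith

/-- For a stable classical solution of the Gelfand system,
`λ ∫ e^{u+v} + 8 √(λμ) ∫ e^{(u+v)/2} ≥ 2 √(λμ) ∫ e^{(u+v)/2} e^v`, and symmetrically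
`μ ∫ e^{u+v} + 8 √(λμ) ∫ e^{(u+v)/2} ≥ 2 √(λμ) ∫ e^{(u+v)/2} e^u`. -/
theorem two_sided_exp_inequalities {N : ℕ}
    (Ω : Set (EuclideanSpace ℝ (Fin N))) (hΩ : IsBoundedDomain Ω)
    (lam mu : ℝ) (hlam : 0 < lam) (hmu : 0 < mu)
    (u v : EuclideanSpace ℝ (Fin N) → ℝ)
    (huv : IsStableGelfandSolution Ω lam mu u v) :
    (lam * (∫ x in Ω, exp (u x + v x)) +
        8 * Real.sqrt (lam * mu) * ∫ x in Ω, exp ((u x + v x) / 2) ≥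
      2 * Real.sqrt (lam * mu) * ∫ x in Ω, exp ((u x + v x) / 2) * exp (v x)) ∧
    (mu * (∫ x in Ω, exp (u x + v x)) +
        8 * Real.sqrt (lam * mu) * ∫ x in Ω, exp ((u x + v x) / 2) ≥
      2 * Real.sqrt (lam * mu) * ∫ x in Ω, exp ((u x + v x) / 2) * exp (u x)) := by
  refine ⟨?_, one_sided Ω hΩ lam mu hlam hmu u v huv⟩
  have hsym : IsStableGelfandSolution Ω mu lam v u := by
    obtain ⟨⟨cu, cv, eu, ev, bu, bv⟩, lam1, p, q, hl1, cp, cq, pp, pq, ep, eq, bp, bq⟩ := huv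
    exact ⟨⟨cv, cu, ev, eu, bv, bu⟩, lam1, q, p, hl1, cq, cp, pq, pp, eq, ep, bq, bp⟩
  have := one_sided Ω hΩ mu lam hmu hlam v u hsym
  simpa only [add_comm, mul_comm mu lam, add_comm (v _) (u _)] using this
end

section
/- Let Ω ⊂ ℝ^N be a smoothly bounded domain, λ, μ > 0, and (u, v) a stable classical solution of the Gelfand system. Then there is a universal constant C > 0 such that C (λ + μ)² (∫_Ω e^{(u+v)/2} dx)² ≥ 2 λμ ∫_Ω e^{(u+v)/2} e^{u} dx · ∫_Ω e^{(u+v)/2} e^{v} dx. -/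
open MeasureTheory Real
open scoped RealInnerProductSpace

open Set

lemma aux_int_zero {N : ℕ} {Ω K : Set (EuclideanSpace ℝ (Fin N))} (hΩ : IsOpen Ω)
    (hK : IsCompact K) (hKΩ : K ⊆ Ω) (g : EuclideanSpace ℝ (Fin N) → ℝ)
    (hg : ContDiffOn ℝ 1 g Ω) (h0 : ∀ x ∈ Ω, x ∉ K → g x = 0)
    (e : EuclideanSpace ℝ (Fin N)) :
    IntegrableOn (fun x => fderiv ℝ g x e) Ω ∧ ∫ x in Ω, fderiv ℝ g x e = 0 := by
  classical
  set G : EuclideanSpace ℝ (Fin N) → ℝ := Ω.indicator g with hG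
  have hGK : ∀ x, x ∉ K → G x = 0 := by
    intro x hx
    by_cases hxΩ : x ∈ Ω
    · simp [hG, hxΩ, h0 x hxΩ hx]
    · simp [hG, hxΩ]
  have hsupp : HasCompactSupport G := HasCompactSupport.intro hK hGK
  have heq : ∀ x ∈ Ω, G =ᶠ[nhds x] g := by
    intro x hx
    filter_upwards [hΩ.mem_nhds hx] with y hy
    simp [hG, hy]
  have heq0 : ∀ x, x ∉ K → G =ᶠ[nhds x] fun _ => 0 := by
    intro x hx
    filter_upwards [hK.isClosed.isOpen_compl.mem_nhds hx] with y hy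
    exact hGK y hy
  have hGd : ContDiff ℝ 1 G := by
    rw [contDiff_iff_contDiffAt]
    intro x
    by_cases hx : x ∈ Ω
    · exact (hg.contDiffAt (hΩ.mem_nhds hx)).congr_of_eventuallyEq (heq x hx)
    · exact contDiffAt_const.congr_of_eventuallyEq (heq0 x (fun h => hx (hKΩ h)))
  have hcont : Continuous (fun x => fderiv ℝ G x e) :=
    (hGd.continuous_fderiv (by norm_num)).clm_apply continuous_const
  have hcs : HasCompactSupport (fun x => fderiv ℝ G x e) := hsupp.fderiv_apply (𝕜 := ℝ) e
  have hint : Integrable (fun x => fderiv ℝ G x e) := hcont.integrable_of_hasCompactSupport hcs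
  have hintG : Integrable G := hGd.continuous.integrable_of_hasCompactSupport hsupp
  have hzero : ∫ x, fderiv ℝ G x e = 0 := by
    have := integral_mul_fderiv_eq_neg_fderiv_mul_of_integrable (𝕜 := ℝ) (f := G) (g := fun _ => (1:ℝ)) (v := e) (μ := volume)
      (by simpa using hint) (by simp) (by simpa using hintG)
      (fun x _ => hGd.differentiable (by norm_num) x) (fun x _ => by fun_prop)
    simpa using this
  have hfe : ∀ x ∈ Ω, fderiv ℝ G x e = fderiv ℝ g x e := by
    intro x hx
    rw [(heq x hx).fderiv_eq]
  constructor
  · exact (integrableOn_congr_fun hfe hΩ.measurableSet).1 hint.integrableOn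
  · rw [← setIntegral_congr_fun hΩ.measurableSet hfe, ← hzero]
    apply setIntegral_eq_integral_of_forall_compl_eq_zero
    intro x hx
    rw [(heq0 x (fun h => hx (hKΩ h))).fderiv_eq]
    simp

lemma aux_div {N : ℕ} {Ω K : Set (EuclideanSpace ℝ (Fin N))} (hΩ : IsOpen Ω)
    (hK : IsCompact K) (hKΩ : K ⊆ Ω) (q w : EuclideanSpace ℝ (Fin N) → ℝ)
    (hq : ContDiffOn ℝ 1 q Ω) (hw : ContDiffOn ℝ 2 w Ω) (h0 : ∀ x ∈ Ω, x ∉ K → q x = 0) :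
    IntegrableOn (fun x => q x * lap w x + ∑ i : Fin N,
      fderiv ℝ q x (EuclideanSpace.single i 1) * fderiv ℝ w x (EuclideanSpace.single i 1)) Ω ∧
    ∫ x in Ω, (q x * lap w x + ∑ i : Fin N,
      fderiv ℝ q x (EuclideanSpace.single i 1) * fderiv ℝ w x (EuclideanSpace.single i 1)) = 0 := by
  have hdw : ∀ i : Fin N, ContDiffOn ℝ 1 (fun y => fderiv ℝ w y (EuclideanSpace.single i 1)) Ω :=
    fun i => (hw.fderiv_of_isOpen hΩ (by norm_num)).clm_apply contDiffOn_const
  have key : ∀ i : Fin N, _ := fun i => aux_int_zero hΩ hK hKΩ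
    (fun y => q y * fderiv ℝ w y (EuclideanSpace.single i 1)) (hq.mul (hdw i))
    (fun x hx hxK => by simp [h0 x hx hxK]) (EuclideanSpace.single i 1)
  have hfe : ∀ x ∈ Ω, ∑ i : Fin N, fderiv ℝ (fun y => q y * fderiv ℝ w y (EuclideanSpace.single i 1)) x
      (EuclideanSpace.single i 1) = q x * lap w x + ∑ i : Fin N,
      fderiv ℝ q x (EuclideanSpace.single i 1) * fderiv ℝ w x (EuclideanSpace.single i 1) := by
    intro x hx
    rw [lap, Finset.mul_sum, ← Finset.sum_add_distrib]
    refine Finset.sum_congr rfl fun i _ => ?_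
    have h1 := (hq.contDiffAt (hΩ.mem_nhds hx)).differentiableAt (by norm_num)
    have h2 := ((hdw i).contDiffAt (hΩ.mem_nhds hx)).differentiableAt (by norm_num)
    rw [fderiv_fun_mul h1 h2]
    simp
    ring
  constructor
  · exact (integrableOn_congr_fun hfe hΩ.measurableSet).1
      (integrable_finsetSum _ fun i _ => (key i).1)
  · rw [← setIntegral_congr_fun hΩ.measurableSet hfe, integral_finsetSum _ fun i _ => (key i).1]
    exact Finset.sum_eq_zero fun i _ => (key i).2

lemma aux_m (x : ℝ) : HasDerivAt (fun x : ℝ => (max x 0)^2) (2 * max x 0) x := by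
  rcases lt_trichotomy x 0 with h | h | h
  · rw [max_eq_right h.le, mul_zero]
    refine (hasDerivAt_const x (0:ℝ)).congr_of_eventuallyEq ?_
    filter_upwards [Iio_mem_nhds h] with y hy
    simp [max_eq_right (le_of_lt (mem_Iio.1 hy))]
  · subst h
    rw [hasDerivAt_iff_isLittleO]
    simp only [max_self, sub_zero, mul_zero, smul_zero, ne_eq, OfNat.ofNat_ne_zero, not_false_eq_true, zero_pow]
    have : (fun x : ℝ => (max x 0)^2) =O[nhds 0] fun x : ℝ => x^2 := by
      apply Asymptotics.IsBigO.of_bound 1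
      filter_upwards with y
      rw [one_mul, norm_pow, norm_pow]
      gcongr
      simp only [Real.norm_eq_abs]
      rcases le_total y 0 with h | h <;> simp [h]
    refine this.trans_isLittleO ?_
    exact Asymptotics.isLittleO_pow_id (by norm_num)
  · rw [max_eq_left h.le]
    have := hasDerivAt_pow 2 x
    refine HasDerivAt.congr_of_eventuallyEq (by simpa using this) ?_
    filter_upwards [Ioi_mem_nhds h] with y hy
    simp [max_eq_left (le_of_lt (mem_Ioi.1 hy))]

lemma aux_m_cd : ContDiff ℝ 1 (fun x : ℝ => (max x 0)^2) := by
  rw [contDiff_one_iff_deriv]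
  refine ⟨fun x => (aux_m x).differentiableAt, ?_⟩
  have : deriv (fun x : ℝ => (max x 0)^2) = fun x => 2 * max x 0 := funext fun x => (aux_m x).deriv
  rw [this]
  fun_prop

/-- positive part of `exp (t/2) - 2` -/
noncomputable def wf (t : ℝ) : ℝ := max (exp (t/2) - 2) 0
noncomputable def hf (t : ℝ) : ℝ := √(1 + wf t ^ 2) - 1
noncomputable def Hf (t : ℝ) : ℝ := wf t ^ 2 / 2

lemma Hf_cd : ContDiff ℝ 1 Hf := by
  unfold Hf wf
  exact (aux_m_cd.comp (g := fun x : ℝ => (max x 0)^2) (f := fun t => exp (t/2) - 2) (by fun_prop)).div_const 2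

lemma hf_cd : ContDiff ℝ 1 hf := by
  unfold hf wf
  have := (aux_m_cd.comp (g := fun x : ℝ => (max x 0)^2) (f := fun t => exp (t/2) - 2) (by fun_prop))
  refine ContDiff.sub (ContDiff.sqrt (contDiff_const.add this) ?_) contDiff_const
  intro x
  positivity

lemma wsq_deriv (t : ℝ) : HasDerivAt (fun t => wf t ^ 2) (wf t * exp (t/2)) t := by
  have h1 : HasDerivAt (fun t : ℝ => exp (t/2) - 2) (exp (t/2) * (1/2)) t :=
    (((hasDerivAt_id t).div_const 2).exp).sub_const 2
  have := (aux_m (exp (t/2) - 2)).comp t h1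
  refine this.congr_deriv ?_
  simp only [wf]; ring

lemma Hf_deriv (t : ℝ) : deriv Hf t = wf t * exp (t/2) / 2 :=
  ((wsq_deriv t).div_const 2).deriv

lemma hf_deriv (t : ℝ) : deriv hf t = wf t * exp (t/2) / (2 * √(1 + wf t ^ 2)) :=
  ((((wsq_deriv t).const_add 1).sqrt (by positivity)).sub_const 1).deriv

lemma wf_nonneg (t : ℝ) : 0 ≤ wf t := le_max_right _ _

lemma deriv_le (t : ℝ) : deriv hf t ^ 2 ≤ deriv Hf t := by
  rw [hf_deriv, Hf_deriv, div_pow, mul_pow, mul_pow, Real.sq_sqrt (by positivity)]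
  have h0 := wf_nonneg t
  have hz : exp (t/2) ≤ wf t + 2 := by have := le_max_left (exp (t/2) - 2) 0; unfold wf; linarith
  have hp := exp_pos (t/2)
  rw [div_le_div_iff₀ (by positivity) (by norm_num)]
  have : wf t * exp (t/2) ≤ 2 * (1 + wf t ^2) := by nlinarith [sq_nonneg (wf t - 1)]
  have h2 : 0 ≤ wf t * exp (t/2) := by positivity
  nlinarith [mul_le_mul_of_nonneg_left this h2]

lemma Hf_le (t : ℝ) : Hf t ≤ exp t / 2 := by
  have hw : wf t ≤ exp (t/2) := max_le (by linarith) (exp_pos _).le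
  have : exp t = exp (t/2) ^ 2 := by rw [← exp_nat_mul]; congr 1; push_cast; ring
  rw [Hf, this]
  have := wf_nonneg t
  gcongr

lemma hf_ge (t : ℝ) : exp t - 6 * exp (t/2) ≤ hf t ^ 2 := by
  have : exp t = exp (t/2) ^ 2 := by rw [← exp_nat_mul]; congr 1; push_cast; ring
  rw [this]
  have hp := exp_pos (t/2)
  by_cases h : exp (t/2) ≤ 3
  · nlinarith [sq_nonneg (hf t)]
  · push Not at h
    have h1 : wf t ≤ √(1 + wf t ^2) := Real.le_sqrt_of_sq_le (by linarith)
    have h2 : exp (t/2) - 2 ≤ wf t := le_max_left _ _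
    have h3 : exp (t/2) - 3 ≤ hf t := by unfold hf; linarith
    nlinarith

lemma hf_zero (t : ℝ) (h : t ≤ log 2) : hf t = 0 ∧ Hf t = 0 := by
  have : wf t = 0 := by
    apply max_eq_right
    have h2 : 0 < log 2 := log_pos (by norm_num)
    have : exp (t/2) ≤ 2 := by
      calc exp (t/2) ≤ exp (log 2) := exp_le_exp.2 (by linarith)
        _ = 2 := exp_log (by norm_num)
    linarith
  simp [hf, Hf, this]

lemma aux_cs {α : Type*} [MeasurableSpace α] (μ : Measure α) (f g : α → ℝ)
    (hf : Integrable (fun x => f x ^ 2) μ) (hg : Integrable (fun x => g x ^ 2) μ)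
    (hfg : Integrable (fun x => f x * g x) μ) :
    (∫ x, f x * g x ∂μ) ^ 2 ≤ (∫ x, f x ^ 2 ∂μ) * ∫ x, g x ^ 2 ∂μ := by
  have h : ∀ t : ℝ, 0 ≤ (∫ x, f x ^ 2 ∂μ) * (t * t) + (2 * ∫ x, f x * g x ∂μ) * t
      + ∫ x, g x ^ 2 ∂μ := by
    intro t
    have h0 : 0 ≤ ∫ x, (f x * t + g x) ^ 2 ∂μ := integral_nonneg fun x => sq_nonneg _
    have h1 : ∫ x, (f x * t + g x) ^ 2 ∂μ =
        ∫ x, ((t * t) * f x ^ 2 + (2 * t) * (f x * g x) + g x ^ 2) ∂μ := by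
      congr 1; ext x; ring
    have ha : Integrable (fun x => (t * t) * f x ^ 2 + (2 * t) * (f x * g x)) μ :=
      (hf.const_mul _).add (hfg.const_mul _)
    rw [h1, integral_add ha hg,
      integral_add (hf.const_mul _) (hfg.const_mul _), integral_const_mul, integral_const_mul] at h0
    linarith
  have := discrim_le_zero h
  rw [discrim] at this
  nlinarith

lemma aux_comb {α : Type*} [MeasurableSpace α] (μ : Measure α) (S : Set α) (hS : MeasurableSet S)
    (f1 f2 f3 g1 g2 g3 : α → ℝ) (m s : ℝ)
    (h1 : IntegrableOn f1 S μ ∧ ∫ x in S, f1 x ∂μ = 0)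
    (h2 : IntegrableOn f2 S μ ∧ ∫ x in S, f2 x ∂μ = 0)
    (h3 : IntegrableOn f3 S μ ∧ ∫ x in S, f3 x ∂μ = 0)
    (k1 : IntegrableOn g1 S μ) (k2 : IntegrableOn g2 S μ) (k3 : IntegrableOn g3 S μ)
    (h : ∀ x ∈ S, 1 / 2 * (f1 x + f2 x) - f3 x ≤ m * g3 x - s * (g1 x - 6 * g2 x)) :
    s * ((∫ x in S, g1 x ∂μ) - 6 * ∫ x in S, g2 x ∂μ) ≤ m * ∫ x in S, g3 x ∂μ := by
  have a1 : IntegrableOn (fun x => f1 x + f2 x) S μ := h1.1.add h2.1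
  have a2 : IntegrableOn (fun x => 1 / 2 * (f1 x + f2 x)) S μ := a1.const_mul _
  have a3 : IntegrableOn (fun x => 1 / 2 * (f1 x + f2 x) - f3 x) S μ := a2.sub h3.1
  have b1 : IntegrableOn (fun x => 6 * g2 x) S μ := k2.const_mul _
  have b2 : IntegrableOn (fun x => g1 x - 6 * g2 x) S μ := k1.sub b1
  have b3 : IntegrableOn (fun x => s * (g1 x - 6 * g2 x)) S μ := b2.const_mul _
  have b4 : IntegrableOn (fun x => m * g3 x) S μ := k3.const_mul _
  have b5 : IntegrableOn (fun x => m * g3 x - s * (g1 x - 6 * g2 x)) S μ := b4.sub b3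
  have hmono := setIntegral_mono_on a3 b5 hS h
  rw [integral_sub a2 h3.1, integral_const_mul, integral_add h1.1 h2.1, h1.2, h2.2, h3.2,
    integral_sub b4 b3, integral_const_mul, integral_const_mul, integral_sub k1 b1,
    integral_const_mul] at hmono
  linarith

/-- pointwise Picone-type inequality -/
lemma aux_picone {N : ℕ} {Ω : Set (EuclideanSpace ℝ (Fin N))} (hΩ : IsOpen Ω)
    (u φ : EuclideanSpace ℝ (Fin N) → ℝ)
    (hu : ContDiffOn ℝ 2 u Ω) (hφ : ContDiffOn ℝ 2 φ Ω) (hpos : ∀ x ∈ Ω, 0 < φ x)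
    (x : EuclideanSpace ℝ (Fin N)) (hx : x ∈ Ω) :
    ∑ i : Fin N, fderiv ℝ (fun y => hf (u y) ^ 2 / φ y) x (EuclideanSpace.single i 1) *
      fderiv ℝ φ x (EuclideanSpace.single i 1) ≤
    deriv hf (u x) ^ 2 * ∑ i : Fin N, fderiv ℝ u x (EuclideanSpace.single i 1) ^ 2 := by
  rw [Finset.mul_sum]
  refine Finset.sum_le_sum fun i _ => ?_
  have h1 := (hu.contDiffAt (hΩ.mem_nhds hx)).differentiableAt (by norm_num)
  have h2 := (hφ.contDiffAt (hΩ.mem_nhds hx)).differentiableAt (by norm_num)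
  have h3 : HasDerivAt hf (deriv hf (u x)) (u x) :=
    (hf_cd.differentiable (by norm_num) (u x)).hasDerivAt
  have hp := hpos x hx
  have h4 := (h3.comp_hasFDerivAt x h1.hasFDerivAt).pow 2
  have h5 := (hasDerivAt_inv hp.ne').comp_hasFDerivAt x h2.hasFDerivAt
  have h6 := h4.mul h5
  have h7 : fderiv ℝ (fun y => hf (u y) ^ 2 / φ y) x = _ := h6.fderiv
  rw [h7]
  simp only [Function.comp, add_apply, smul_apply,
    smul_eq_mul, Pi.pow_apply]
  set d := fderiv ℝ u x (EuclideanSpace.single i 1)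
  set p := fderiv ℝ φ x (EuclideanSpace.single i 1)
  set Z := hf (u x)
  set Z' := deriv hf (u x)
  have key : 0 ≤ (Z' * d - Z * p / φ x) ^ 2 := sq_nonneg _
  have e : (Z' * d - Z * p / φ x) ^ 2 = Z' ^ 2 * d ^ 2 - 2 * Z * Z' * d * p / φ x + Z^2 * p^2 / (φ x)^2 := by
    field_simp
    ring
  rw [e] at key
  refine le_of_sub_nonneg (key.trans_eq ?_)
  simp
  field_simp
  ring

lemma aux_H {N : ℕ} {Ω : Set (EuclideanSpace ℝ (Fin N))} (hΩ : IsOpen Ω)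
    (u : EuclideanSpace ℝ (Fin N) → ℝ) (hu : ContDiffOn ℝ 2 u Ω)
    (x : EuclideanSpace ℝ (Fin N)) (hx : x ∈ Ω) :
    ∑ i : Fin N, fderiv ℝ (fun y => Hf (u y)) x (EuclideanSpace.single i 1) *
      fderiv ℝ u x (EuclideanSpace.single i 1) =
    deriv Hf (u x) * ∑ i : Fin N, fderiv ℝ u x (EuclideanSpace.single i 1) ^ 2 := by
  rw [Finset.mul_sum]
  refine Finset.sum_congr rfl fun i _ => ?_
  have h1 := (hu.contDiffAt (hΩ.mem_nhds hx)).differentiableAt (by norm_num)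
  have h3 : HasDerivAt Hf (deriv Hf (u x)) (u x) :=
    (Hf_cd.differentiable (by norm_num) (u x)).hasDerivAt
  have h7 : fderiv ℝ (fun y => Hf (u y)) x = _ := (h3.comp_hasFDerivAt x h1.hasFDerivAt).fderiv
  rw [h7]
  simp
  ring

lemma aux_amgm (lam mu a b p q : ℝ) (hl : 0 < lam) (hm : 0 < mu) (hp : 0 < p) (hq : 0 < q) :
    2 * (√(lam * mu) * exp ((a + b) / 2)) ≤ mu * exp b * q / p + lam * exp a * p / q := by
  set X := mu * exp b * q / p
  set Y := lam * exp a * p / q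
  have hX : 0 < X := by positivity
  have hY : 0 < Y := by positivity
  have hXY : (√(lam * mu) * exp ((a + b) / 2)) ^ 2 = X * Y := by
    have : exp ((a + b) / 2) ^ 2 = exp a * exp b := by
      rw [← exp_nat_mul, ← exp_add]; congr 1; push_cast; ring
    rw [mul_pow, Real.sq_sqrt (by positivity), this]
    simp only [X, Y]
    field_simp
  have : (2 * (√(lam * mu) * exp ((a + b) / 2))) ^ 2 ≤ (X + Y) ^ 2 := by
    nlinarith [sq_nonneg (X - Y)]
  exact le_of_sq_le_sq this (by positivity)

lemma aux_integrable {N : ℕ} {Ω : Set (EuclideanSpace ℝ (Fin N))}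
    (hΩb : Bornology.IsBounded Ω) (f : EuclideanSpace ℝ (Fin N) → ℝ)
    (hf : ContinuousOn f (closure Ω)) : IntegrableOn f Ω :=
  (hf.integrableOn_compact hΩb.isCompact_closure).mono_set subset_closure

lemma aux_main {N : ℕ} {Ω : Set (EuclideanSpace ℝ (Fin N))} (hΩ : IsOpen Ω)
    (hΩb : Bornology.IsBounded Ω) (lam mu : ℝ) (hl : 0 < lam) (hm : 0 < mu)
    (u v : EuclideanSpace ℝ (Fin N) → ℝ) (hs : IsStableGelfandSolution Ω lam mu u v) :
    √(lam * mu) * ((∫ x in Ω, exp ((u x + v x) / 2) * exp (u x)) -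
      6 * ∫ x in Ω, exp ((u x + v x) / 2) * exp (u x / 2)) ≤
    mu / 2 * ∫ x in Ω, exp (u x + v x) := by
  obtain ⟨⟨huc, hvc, hu, hv, hu0, hv0⟩, lam1, φ, ψ, hlam1, hφc, hψc, hφ, hψ, eφ, eψ, -, -⟩ := hs
  have cu := huc.continuousOn
  have cv := hvc.continuousOn
  set K := closure Ω ∩ u ⁻¹' (Ici (log 2)) with hKdef
  have hK : IsCompact K := by
    refine hΩb.isCompact_closure.of_isClosed_subset ?_ inter_subset_left
    exact cu.preimage_isClosed_of_isClosed isClosed_closure isClosed_Ici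
  have hl2 : 0 < log 2 := log_pos (by norm_num)
  have hKΩ : K ⊆ Ω := by
    rintro x ⟨hx, hux⟩
    by_contra hxΩ
    have : u x = 0 := hu0 x (by rw [hΩ.frontier_eq]; exact ⟨hx, hxΩ⟩)
    simp only [mem_preimage, mem_Ici, this] at hux
    linarith
  have hzero : ∀ x ∈ Ω, x ∉ K → hf (u x) = 0 ∧ Hf (u x) = 0 := by
    intro x hx hxK
    apply hf_zero
    have : ¬ (log 2 ≤ u x) := fun h => hxK ⟨subset_closure hx, h⟩
    linarith
  have hu2 := huc.mono (subset_closure (s := Ω))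
  have hφ2 := hφc.mono (subset_closure (s := Ω))
  have hψ2 := hψc.mono (subset_closure (s := Ω))
  have hu1 : ContDiffOn ℝ 1 u Ω := hu2.of_le (by norm_num)
  have hhu : ContDiffOn ℝ 1 (fun y => hf (u y)) Ω := hf_cd.comp_contDiffOn hu1
  have hHu : ContDiffOn ℝ 1 (fun y => Hf (u y)) Ω := Hf_cd.comp_contDiffOn hu1
  have D1 := aux_div hΩ hK hKΩ (fun y => hf (u y) ^ 2 / φ y) φ
    ((hhu.pow 2).div (hφ2.of_le (by norm_num)) (fun x hx => (hφ x hx).ne')) hφ2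
    (fun x hx hxK => by simp [(hzero x hx hxK).1])
  have D2 := aux_div hΩ hK hKΩ (fun y => hf (u y) ^ 2 / ψ y) ψ
    ((hhu.pow 2).div (hψ2.of_le (by norm_num)) (fun x hx => (hψ x hx).ne')) hψ2
    (fun x hx hxK => by simp [(hzero x hx hxK).1])
  have D3 := aux_div hΩ hK hKΩ (fun y => Hf (u y)) u hHu hu2
    (fun x hx hxK => (hzero x hx hxK).2)
  have i1 : IntegrableOn (fun x => exp ((u x + v x) / 2) * exp (u x)) Ω :=
    aux_integrable hΩb _ (by fun_prop)
  have i2 : IntegrableOn (fun x => exp ((u x + v x) / 2) * exp (u x / 2)) Ω :=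
    aux_integrable hΩb _ (by fun_prop)
  have i3 : IntegrableOn (fun x => exp (u x + v x)) Ω :=
    aux_integrable hΩb _ (by fun_prop)
  exact aux_comb volume Ω hΩ.measurableSet _ _ _ _ _ _ (mu / 2) (√(lam * mu)) D1 D2 D3 i1 i2 i3 (by
      intro x hx
      have p1 := aux_picone hΩ u φ hu2 hφ2 hφ x hx
      have p2 := aux_picone hΩ u ψ hu2 hψ2 hψ x hx
      have p3 := aux_H hΩ u hu2 x hx
      have hS : 0 ≤ ∑ i : Fin N, fderiv ℝ u x (EuclideanSpace.single i 1) ^ 2 :=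
        Finset.sum_nonneg fun i _ => sq_nonneg _
      have p4 := mul_le_mul_of_nonneg_right (deriv_le (u x)) hS
      have hφx := hφ x hx
      have hψx := hψ x hx
      have l1 : lap φ x = -(mu * exp (v x) * ψ x + lam1 * φ x) := by linarith [eφ x hx]
      have l2 : lap ψ x = -(lam * exp (u x) * φ x + lam1 * ψ x) := by linarith [eψ x hx]
      have l3 : lap u x = -(mu * exp (v x)) := by linarith [hu x hx]
      have q1 : hf (u x) ^ 2 / φ x * lap φ x =
          - (hf (u x) ^ 2 * (mu * exp (v x) * ψ x / φ x)) - lam1 * hf (u x) ^ 2 := by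
        rw [l1]; field_simp; ring
      have q2 : hf (u x) ^ 2 / ψ x * lap ψ x =
          - (hf (u x) ^ 2 * (lam * exp (u x) * φ x / ψ x)) - lam1 * hf (u x) ^ 2 := by
        rw [l2]; field_simp; ring
      have q3 : 0 ≤ lam1 * hf (u x) ^ 2 := by positivity
      have q4 := mul_le_mul_of_nonneg_left
        (aux_amgm lam mu (u x) (v x) (φ x) (ψ x) hl hm hφx hψx) (sq_nonneg (hf (u x)))
      have q5 := mul_le_mul_of_nonneg_left (hf_ge (u x))
        (show 0 ≤ √(lam * mu) * exp ((u x + v x) / 2) by positivity)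
      have q6 := mul_le_mul_of_nonneg_left (Hf_le (u x))
        (show 0 ≤ mu * exp (v x) by positivity)
      have q7 : exp (u x + v x) = exp (u x) * exp (v x) := exp_add _ _
      rw [q1, q2, p3, l3, q7]
      linarith)

lemma IsStableGelfandSolution.swap {N : ℕ} {Ω : Set (EuclideanSpace ℝ (Fin N))} {lam mu : ℝ}
    {u v : EuclideanSpace ℝ (Fin N) → ℝ} (hs : IsStableGelfandSolution Ω lam mu u v) :
    IsStableGelfandSolution Ω mu lam v u := by
  obtain ⟨⟨huc, hvc, hu, hv, hu0, hv0⟩, lam1, φ, ψ, hlam1, hφc, hψc, hφ, hψ, eφ, eψ, a, b⟩ := hs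
  exact ⟨⟨hvc, huc, hv, hu, hv0, hu0⟩, lam1, ψ, φ, hlam1, hψc, hφc, hψ, hφ, eψ, eφ, b, a⟩

/-- the algebra: from `s(A-6J) ≤ μ/2 P`, with `J² ≤ A I`, `P² ≤ A B`. -/
lemma aux_lin (s mu A B I J P : ℝ) (hs : 0 < s) (hm : 0 < mu) (hA : 0 ≤ A) (hB : 0 ≤ B)
    (hI : 0 ≤ I) (hJ : J ^ 2 ≤ A * I) (hP : P ^ 2 ≤ A * B) (h : s * (A - 6 * J) ≤ mu / 2 * P) :
    s * √A ≤ 6 * s * √I + mu / 2 * √B := by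
  have hJ' : J ≤ √A * √I := by rw [← Real.sqrt_mul hA]; exact Real.le_sqrt_of_sq_le hJ
  have hP' : P ≤ √A * √B := by rw [← Real.sqrt_mul hA]; exact Real.le_sqrt_of_sq_le hP
  rcases (Real.sqrt_nonneg A).eq_or_lt with h0 | h0
  · rw [← h0]; have := Real.sqrt_nonneg I; have := Real.sqrt_nonneg B; simp only [mul_zero]; positivity
  · refine le_of_mul_le_mul_right ?_ h0
    have e : A = √A * √A := (Real.mul_self_sqrt hA).symm
    have e1 := mul_le_mul_of_nonneg_left hJ' hs.le
    have e2 := mul_le_mul_of_nonneg_left hP' hm.le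
    have e3 : s * A = s * (√A * √A) := by rw [← e]
    linarith

lemma aux_fin (lam mu A B I : ℝ) (hl : 0 < lam) (hm : 0 < mu) (hA : 0 ≤ A) (hB : 0 ≤ B)
    (hI : 0 ≤ I) (h1 : √(lam * mu) * √A ≤ 6 * √(lam * mu) * √I + mu / 2 * √B)
    (h2 : √(lam * mu) * √B ≤ 6 * √(lam * mu) * √I + lam / 2 * √A) :
    2 * (lam * mu) * A * B ≤ 1000000 * (lam + mu) ^ 2 * I ^ 2 := by
  have hs : 0 < √(lam * mu) := Real.sqrt_pos.2 (by positivity)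
  have hss : √(lam * mu) ^ 2 = lam * mu := Real.sq_sqrt (by positivity)
  have eA := Real.sq_sqrt hA
  have eB := Real.sq_sqrt hB
  have eI := Real.sq_sqrt hI
  have ha := Real.sqrt_nonneg A
  have hb := Real.sqrt_nonneg B
  have hi := Real.sqrt_nonneg I
  rw [← hss, ← eA, ← eB, ← eI]
  generalize √(lam * mu) = s at *
  generalize √A = a at *
  generalize √B = b at *
  generalize √I = i at *
  -- s a ≤ 8 s i + 4 mu i
  have k1 : s * a ≤ (8 * s + 4 * mu) * i := by
    have : s * (s * a) ≤ s * ((8 * s + 4 * mu) * i) := by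
      nlinarith [mul_le_mul_of_nonneg_left h1 hs.le, mul_le_mul_of_nonneg_left h2 hm.le]
    exact le_of_mul_le_mul_left this hs
  have k2 : s * b ≤ (8 * s + 4 * lam) * i := by
    have : s * (s * b) ≤ s * ((8 * s + 4 * lam) * i) := by
      nlinarith [mul_le_mul_of_nonneg_left h2 hs.le, mul_le_mul_of_nonneg_left h1 hl.le]
    exact le_of_mul_le_mul_left this hs
  have hsl : 2 * s ≤ lam + mu := by
    apply le_of_sq_le_sq _ (by positivity)
    nlinarith [sq_nonneg (lam - mu)]
  have k3 : s * (a * b) ≤ 100 * (lam + mu) * i ^ 2 := by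
    have hm1 := mul_le_mul k1 k2 (by positivity) (by positivity)
    have : s * (s * (a * b)) ≤ s * (100 * (lam + mu) * i ^ 2) := by
      have e : (8 * s + 4 * mu) * i * ((8 * s + 4 * lam) * i) =
        s * ((80 * s + 32 * (lam + mu)) * i ^ 2) := by
        linear_combination (-16 * i ^ 2) * hss
      have : (80 * s + 32 * (lam + mu)) * i ^ 2 ≤ 100 * (lam + mu) * i ^ 2 := by
        gcongr; linarith
      have := mul_le_mul_of_nonneg_left this hs.le
      linarith
    exact le_of_mul_le_mul_left this hs
  have k4 := mul_le_mul k3 k3 (by positivity) (by positivity)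
  have : 0 ≤ (lam + mu) ^ 2 * (i ^ 2) ^ 2 := by positivity
  nlinarith

/-- There is a universal constant `C > 0` such that every stable classical
solution of the Gelfand system satisfies
`C (λ+μ)² (∫ e^{(u+v)/2})² ≥ 2 λμ ∫ e^{(u+v)/2} e^u · ∫ e^{(u+v)/2} e^v`. -/
theorem product_exp_inequality :
    ∃ C : ℝ, 0 < C ∧
      ∀ (N : ℕ) (Ω : Set (EuclideanSpace ℝ (Fin N))), IsBoundedDomain Ω →
        ∀ (lam mu : ℝ), 0 < lam → 0 < mu →
          ∀ (u v : EuclideanSpace ℝ (Fin N) → ℝ),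
            IsStableGelfandSolution Ω lam mu u v →
            C * (lam + mu) ^ 2 * (∫ x in Ω, exp ((u x + v x) / 2)) ^ 2 ≥
              2 * (lam * mu) * (∫ x in Ω, exp ((u x + v x) / 2) * exp (u x)) *
                ∫ x in Ω, exp ((u x + v x) / 2) * exp (v x) := by
  refine ⟨1000000, by norm_num, ?_⟩
  rintro N Ω ⟨hΩ, -, hΩb⟩ lam mu hl hm u v hs
  have M1 := aux_main hΩ hΩb lam mu hl hm u v hs
  have M2 := aux_main hΩ hΩb mu lam hm hl v u hs.swap
  have cu := hs.1.1.continuousOn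
  have cv := hs.1.2.1.continuousOn
  have csq : ∀ a : ℝ, exp a ^ 2 = exp (2 * a) := fun a => by
    rw [← exp_nat_mul]; norm_num
  have CS : ∀ f g : EuclideanSpace ℝ (Fin N) → ℝ, ContinuousOn f (closure Ω) →
      ContinuousOn g (closure Ω) → (∫ x in Ω, exp (f x / 2 + g x / 2)) ^ 2 ≤
      (∫ x in Ω, exp (f x)) * ∫ x in Ω, exp (g x) := by
    intro f g cf cg
    have := aux_cs (volume.restrict Ω) (fun x => exp (f x / 2)) (fun x => exp (g x / 2))
      (aux_integrable hΩb _ (by fun_prop)) (aux_integrable hΩb _ (by fun_prop))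
      (aux_integrable hΩb _ (by fun_prop))
    simp only [csq, mul_div_cancel₀ _ (two_ne_zero' ℝ), ← exp_add,
      mul_div_cancel_left₀ _ (two_ne_zero' ℝ)] at this
    convert this using 6
  have e1 : ∀ x, exp ((v x + u x) / 2) = exp ((u x + v x) / 2) := fun x => by rw [add_comm]
  have e2 : ∀ x, exp (v x + u x) = exp (u x + v x) := fun x => by rw [add_comm]
  simp only [e1, e2] at M2
  rw [mul_comm mu lam] at M2
  simp only [← exp_add] at M1 M2 ⊢
  have nn : ∀ f : EuclideanSpace ℝ (Fin N) → ℝ, 0 ≤ ∫ x in Ω, exp (f x) :=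
    fun f => integral_nonneg fun x => (exp_pos _).le
  have C1 := CS (fun x => (u x + v x) / 2 + u x) (fun x => (u x + v x) / 2) (by fun_prop) (by fun_prop)
  have C2 := CS (fun x => (u x + v x) / 2 + v x) (fun x => (u x + v x) / 2) (by fun_prop) (by fun_prop)
  have C3 := CS (fun x => (u x + v x) / 2 + u x) (fun x => (u x + v x) / 2 + v x)
    (by fun_prop) (by fun_prop)
  have r1 : ∀ x, ((u x + v x) / 2 + u x) / 2 + (u x + v x) / 2 / 2 = (u x + v x) / 2 + u x / 2 :=
    fun x => by ring
  have r2 : ∀ x, ((u x + v x) / 2 + v x) / 2 + (u x + v x) / 2 / 2 = (u x + v x) / 2 + v x / 2 :=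
    fun x => by ring
  have r3 : ∀ x, ((u x + v x) / 2 + u x) / 2 + ((u x + v x) / 2 + v x) / 2 = u x + v x :=
    fun x => by ring
  simp only [r1, r2, r3] at C1 C2 C3
  have hsp : 0 < √(lam * mu) := Real.sqrt_pos.2 (by positivity)
  exact aux_fin lam mu _ _ _ hl hm (nn _) (nn _) (nn _)
    (aux_lin _ _ _ _ _ _ _ hsp hm (nn _) (nn _) (nn _) C1 C3 M1)
    (aux_lin _ _ _ _ _ _ _ hsp hl (nn _) (nn _) (nn _) C2 (C3.trans_eq (mul_comm _ _)) M2)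
end

section
/- Let Ω ⊂ ℝ^N be a smoothly bounded domain, λ, μ > 0, and (u, v) a stable classical solution of the Gelfand system. Then ∫_Ω |∇(e^{v/2} − 1)|² dx ≤ (C/4) λ |Ω| (λ/μ + μ/λ), where C is the universal constant from the bound ∫_Ω e^{u+v} dx ≤ C|Ω|(λ/μ + μ/λ); that is, e^{v/2} − 1 is bounded in H¹₀(Ω) uniformly with respect to λ, μ in any region where λ|Ω|(λ/μ + μ/λ) is bounded. -/
open MeasureTheory Real
open scoped RealInnerProductSpace

/-- Directional derivative along the `i`-th basis vector. -/
noncomputable def dd {N : ℕ} (i : Fin N) (f : EuclideanSpace ℝ (Fin N) → ℝ)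
    (x : EuclideanSpace ℝ (Fin N)) : ℝ := fderiv ℝ f x (EuclideanSpace.single i 1)

/-- Compactly supported `C¹` test functions. -/
structure TestFn {N : ℕ} (Ω : Set (EuclideanSpace ℝ (Fin N)))
    (η : EuclideanSpace ℝ (Fin N) → ℝ) : Prop where
  smooth : ContDiff ℝ 1 η
  comp : HasCompactSupport η
  supp : tsupport η ⊆ Ω

section tools
variable {N : ℕ} {Ω : Set (EuclideanSpace ℝ (Fin N))}

lemma lap_eq (f : EuclideanSpace ℝ (Fin N) → ℝ) (x : EuclideanSpace ℝ (Fin N)) :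
    lap f x = ∑ i, dd i (dd i f) x := rfl

lemma dd_contDiffAt {f : EuclideanSpace ℝ (Fin N) → ℝ} {x : EuclideanSpace ℝ (Fin N)}
    (hf : ContDiffAt ℝ 2 f x) (i : Fin N) : ContDiffAt ℝ 1 (dd i f) x := by
  have h := hf.fderiv_right (m := 1) (by norm_num)
  exact h.clm_apply contDiffAt_const

lemma dd_continuousAt {f : EuclideanSpace ℝ (Fin N) → ℝ} {x : EuclideanSpace ℝ (Fin N)}
    (hf : ContDiffAt ℝ 1 f x) (i : Fin N) : ContinuousAt (dd i f) x := by
  have h := hf.fderiv_right (m := 0) (by norm_num)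
  exact (h.clm_apply contDiffAt_const).continuousAt

lemma lap_continuousAt {f : EuclideanSpace ℝ (Fin N) → ℝ} {x : EuclideanSpace ℝ (Fin N)}
    (hf : ContDiffAt ℝ 2 f x) : ContinuousAt (lap f) x := by
  have : lap f = fun x => ∑ i, dd i (dd i f) x := by ext; rfl
  rw [this]
  exact tendsto_finsetSum _ fun i _ => dd_continuousAt (dd_contDiffAt hf i) i

lemma testFn_of (hO : IsOpen Ω) {K : Set (EuclideanSpace ℝ (Fin N))} (hK : IsCompact K)
    (hKO : K ⊆ Ω) {η : EuclideanSpace ℝ (Fin N) → ℝ} (h1 : ∀ x ∈ Ω, ContDiffAt ℝ 1 η x)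
    (h0 : ∀ x ∉ K, η x = 0) : TestFn Ω η := by
  refine ⟨?_, HasCompactSupport.intro hK h0, ?_⟩
  · rw [contDiff_iff_contDiffAt]
    intro x
    by_cases hx : x ∈ Ω
    · exact h1 x hx
    · have : η =ᶠ[nhds x] fun _ => 0 := by
        filter_upwards [hK.isClosed.isOpen_compl.mem_nhds (fun h => hx (hKO h))] with y hy
        exact h0 y hy
      exact contDiffAt_const.congr_of_eventuallyEq this
  · refine subset_trans (closure_minimal ?_ hK.isClosed) hKO
    intro x hx
    by_contra h
    exact hx (h0 x h)

lemma integrable_of_cont (hO : IsOpen Ω) {K : Set (EuclideanSpace ℝ (Fin N))} (hK : IsCompact K)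
    (hKO : K ⊆ Ω) {η : EuclideanSpace ℝ (Fin N) → ℝ} (h1 : ∀ x ∈ Ω, ContinuousAt η x)
    (h0 : ∀ x ∉ K, η x = 0) : Integrable η := by
  refine Continuous.integrable_of_hasCompactSupport ?_ (HasCompactSupport.intro hK h0)
  rw [continuous_iff_continuousAt]
  intro x
  by_cases hx : x ∈ Ω
  · exact h1 x hx
  · have : η =ᶠ[nhds x] fun _ => 0 := by
      filter_upwards [hK.isClosed.isOpen_compl.mem_nhds (fun h => hx (hKO h))] with y hy
      exact h0 y hy
    exact continuousAt_const.congr this.symm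

lemma TestFn.integrable_mul {η g : EuclideanSpace ℝ (Fin N) → ℝ} (h : TestFn Ω η) (hO : IsOpen Ω)
    (hg : ∀ x ∈ Ω, ContinuousAt g x) : Integrable (fun x => g x * η x) :=
  integrable_of_cont hO h.comp.isCompact h.supp
    (fun x hx => (hg x hx).mul h.smooth.continuous.continuousAt)
    (fun x hx => by rw [image_eq_zero_of_notMem_tsupport hx, mul_zero])

lemma TestFn.integrable_mul_dd {η g : EuclideanSpace ℝ (Fin N) → ℝ} (h : TestFn Ω η)
    (hO : IsOpen Ω) (hg : ∀ x ∈ Ω, ContinuousAt g x) (i : Fin N) :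
    Integrable (fun x => g x * dd i η x) :=
  integrable_of_cont hO h.comp.isCompact h.supp
    (fun x hx => (hg x hx).mul (dd_continuousAt h.smooth.contDiffAt i))
    (fun x hx => by rw [dd, fderiv_of_notMem_tsupport ℝ hx]; simp)

/-- Integration by parts. -/
lemma ibp (hO : IsOpen Ω) {f η : EuclideanSpace ℝ (Fin N) → ℝ} (hf : ∀ x ∈ Ω, ContDiffAt ℝ 2 f x)
    (h : TestFn Ω η) :
    Integrable (fun x => ∑ i, dd i f x * dd i η x) ∧ Integrable (fun x => -lap f x * η x) ∧
    ∫ x, ∑ i, dd i f x * dd i η x = ∫ x, -lap f x * η x := by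
  have hI : ∀ i, Integrable (fun x => dd i f x * dd i η x) := fun i =>
    h.integrable_mul_dd hO (fun x hx => (dd_contDiffAt (hf x hx) i).continuousAt) i
  have hJ : ∀ i, Integrable (fun x => dd i (dd i f) x * η x) := fun i =>
    h.integrable_mul hO (fun x hx => dd_continuousAt (dd_contDiffAt (hf x hx) i) i)
  refine ⟨integrable_finsetSum _ fun i _ => hI i,
    h.integrable_mul hO (fun x hx => (lap_continuousAt (hf x hx)).neg), ?_⟩
  rw [integral_finsetSum _ fun i _ => hI i]
  have : ∀ x, -lap f x * η x = -∑ i, dd i (dd i f) x * η x := by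
    intro x
    rw [lap_eq, neg_mul, Finset.sum_mul]
  simp_rw [this]
  rw [integral_neg, integral_finsetSum _ fun i _ => hJ i, ← Finset.sum_neg_distrib]
  refine Finset.sum_congr rfl fun i _ => ?_
  refine integral_mul_fderiv_eq_neg_fderiv_mul_of_integrable (hJ i) (hI i) ?_ ?_ ?_
  · exact h.integrable_mul hO (fun x hx => (dd_contDiffAt (hf x hx) i).continuousAt)
  · intro x hx
    exact (dd_contDiffAt (hf x (h.supp hx)) i).differentiableAt (by norm_num)
  · intro x _
    exact h.smooth.differentiable (by norm_num) x

/-- Composition test functions. -/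
lemma testFn_comp (hO : IsOpen Ω) (hB : Bornology.IsBounded Ω)
    {u : EuclideanSpace ℝ (Fin N) → ℝ} (hu : ∀ x ∈ Ω, ContDiffAt ℝ 2 u x)
    (huc : ContinuousOn u (closure Ω)) (hu0 : ∀ x ∈ frontier Ω, u x = 0)
    {F : ℝ → ℝ} (hF : ContDiff ℝ 1 F) {ε : ℝ} (hε : 0 < ε) (hF0 : ∀ t ≤ ε, F t = 0) :
    TestFn Ω (Ω.indicator fun x => F (u x)) := by
  have hK : IsCompact (closure Ω ∩ u ⁻¹' (Set.Ici ε)) := by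
    refine (Metric.isCompact_of_isClosed_isBounded isClosed_closure hB.closure).of_isClosed_subset
      ?_ Set.inter_subset_left
    exact huc.preimage_isClosed_of_isClosed isClosed_closure isClosed_Ici
  refine testFn_of hO hK ?_ ?_ ?_
  · rintro x ⟨hx, hx2⟩
    by_contra hxO
    have : x ∈ frontier Ω := ⟨hx, by rwa [hO.interior_eq]⟩
    have h2 := hu0 x this
    simp only [Set.mem_preimage, Set.mem_Ici, h2] at hx2
    linarith
  · intro x hx
    have : (Ω.indicator fun x => F (u x)) =ᶠ[nhds x] fun x => F (u x) := by
      filter_upwards [hO.mem_nhds hx] with y hy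
      simp [hy]
    refine ContDiffAt.congr_of_eventuallyEq ?_ this
    exact hF.contDiffAt.comp x ((hu x hx).of_le (by norm_num))
  · intro x hx
    by_cases hxO : x ∈ Ω
    · rw [Set.indicator_of_mem hxO]
      apply hF0
      by_contra h
      exact hx ⟨subset_closure hxO, le_of_lt (not_le.mp h)⟩
    · simp [hxO]

lemma dd_comp (hO : IsOpen Ω) {u : EuclideanSpace ℝ (Fin N) → ℝ}
    (hu : ∀ x ∈ Ω, ContDiffAt ℝ 2 u x)
    {F : ℝ → ℝ} {F' : ℝ} {x : EuclideanSpace ℝ (Fin N)} (hx : x ∈ Ω) (hF : HasDerivAt F F' (u x))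
    (i : Fin N) :
    dd i (Ω.indicator fun x => F (u x)) x = F' * dd i u x := by
  have : (Ω.indicator fun x => F (u x)) =ᶠ[nhds x] fun x => F (u x) := by
    filter_upwards [hO.mem_nhds hx] with y hy
    simp [hy]
  rw [dd, this.fderiv_eq]
  have h := hF.comp_hasFDerivAt x ((hu x hx).differentiableAt (by norm_num)).hasFDerivAt
  have h2 : fderiv ℝ (fun x => F (u x)) x = F' • fderiv ℝ u x := h.fderiv
  rw [h2]
  simp [dd]

/-- Stability-type inequality for a positive function. -/
lemma stab_one (hO : IsOpen Ω) {φ ζ : EuclideanSpace ℝ (Fin N) → ℝ}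
    (hφ : ∀ x ∈ Ω, ContDiffAt ℝ 2 φ x) (hpos : ∀ x ∈ Ω, 0 < φ x) (h : TestFn Ω ζ) :
    Integrable (fun x => -lap φ x * (ζ x ^ 2 / φ x)) ∧
    Integrable (fun x => ∑ i, dd i ζ x ^ 2) ∧
    ∫ x, -lap φ x * (ζ x ^ 2 / φ x) ≤ ∫ x, ∑ i, dd i ζ x ^ 2 := by
  have hη : TestFn Ω (fun x => ζ x ^ 2 / φ x) := by
    refine testFn_of hO h.comp.isCompact h.supp ?_ ?_
    · intro x hx
      exact (h.smooth.contDiffAt.pow 2).div ((hφ x hx).of_le (by norm_num)) (hpos x hx).ne'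
    · intro x hx
      simp [image_eq_zero_of_notMem_tsupport hx]
  obtain ⟨i1, i2, e⟩ := ibp hO hφ hη
  have i3 : Integrable (fun x => ∑ i, dd i ζ x ^ 2) := by
    refine integrable_finsetSum _ fun i _ => ?_
    simp_rw [sq]
    exact h.integrable_mul_dd hO (fun x hx => dd_continuousAt h.smooth.contDiffAt i) i
  refine ⟨i2, i3, ?_⟩
  rw [← e]
  refine integral_mono i1 i3 fun x => ?_
  refine Finset.sum_le_sum fun i _ => ?_
  by_cases hx : x ∈ Ω
  · have hp := hpos x hx
    have hd : dd i (fun x => ζ x ^ 2 / φ x) x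
        = (2 * ζ x * dd i ζ x * φ x - ζ x ^ 2 * dd i φ x) / φ x ^ 2 := by
      have h1 : HasFDerivAt ζ (fderiv ℝ ζ x) x :=
        (h.smooth.differentiable (by norm_num) x).hasFDerivAt
      have h2 : HasFDerivAt φ (fderiv ℝ φ x) x :=
        ((hφ x hx).differentiableAt (by norm_num)).hasFDerivAt
      have l1 := (h1.hasLineDerivAt (EuclideanSpace.single i 1))
      have l2 := (h2.hasLineDerivAt (EuclideanSpace.single i 1))
      have l3 : HasFDerivAt (fun x => ζ x ^ 2 / φ x) (fderiv ℝ (fun x => ζ x ^ 2 / φ x) x) x :=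
        (hη.smooth.differentiable (by norm_num) x).hasFDerivAt
      have l4 := (l3.hasLineDerivAt (EuclideanSpace.single i 1))
      unfold HasLineDerivAt at l1 l2 l4
      have l5 := (l1.pow 2).div l2 (by simpa using hp.ne')
      have := l4.unique l5
      rw [dd, this]
      simp [dd]
    rw [hd]
    have key : dd i ζ x ^ 2 - dd i φ x * ((2 * ζ x * dd i ζ x * φ x - ζ x ^ 2 * dd i φ x) / φ x ^ 2)
        = (dd i ζ x - ζ x * dd i φ x / φ x) ^ 2 := by
      field_simp
      ring
    nlinarith [sq_nonneg (dd i ζ x - ζ x * dd i φ x / φ x)]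
  · have hx' : x ∉ tsupport (fun x => ζ x ^ 2 / φ x) := fun hh => hx (hη.supp hh)
    rw [dd, dd, fderiv_of_notMem_tsupport ℝ hx']
    simp only [zero_apply, mul_zero]
    positivity

/-- Minimum principle. -/
lemma min_principle (hO : IsOpen Ω) (hB : Bornology.IsBounded Ω)
    {v : EuclideanSpace ℝ (Fin N) → ℝ} (hv : ∀ x ∈ Ω, ContDiffAt ℝ 2 v x)
    (hvc : ContinuousOn v (closure Ω)) (hv0 : ∀ x ∈ frontier Ω, v x = 0)
    (hl : ∀ x ∈ Ω, lap v x < 0) : ∀ x ∈ Ω, 0 ≤ v x := by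
  intro x hx
  by_contra hneg
  push Not at hneg
  obtain ⟨y, hy, hmin⟩ :=
    (Metric.isCompact_of_isClosed_isBounded isClosed_closure hB.closure).exists_isMinOn
      ⟨x, subset_closure hx⟩ hvc
  have hyneg : v y < 0 := lt_of_le_of_lt (hmin (subset_closure hx)) hneg
  have hyO : y ∈ Ω := by
    by_contra h
    have := hv0 y ⟨hy, by rwa [hO.interior_eq]⟩
    linarith
  have hlm : IsLocalMin v y := by
    filter_upwards [hO.mem_nhds hyO] with z hz
    exact hmin (subset_closure hz)
  have hly := hl y hyO
  rw [lap_eq] at hly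
  obtain ⟨i, -, hi⟩ := Finset.exists_lt_of_sum_lt (s := Finset.univ) (f := fun i => dd i (dd i v) y)
    (g := fun _ => (0 : ℝ)) (by simpa using hly)
  set e : EuclideanSpace ℝ (Fin N) := EuclideanSpace.single i 1 with he
  set γ : ℝ → EuclideanSpace ℝ (Fin N) := fun t => y + t • e with hγ
  have hγc : Continuous γ := by fun_prop
  have hγ0 : γ 0 = y := by simp [hγ]
  have hγd : ∀ t, HasDerivAt γ e t := by
    intro t
    have := ((hasDerivAt_id t).smul_const e).const_add y
    simpa [hγ] using this
  have hev : ∀ᶠ t in nhds (0 : ℝ), γ t ∈ Ω := by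
    apply hγc.continuousAt.eventually_mem
    rw [hγ0]; exact hO.mem_nhds hyO
  have hd1 : ∀ᶠ t in nhds (0 : ℝ), HasDerivAt (fun t => v (γ t)) (dd i v (γ t)) t := by
    filter_upwards [hev] with t ht
    exact ((hv _ ht).differentiableAt (by norm_num)).hasFDerivAt.comp_hasDerivAt t (hγd t)
  have hd1e : deriv (fun t => v (γ t)) =ᶠ[nhds 0] fun t => dd i v (γ t) := by
    filter_upwards [hd1] with t ht using ht.deriv
  have hd2 : HasDerivAt (fun t => dd i v (γ t)) (dd i (dd i v) y) 0 := by
    have h1 : HasFDerivAt (dd i v) (fderiv ℝ (dd i v) y) (γ 0) := by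
      rw [hγ0]
      exact ((dd_contDiffAt (hv _ hyO) i).differentiableAt (by norm_num)).hasFDerivAt
    exact h1.comp_hasDerivAt 0 (hγd 0)
  have hdd : deriv (deriv (fun t => v (γ t))) 0 = dd i (dd i v) y := by
    rw [hd1e.deriv_eq, hd2.deriv]
  have hlmt : IsLocalMin (fun t => v (γ t)) 0 := by
    have : Filter.Tendsto γ (nhds 0) (nhds y) := by
      have := hγc.tendsto 0; rwa [hγ0] at this
    filter_upwards [this.eventually hlm] with t ht
    rw [hγ0]; exact ht
  have hmax : IsLocalMax (fun t => v (γ t)) 0 := by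
    apply isLocalMax_of_deriv_deriv_neg
    · rw [hdd]; exact hi
    · exact hlmt.deriv_eq_zero
    · exact hd1.self_of_nhds.continuousAt
  have hconst : (fun t => v (γ t)) =ᶠ[nhds 0] fun _ => v (γ 0) := by
    filter_upwards [hlmt, hmax] with t h1 h2 using le_antisymm h2 h1
  have : deriv (deriv (fun t => v (γ t))) 0 = 0 := by
    rw [hconst.deriv.deriv_eq]; simp
  rw [hdd] at this
  linarith

end tools

/-- Continuous cutoff. -/
noncomputable def chi (n : ℕ) (t : ℝ) : ℝ := min 1 (max 0 (n * t - 1))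

/-- Truncation of `e^{t/2} - 1`. -/
noncomputable def FF (n : ℕ) (t : ℝ) : ℝ := ∫ s in (0 : ℝ)..t, chi n s * (exp (s / 2) / 2)

/-- Truncation of `e^t - 1`. -/
noncomputable def GG (n : ℕ) (t : ℝ) : ℝ := ∫ s in (0 : ℝ)..t, chi n s ^ 2 * exp s

lemma chi_cont (n : ℕ) : Continuous (chi n) := by unfold chi; fun_prop

lemma chi_nonneg (n : ℕ) (t : ℝ) : 0 ≤ chi n t := le_min zero_le_one (le_max_left _ _)

lemma chi_le (n : ℕ) (t : ℝ) : chi n t ≤ 1 := min_le_left _ _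

lemma chi_zero (n : ℕ) {t : ℝ} (ht : t ≤ 1 / ((n : ℝ) + 1)) : chi n t = 0 := by
  have hn : (0 : ℝ) ≤ n := n.cast_nonneg
  have h1 : n * t - 1 ≤ 0 := by
    have : (n : ℝ) * t ≤ n * (1 / ((n : ℝ) + 1)) := by gcongr
    have h2 : (n : ℝ) * (1 / ((n : ℝ) + 1)) ≤ 1 := by
      rw [mul_one_div, div_le_one (by positivity)]; linarith
    linarith
  rw [chi, max_eq_left h1]; simp

lemma chi_eventually {t : ℝ} (ht : 0 < t) : ∀ᶠ n : ℕ in Filter.atTop, chi n t = 1 := by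
  filter_upwards [Filter.eventually_ge_atTop ⌈2 / t⌉₊] with n hn
  have : 2 / t ≤ n := Nat.ceil_le.mp hn
  rw [div_le_iff₀ ht] at this
  rw [chi, max_eq_right (by linarith), min_eq_left (by linarith)]

lemma FF_deriv (n : ℕ) (t : ℝ) : HasDerivAt (FF n) (chi n t * (exp (t / 2) / 2)) t := by
  have hc : Continuous fun s => chi n s * (exp (s / 2) / 2) := by
    have := chi_cont n; fun_prop
  exact hc.integral_hasStrictDerivAt 0 t |>.hasDerivAt

lemma GG_deriv (n : ℕ) (t : ℝ) : HasDerivAt (GG n) (chi n t ^ 2 * exp t) t := by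
  have hc : Continuous fun s => chi n s ^ 2 * exp s := by
    have := chi_cont n; fun_prop
  exact hc.integral_hasStrictDerivAt 0 t |>.hasDerivAt

lemma FF_contDiff (n : ℕ) : ContDiff ℝ 1 (FF n) := by
  rw [contDiff_one_iff_deriv]
  refine ⟨fun t => (FF_deriv n t).differentiableAt, ?_⟩
  have : deriv (FF n) = fun s => chi n s * (exp (s / 2) / 2) := by
    ext t; exact (FF_deriv n t).deriv
  rw [this]
  have := chi_cont n; fun_prop

lemma GG_contDiff (n : ℕ) : ContDiff ℝ 1 (GG n) := by
  rw [contDiff_one_iff_deriv]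
  refine ⟨fun t => (GG_deriv n t).differentiableAt, ?_⟩
  have : deriv (GG n) = fun s => chi n s ^ 2 * exp s := by
    ext t; exact (GG_deriv n t).deriv
  rw [this]
  have := chi_cont n; fun_prop

lemma chi_zero_uIcc (n : ℕ) {t s : ℝ} (ht : t ≤ 1 / ((n : ℝ) + 1)) (hs : s ∈ Set.uIcc 0 t) :
    chi n s = 0 := by
  apply chi_zero
  have h0 : (0 : ℝ) ≤ 1 / ((n : ℝ) + 1) := by positivity
  exact le_trans hs.2 (max_le h0 ht)

lemma FF_zero (n : ℕ) (t : ℝ) (ht : t ≤ 1 / ((n : ℝ) + 1)) : FF n t = 0 := by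
  rw [FF, intervalIntegral.integral_congr (g := fun _ => (0 : ℝ))]
  · simp
  · intro s hs
    simp [chi_zero_uIcc n ht hs]

lemma GG_zero (n : ℕ) (t : ℝ) (ht : t ≤ 1 / ((n : ℝ) + 1)) : GG n t = 0 := by
  rw [GG, intervalIntegral.integral_congr (g := fun _ => (0 : ℝ))]
  · simp
  · intro s hs
    simp [chi_zero_uIcc n ht hs]

lemma int_half (t : ℝ) : ∫ s in (0 : ℝ)..t, exp (s / 2) / 2 = exp (t / 2) - 1 := by
  rw [intervalIntegral.integral_eq_sub_of_hasDerivAt (f := fun s => exp (s / 2))]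
  · simp
  · intro x _
    have := ((hasDerivAt_id x).div_const 2).exp
    simpa [div_eq_mul_inv] using this
  · exact Continuous.intervalIntegrable (by fun_prop) _ _

lemma FF_nonneg (n : ℕ) {t : ℝ} (ht : 0 ≤ t) : 0 ≤ FF n t :=
  intervalIntegral.integral_nonneg ht fun s _ => by have := chi_nonneg n s; positivity

lemma FF_le (n : ℕ) {t : ℝ} (ht : 0 ≤ t) : FF n t ≤ exp (t / 2) - 1 := by
  rw [← int_half, FF]
  have hc := chi_cont n
  refine intervalIntegral.integral_mono_on ht (Continuous.intervalIntegrable (by fun_prop) _ _)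
    (Continuous.intervalIntegrable (by fun_prop) _ _) fun s _ => ?_
  exact mul_le_of_le_one_left (by positivity) (chi_le n s)

lemma GG_le (n : ℕ) {t : ℝ} (ht : 0 ≤ t) : GG n t ≤ exp t := by
  have h : GG n t ≤ ∫ s in (0 : ℝ)..t, exp s := by
    have hc := chi_cont n
    refine intervalIntegral.integral_mono_on ht (Continuous.intervalIntegrable (by fun_prop) _ _)
      (Continuous.intervalIntegrable (by fun_prop) _ _) fun s _ => ?_
    exact mul_le_of_le_one_left (by positivity) (pow_le_one₀ (chi_nonneg n s) (chi_le n s))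
  rw [integral_exp] at h
  simp at h
  linarith

lemma FF_tendsto {t : ℝ} (ht : 0 ≤ t) :
    Filter.Tendsto (fun n => FF n t) Filter.atTop (nhds (exp (t / 2) - 1)) := by
  rw [← int_half]
  refine intervalIntegral.tendsto_integral_filter_of_dominated_convergence
    (fun s => exp (s / 2) / 2) ?_ ?_ ?_ ?_
  · refine Filter.Eventually.of_forall fun n => Continuous.aestronglyMeasurable ?_
    have hc := chi_cont n
    fun_prop
  · refine Filter.Eventually.of_forall fun n => Filter.Eventually.of_forall fun s _ => ?_
    have := chi_nonneg n s
    rw [Real.norm_of_nonneg (by positivity)]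
    exact mul_le_of_le_one_left (by positivity) (chi_le n s)
  · exact Continuous.intervalIntegrable (by fun_prop) _ _
  · refine Filter.Eventually.of_forall fun s hs => ?_
    rw [Set.uIoc_of_le ht] at hs
    refine tendsto_const_nhds.congr' ?_
    filter_upwards [chi_eventually hs.1] with n hn
    rw [hn, one_mul]

/-- The pointwise algebraic inequality. -/
lemma pointwise_ineq_s8 {a b s : ℝ} (ha : 0 < a) (hb : 0 < b) (hs : 0 < s) :
    a ^ 2 * b ^ 2 ≤ 3 / 4 * (a * b * (a - 1) ^ 2 / s + s * (a * b * (b - 1) ^ 2))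
      + 1 / 4 * (a ^ 2 * b ^ 2) + 289 / 16 * (s + 1 / s) ^ 2 := by
  have aux : ∀ a b s : ℝ, 0 < a → 0 < b → 0 < s →
      a ^ 2 * b ≤ 1 / 4 * (a * b * (a - 1) ^ 2 / s) + (1 / 4 * (1 / s) + 4 * s) * (a * b) := by
    intro a b s ha hb hs
    have h1 : a ≤ (1 / 16) * a ^ 2 / s + 4 * s := by
      have : (1 / 16) * a ^ 2 / s + 4 * s - a = (a / 4 - 2 * s) ^ 2 / s := by
        field_simp; ring
      have : 0 ≤ (a / 4 - 2 * s) ^ 2 / s := by positivity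
      linarith
    have h2 : a ^ 2 ≤ 4 * (a - 1) ^ 2 + 4 := by nlinarith [sq_nonneg (3 * a - 4)]
    have h3 : (1 / 16) * a ^ 2 / s ≤ (1 / 16) * (4 * (a - 1) ^ 2 + 4) / s := by gcongr
    have h4 : a ≤ (1 / 16) * (4 * (a - 1) ^ 2 + 4) / s + 4 * s := by linarith
    have h5 := mul_le_mul_of_nonneg_left h4 (mul_pos ha hb).le
    calc a ^ 2 * b = a * b * a := by ring
      _ ≤ _ := h5
      _ = _ := by field_simp; ring
  have e1 := aux a b s ha hb hs
  have e2 := aux b a (1 / s) hb ha (by positivity)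
  have e2' : b ^ 2 * a ≤ 1 / 4 * (s * (a * b * (b - 1) ^ 2)) + (1 / 4 * s + 4 * (1 / s)) * (a * b) := by
    refine e2.trans (le_of_eq ?_)
    field_simp
  have e3 : a * b * ((a - 1) * (b - 1)) ≤
      1 / 2 * (a * b * (a - 1) ^ 2 / s + s * (a * b * (b - 1) ^ 2)) := by
    have : 1 / 2 * (a * b * (a - 1) ^ 2 / s + s * (a * b * (b - 1) ^ 2))
        - a * b * ((a - 1) * (b - 1)) = 1 / 2 * (a * b) * ((a - 1) - s * (b - 1)) ^ 2 / s := by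
      field_simp; ring
    have : 0 ≤ 1 / 2 * (a * b) * ((a - 1) - s * (b - 1)) ^ 2 / s := by positivity
    linarith
  have e4 : 17 / 4 * (s + 1 / s) * (a * b) ≤
      1 / 4 * (a ^ 2 * b ^ 2) + 289 / 16 * (s + 1 / s) ^ 2 := by
    nlinarith [sq_nonneg (1 / 2 * (a * b) - 17 / 4 * (s + 1 / s))]
  have e5 : 0 < a * b := by positivity
  nlinarith

section tools2
variable {N : ℕ} {Ω : Set (EuclideanSpace ℝ (Fin N))}

/-- Energy bound for the truncated functions. -/
lemma energy (hO : IsOpen Ω) (hB : Bornology.IsBounded Ω)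
    {w : EuclideanSpace ℝ (Fin N) → ℝ} (hw : ∀ x ∈ Ω, ContDiffAt ℝ 2 w x)
    (hwc : ContinuousOn w (closure Ω)) (hw0 : ∀ x ∈ frontier Ω, w x = 0)
    (hl : ∀ x ∈ Ω, 0 ≤ -lap w x) (hwn : ∀ x ∈ Ω, 0 ≤ w x)
    (hint : IntegrableOn (fun x => -lap w x * exp (w x)) Ω) (n : ℕ) :
    ∫ x, ∑ i, dd i (Ω.indicator fun x => FF n (w x)) x ^ 2
      ≤ 1 / 4 * ∫ x in Ω, -lap w x * exp (w x) := by
  have hn : (0 : ℝ) < 1 / ((n : ℝ) + 1) := by positivity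
  have hζ := testFn_comp hO hB hw hwc hw0 (FF_contDiff n) hn (FF_zero n)
  have hη := testFn_comp hO hB hw hwc hw0 (GG_contDiff n) hn (GG_zero n)
  obtain ⟨i1, i2, e⟩ := ibp hO hw hη
  have h1 : ∀ x, ∑ i, dd i (Ω.indicator fun x => FF n (w x)) x ^ 2 =
      1 / 4 * ∑ i, dd i w x * dd i (Ω.indicator fun x => GG n (w x)) x := by
    intro x
    rw [Finset.mul_sum]
    refine Finset.sum_congr rfl fun i _ => ?_
    by_cases hx : x ∈ Ω
    · rw [dd_comp hO hw hx (FF_deriv n _), dd_comp hO hw hx (GG_deriv n _)]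
      have : exp (w x) = exp (w x / 2) ^ 2 := by rw [← exp_nat_mul]; congr 1; push_cast; ring
      rw [this]; ring
    · rw [dd, dd, dd, fderiv_of_notMem_tsupport ℝ (fun h => hx (hζ.supp h)),
        fderiv_of_notMem_tsupport ℝ (fun h => hx (hη.supp h))]
      simp
  simp_rw [h1]
  rw [integral_const_mul, e]
  refine mul_le_mul_of_nonneg_left ?_ (by norm_num)
  rw [← setIntegral_eq_integral_of_forall_compl_eq_zero (s := Ω)
    (fun x hx => by rw [Set.indicator_of_notMem hx, mul_zero])]
  refine setIntegral_mono_on i2.integrableOn hint hO.measurableSet fun x hx => ?_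
  rw [Set.indicator_of_mem hx]
  exact mul_le_mul_of_nonneg_left (GG_le n (hwn x hx)) (hl x hx)

lemma grad_sq (f : EuclideanSpace ℝ (Fin N) → ℝ) (x : EuclideanSpace ℝ (Fin N)) :
    ‖gradient f x‖ ^ 2 = ∑ i, dd i f x ^ 2 := by
  rw [← (EuclideanSpace.basisFun (Fin N) ℝ).sum_sq_norm_inner_right]
  refine Finset.sum_congr rfl fun i _ => ?_
  rw [real_inner_comm, gradient, InnerProductSpace.toDual_symm_apply]
  simp [dd]

/-- Passing to the limit in the gradient estimate. -/
lemma grad_limit (hO : IsOpen Ω) (hB : Bornology.IsBounded Ω)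
    {v : EuclideanSpace ℝ (Fin N) → ℝ} (hv : ∀ x ∈ Ω, ContDiffAt ℝ 2 v x)
    (hvc : ContinuousOn v (closure Ω)) (hv0 : ∀ x ∈ frontier Ω, v x = 0)
    (hvn : ∀ x ∈ Ω, 0 ≤ v x) {B : ℝ} (hB0 : 0 ≤ B)
    (hE : ∀ n, ∫ x, ∑ i, dd i (Ω.indicator fun x => FF n (v x)) x ^ 2 ≤ B) :
    ∫ x in Ω, ‖gradient (fun y => exp (v y / 2) - 1) x‖ ^ 2 ≤ B := by
  by_cases hI : IntegrableOn (fun x => ‖gradient (fun y => exp (v y / 2) - 1) x‖ ^ 2) Ω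
  swap
  · rw [integral_undef hI]; exact hB0
  have hζ : ∀ n, TestFn Ω (Ω.indicator fun x => FF n (v x)) := fun n =>
    testFn_comp hO hB hv hvc hv0 (FF_contDiff n) (ε := 1 / ((n : ℝ) + 1)) (by positivity) (FF_zero n)
  have hint : ∀ n, Integrable (fun x => ∑ i, dd i (Ω.indicator fun x => FF n (v x)) x ^ 2) := by
    intro n
    refine integrable_finsetSum _ fun i _ => ?_
    simp_rw [sq]
    exact (hζ n).integrable_mul_dd hO
      (fun x hx => dd_continuousAt (hζ n).smooth.contDiffAt i) i
  have hgr : ∀ x ∈ Ω, ∀ i, dd i (fun y => exp (v y / 2) - 1) x = exp (v x / 2) / 2 * dd i v x := by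
    intro x hx i
    have hd : HasDerivAt (fun t : ℝ => exp (t / 2) - 1) (exp (v x / 2) / 2) (v x) := by
      have := (((hasDerivAt_id (v x)).div_const 2).exp).sub_const 1
      simpa [div_eq_mul_inv] using this
    rw [← dd_comp hO hv hx hd i]
    have : (Ω.indicator fun x => exp (v x / 2) - 1) =ᶠ[nhds x] fun x => exp (v x / 2) - 1 := by
      filter_upwards [hO.mem_nhds hx] with y hy
      simp [hy]
    rw [dd, dd, this.fderiv_eq]
  have hlim : Filter.Tendsto
      (fun n => ∫ x in Ω, ∑ i, dd i (Ω.indicator fun x => FF n (v x)) x ^ 2) Filter.atTop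
      (nhds (∫ x in Ω, ‖gradient (fun y => exp (v y / 2) - 1) x‖ ^ 2)) := by
    refine tendsto_integral_of_dominated_convergence
      (fun x => ‖gradient (fun y => exp (v y / 2) - 1) x‖ ^ 2)
      (fun n => (hint n).integrableOn.aestronglyMeasurable) hI (fun n => ?_) ?_
    · filter_upwards [ae_restrict_mem hO.measurableSet] with x hx
      rw [Real.norm_of_nonneg (by positivity), grad_sq]
      refine Finset.sum_le_sum fun i _ => ?_
      rw [dd_comp hO hv hx (FF_deriv n _), hgr x hx, mul_assoc, mul_pow]
      exact mul_le_of_le_one_left (by positivity) (pow_le_one₀ (chi_nonneg n _) (chi_le n _))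
    · filter_upwards [ae_restrict_mem hO.measurableSet] with x hx
      rw [grad_sq]
      refine tendsto_finsetSum _ fun i _ => ?_
      rw [hgr x hx]
      rcases (hvn x hx).eq_or_lt with h0 | h0
      · have hlm : IsLocalMin v x := by
          filter_upwards [hO.mem_nhds hx] with y hy
          rw [← h0]; exact hvn y hy
        have hz : dd i v x = 0 := by rw [dd, hlm.fderiv_eq_zero]; simp
        refine tendsto_const_nhds.congr fun n => ?_
        rw [dd_comp hO hv hx (FF_deriv n _), hz]; simp
      · refine tendsto_const_nhds.congr' ?_
        filter_upwards [chi_eventually h0] with n hn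
        rw [dd_comp hO hv hx (FF_deriv n _), hn, one_mul]
  refine le_of_tendsto' hlim fun n => ?_
  rw [setIntegral_eq_integral_of_forall_compl_eq_zero]
  · exact hE n
  · intro x hx
    refine Finset.sum_eq_zero fun i _ => ?_
    rw [dd, fderiv_of_notMem_tsupport ℝ (fun h => hx ((hζ n).supp h))]
    simp

/-- Passing to the limit in the stability estimate. -/
lemma stab_limit (hO : IsOpen Ω) {w k : EuclideanSpace ℝ (Fin N) → ℝ}
    (hk : ContinuousOn k Ω) (hk0 : ∀ x ∈ Ω, 0 ≤ k x) (hw : ContinuousOn w Ω)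
    (hwn : ∀ x ∈ Ω, 0 ≤ w x) {B : ℝ}
    (hI : IntegrableOn (fun x => k x * (exp (w x / 2) - 1) ^ 2) Ω)
    (hE : ∀ n, ∫ x in Ω, k x * (FF n (w x)) ^ 2 ≤ B) :
    ∫ x in Ω, k x * (exp (w x / 2) - 1) ^ 2 ≤ B := by
  have hlim : Filter.Tendsto
      (fun n => ∫ x in Ω, k x * (FF n (w x)) ^ 2) Filter.atTop
      (nhds (∫ x in Ω, k x * (exp (w x / 2) - 1) ^ 2)) := by
    refine tendsto_integral_of_dominated_convergence
      (fun x => k x * (exp (w x / 2) - 1) ^ 2) (fun n => ?_) hI (fun n => ?_) ?_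
    · refine ContinuousOn.aestronglyMeasurable ?_ hO.measurableSet
      exact hk.mul (((FF_contDiff n).continuous.comp_continuousOn hw).pow 2)
    · filter_upwards [ae_restrict_mem hO.measurableSet] with x hx
      have := hk0 x hx
      rw [Real.norm_of_nonneg (by positivity)]
      gcongr
      · exact FF_nonneg n (hwn x hx)
      · exact FF_le n (hwn x hx)
    · filter_upwards [ae_restrict_mem hO.measurableSet] with x hx
      exact ((FF_tendsto (hwn x hx)).pow 2).const_mul _
  exact le_of_tendsto' hlim hE

end tools2

lemma amgm_aux {p q k : ℝ} (hp : 0 ≤ p) (hq : 0 ≤ q) (h : k ^ 2 = p * q) : 2 * k ≤ p + q := by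
  refine le_of_sq_le_sq ?_ (by positivity)
  nlinarith [sq_nonneg (p - q)]

/-- Stability inequality for the system. -/
lemma stab_sys {N : ℕ} {Ω : Set (EuclideanSpace ℝ (Fin N))} (hO : IsOpen Ω) {lam mu lam1 : ℝ}
    (hlam : 0 < lam) (hmu : 0 < mu) (hlam1 : 0 ≤ lam1)
    {u v φ ψ ζ : EuclideanSpace ℝ (Fin N) → ℝ}
    (hu : ∀ x ∈ Ω, ContDiffAt ℝ 2 u x) (hv : ∀ x ∈ Ω, ContDiffAt ℝ 2 v x)
    (hφ : ∀ x ∈ Ω, ContDiffAt ℝ 2 φ x) (hψ : ∀ x ∈ Ω, ContDiffAt ℝ 2 ψ x)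
    (hφ0 : ∀ x ∈ Ω, 0 < φ x) (hψ0 : ∀ x ∈ Ω, 0 < ψ x)
    (e1 : ∀ x ∈ Ω, -lap φ x - mu * exp (v x) * ψ x = lam1 * φ x)
    (e2 : ∀ x ∈ Ω, -lap ψ x - lam * exp (u x) * φ x = lam1 * ψ x)
    (h : TestFn Ω ζ) :
    ∫ x in Ω, (√(lam * mu) * exp ((u x + v x) / 2)) * ζ x ^ 2 ≤ ∫ x, ∑ i, dd i ζ x ^ 2 := by
  obtain ⟨i1, i3, h1⟩ := stab_one hO hφ hφ0 h
  obtain ⟨i2, -, h2⟩ := stab_one hO hψ hψ0 h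
  have hz : ∀ x ∉ Ω, ζ x = 0 := fun x hx =>
    image_eq_zero_of_notMem_tsupport fun hh => hx (h.supp hh)
  rw [setIntegral_eq_integral_of_forall_compl_eq_zero (fun x hx => by rw [hz x hx]; ring)]
  have i4 : Integrable (fun x => (√(lam * mu) * exp ((u x + v x) / 2)) * ζ x ^ 2) := by
    have : ∀ x, (√(lam * mu) * exp ((u x + v x) / 2)) * ζ x ^ 2 =
        (√(lam * mu) * exp ((u x + v x) / 2)) * ζ x * ζ x := by intro x; ring
    simp_rw [this]
    refine h.integrable_mul hO fun x hx => ?_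
    have c1 := (hu x hx).continuousAt
    have c2 := (hv x hx).continuousAt
    have c3 := h.smooth.continuous.continuousAt (x := x)
    fun_prop
  have key : ∫ x, (√(lam * mu) * exp ((u x + v x) / 2)) * ζ x ^ 2 ≤
      ∫ x, (1 / 2 * (-lap φ x * (ζ x ^ 2 / φ x)) + 1 / 2 * (-lap ψ x * (ζ x ^ 2 / ψ x))) := by
    refine integral_mono i4 ((i1.const_mul _).add (i2.const_mul _)) fun x => ?_
    by_cases hx : x ∈ Ω
    · have p1 := hφ0 x hx
      have p2 := hψ0 x hx
      have E1 : -lap φ x = mu * exp (v x) * ψ x + lam1 * φ x := by linarith [e1 x hx]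
      have E2 : -lap ψ x = lam * exp (u x) * φ x + lam1 * ψ x := by linarith [e2 x hx]
      have hk : (√(lam * mu) * exp ((u x + v x) / 2)) ^ 2 =
          (mu * exp (v x) * ψ x / φ x) * (lam * exp (u x) * φ x / ψ x) := by
        rw [mul_pow, Real.sq_sqrt (by positivity), ← exp_nat_mul,
          show ((2 : ℕ) : ℝ) * ((u x + v x) / 2) = u x + v x by push_cast; ring, exp_add]
        field_simp
      have := amgm_aux (by positivity) (by positivity) hk
      have hm := mul_le_mul_of_nonneg_right this (sq_nonneg (ζ x))
      have r1 : -lap φ x * (ζ x ^ 2 / φ x) =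
          mu * exp (v x) * ψ x / φ x * ζ x ^ 2 + lam1 * ζ x ^ 2 := by
        rw [E1]; field_simp
      have r2 : -lap ψ x * (ζ x ^ 2 / ψ x) =
          lam * exp (u x) * φ x / ψ x * ζ x ^ 2 + lam1 * ζ x ^ 2 := by
        rw [E2]; field_simp
      simp only []
      rw [r1, r2]
      have : 0 ≤ lam1 * ζ x ^ 2 := by positivity
      linarith
    · simp [hz x hx]
  rw [integral_add (i1.const_mul _) (i2.const_mul _), integral_const_mul, integral_const_mul] at key
  linarith

/-- With `C` the universal constant from the bound
`∫ e^{u+v} ≤ C|Ω|(λ/μ + μ/λ)`, every stable classical solution of the Gelfand system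
satisfies `∫ |∇(e^{v/2} − 1)|² ≤ (C/4) λ |Ω| (λ/μ + μ/λ)`: `e^{v/2} − 1` is bounded in
`H¹₀(Ω)` uniformly wherever `λ|Ω|(λ/μ + μ/λ)` is bounded. -/
theorem gradient_H1_bound :
    ∃ C : ℝ, 0 < C ∧
      ∀ (N : ℕ), 1 ≤ N →
        ∀ (Ω : Set (EuclideanSpace ℝ (Fin N))), IsBoundedDomain Ω →
          ∀ (lam mu : ℝ), 0 < lam → 0 < mu →
            ∀ (u v : EuclideanSpace ℝ (Fin N) → ℝ),
              IsStableGelfandSolution Ω lam mu u v →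
              (∫ x in Ω, exp (u x + v x) ≤
                  C * (volume Ω).toReal * (lam / mu + mu / lam)) ∧
              ∫ x in Ω, ‖gradient (fun y => exp (v y / 2) - 1) x‖ ^ 2 ≤
                C / 4 * lam * (volume Ω).toReal * (lam / mu + mu / lam) := by
  refine ⟨100, by norm_num, ?_⟩
  rintro N _ Ω ⟨hO, -, hB⟩ lam mu hlam hmu u v ⟨⟨cu, cv, eu, ev, u0, v0⟩, lam1, φ, ψ, hlam1, cφ, cψ,
    hφ0, hψ0, e1, e2, -, -⟩
  have hnh : ∀ x ∈ Ω, closure Ω ∈ nhds x := fun x hx =>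
    Filter.mem_of_superset (hO.mem_nhds hx) subset_closure
  have hu : ∀ x ∈ Ω, ContDiffAt ℝ 2 u x := fun x hx => cu.contDiffAt (hnh x hx)
  have hv : ∀ x ∈ Ω, ContDiffAt ℝ 2 v x := fun x hx => cv.contDiffAt (hnh x hx)
  have hφ : ∀ x ∈ Ω, ContDiffAt ℝ 2 φ x := fun x hx => cφ.contDiffAt (hnh x hx)
  have hψ : ∀ x ∈ Ω, ContDiffAt ℝ 2 ψ x := fun x hx => cψ.contDiffAt (hnh x hx)
  have hun : ∀ x ∈ Ω, 0 ≤ u x := min_principle hO hB hu cu.continuousOn u0 fun x hx => by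
    have := eu x hx
    have : 0 < mu * exp (v x) := by positivity
    linarith
  have hvn : ∀ x ∈ Ω, 0 ≤ v x := min_principle hO hB hv cv.continuousOn v0 fun x hx => by
    have := ev x hx
    have : 0 < lam * exp (u x) := by positivity
    linarith
  have hcomp : IsCompact (closure Ω) :=
    Metric.isCompact_of_isClosed_isBounded isClosed_closure hB.closure
  have hint : ∀ g : EuclideanSpace ℝ (Fin N) → ℝ, ContinuousOn g (closure Ω) →
      IntegrableOn g Ω := fun g hg =>
    (hg.integrableOn_compact hcomp).mono_set subset_closure
  have cu' := cu.continuousOn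
  have cv' := cv.continuousOn
  set X := ∫ x in Ω, exp (u x + v x) with hX
  have hX0 : 0 ≤ X := integral_nonneg fun x => (exp_pos _).le
  -- energies
  have Eu : ∫ x in Ω, -lap u x * exp (u x) = mu * X := by
    rw [hX, ← integral_const_mul]
    refine setIntegral_congr_fun hO.measurableSet fun x hx => ?_
    rw [eu x hx, exp_add]; ring
  have Ev : ∫ x in Ω, -lap v x * exp (v x) = lam * X := by
    rw [hX, ← integral_const_mul]
    refine setIntegral_congr_fun hO.measurableSet fun x hx => ?_
    rw [ev x hx, exp_add]; ring
  have enu : ∀ n, ∫ x, ∑ i, dd i (Ω.indicator fun x => FF n (u x)) x ^ 2 ≤ 1 / 4 * (mu * X) := by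
    intro n
    rw [← Eu]
    refine energy hO hB hu cu' u0 (fun x hx => ?_) hun ?_ n
    · rw [eu x hx]; positivity
    · refine IntegrableOn.congr_fun (f := fun x => mu * exp (v x) * exp (u x)) ?_ ?_ hO.measurableSet
      · exact hint _ (by fun_prop)
      · intro x hx
        simp only []
        rw [eu x hx]
  have env : ∀ n, ∫ x, ∑ i, dd i (Ω.indicator fun x => FF n (v x)) x ^ 2 ≤ 1 / 4 * (lam * X) := by
    intro n
    rw [← Ev]
    refine energy hO hB hv cv' v0 (fun x hx => ?_) hvn ?_ n
    · rw [ev x hx]; positivity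
    · refine IntegrableOn.congr_fun (f := fun x => lam * exp (u x) * exp (v x)) ?_ ?_ hO.measurableSet
      · exact hint _ (by fun_prop)
      · intro x hx
        simp only []
        rw [ev x hx]
  -- stability with the truncated functions
  have su : ∫ x in Ω, (√(lam * mu) * exp ((u x + v x) / 2)) * (exp (u x / 2) - 1) ^ 2
      ≤ 1 / 4 * (mu * X) := by
    refine stab_limit hO ?_ (fun x _ => by positivity) (cu'.mono subset_closure) hun ?_ fun n => ?_
    · exact ContinuousOn.mono (by fun_prop) subset_closure
    · exact hint _ (by fun_prop)
    · refine le_trans (le_of_eq ?_) ((stab_sys hO hlam hmu hlam1 hu hv hφ hψ hφ0 hψ0 e1 e2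
        (testFn_comp hO hB hu cu' u0 (FF_contDiff n) (ε := 1 / ((n : ℝ) + 1)) (by positivity)
          (FF_zero n))).trans (enu n))
      refine setIntegral_congr_fun hO.measurableSet fun x hx => ?_
      simp only [Set.indicator_of_mem hx]
  have sv : ∫ x in Ω, (√(lam * mu) * exp ((u x + v x) / 2)) * (exp (v x / 2) - 1) ^ 2
      ≤ 1 / 4 * (lam * X) := by
    refine stab_limit hO ?_ (fun x _ => by positivity) (cv'.mono subset_closure) hvn ?_ fun n => ?_
    · exact ContinuousOn.mono (by fun_prop) subset_closure
    · exact hint _ (by fun_prop)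
    · refine le_trans (le_of_eq ?_) ((stab_sys hO hlam hmu hlam1 hu hv hφ hψ hφ0 hψ0 e1 e2
        (testFn_comp hO hB hv cv' v0 (FF_contDiff n) (ε := 1 / ((n : ℝ) + 1)) (by positivity)
          (FF_zero n))).trans (env n))
      refine setIntegral_congr_fun hO.measurableSet fun x hx => ?_
      simp only [Set.indicator_of_mem hx]
  set P := ∫ x in Ω, exp ((u x + v x) / 2) * (exp (u x / 2) - 1) ^ 2 with hP
  set Q := ∫ x in Ω, exp ((u x + v x) / 2) * (exp (v x / 2) - 1) ^ 2 with hQ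
  have su' : √(lam * mu) * P ≤ 1 / 4 * (mu * X) := by
    rw [hP, ← integral_const_mul]
    simpa only [mul_assoc] using su
  have sv' : √(lam * mu) * Q ≤ 1 / 4 * (lam * X) := by
    rw [hQ, ← integral_const_mul]
    simpa only [mul_assoc] using sv
  set a := √lam with ha
  set b := √mu with hb
  have ha0 : 0 < a := Real.sqrt_pos.mpr hlam
  have hb0 : 0 < b := Real.sqrt_pos.mpr hmu
  have ha2 : lam = a ^ 2 := (Real.sq_sqrt hlam.le).symm
  have hb2 : mu = b ^ 2 := (Real.sq_sqrt hmu.le).symm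
  rw [Real.sqrt_mul hlam.le, ← ha, ← hb] at su' sv'
  have hPb : P / (b / a) ≤ 1 / 4 * X := by
    rw [div_le_iff₀ (by positivity)]
    refine le_of_mul_le_mul_left (su'.trans (le_of_eq ?_)) (mul_pos ha0 hb0)
    rw [hb2]; field_simp
  have hQb : b / a * Q ≤ 1 / 4 * X := by
    refine le_of_mul_le_mul_left (a := a ^ 2) ?_ (by positivity)
    rw [ha2] at sv'
    refine le_trans (le_of_eq ?_) (sv'.trans (le_of_eq ?_))
    · field_simp
    · ring
  set s := b / a with hs
  have hs0 : 0 < s := by positivity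
  set V := (volume Ω).toReal with hV
  have hV0 : 0 ≤ V := ENNReal.toReal_nonneg
  have iX : IntegrableOn (fun x => exp (u x + v x)) Ω := hint _ (by fun_prop)
  have iP : IntegrableOn (fun x => exp ((u x + v x) / 2) * (exp (u x / 2) - 1) ^ 2) Ω :=
    hint _ (by fun_prop)
  have iQ : IntegrableOn (fun x => exp ((u x + v x) / 2) * (exp (v x / 2) - 1) ^ 2) Ω :=
    hint _ (by fun_prop)
  have iC : IntegrableOn (fun _ : EuclideanSpace ℝ (Fin N) => 289 / 16 * (s + 1 / s) ^ 2) Ω :=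
    hint _ (by fun_prop)
  have main : X ≤ 3 / 4 * (P / s + s * Q) + 1 / 4 * X + 289 / 16 * (s + 1 / s) ^ 2 * V := by
    have hle : X ≤ ∫ x in Ω, (3 / 4 * (exp ((u x + v x) / 2) * (exp (u x / 2) - 1) ^ 2 / s
        + s * (exp ((u x + v x) / 2) * (exp (v x / 2) - 1) ^ 2))
        + 1 / 4 * exp (u x + v x) + 289 / 16 * (s + 1 / s) ^ 2) := by
      refine integral_mono iX (((((iP.div_const s).add (iQ.const_mul s)).const_mul _).add
        (iX.const_mul _)).add iC) fun x => ?_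
      have := pointwise_ineq_s8 (exp_pos (u x / 2)) (exp_pos (v x / 2)) hs0
      have r1 : exp (u x / 2) ^ 2 * exp (v x / 2) ^ 2 = exp (u x + v x) := by
        rw [← exp_nat_mul, ← exp_nat_mul, ← exp_add]; congr 1; push_cast; ring
      have r2 : exp (u x / 2) * exp (v x / 2) = exp ((u x + v x) / 2) := by
        rw [← exp_add]; congr 1; ring
      rw [r1, r2] at this
      exact this
    refine hle.trans (le_of_eq ?_)
    have j1 : IntegrableOn (fun x => exp ((u x + v x) / 2) * (exp (u x / 2) - 1) ^ 2 / s) Ω :=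
      iP.div_const s
    have j2 : IntegrableOn (fun x => s * (exp ((u x + v x) / 2) * (exp (v x / 2) - 1) ^ 2)) Ω :=
      iQ.const_mul s
    have j3 : IntegrableOn (fun x => 3 / 4 * (exp ((u x + v x) / 2) * (exp (u x / 2) - 1) ^ 2 / s
        + s * (exp ((u x + v x) / 2) * (exp (v x / 2) - 1) ^ 2))) Ω := (j1.add j2).const_mul _
    have j4 : IntegrableOn (fun x => 1 / 4 * exp (u x + v x)) Ω := iX.const_mul _
    have j5 : IntegrableOn (fun x => 3 / 4 * (exp ((u x + v x) / 2) * (exp (u x / 2) - 1) ^ 2 / s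
        + s * (exp ((u x + v x) / 2) * (exp (v x / 2) - 1) ^ 2)) + 1 / 4 * exp (u x + v x)) Ω :=
      j3.add j4
    rw [integral_add j5 iC, integral_add j3 j4, integral_const_mul, integral_add j1 j2,
        integral_div, integral_const_mul, integral_const_mul, setIntegral_const, smul_eq_mul,
        Measure.real]
    ring
  have hs2 : (s + 1 / s) ^ 2 ≤ 2 * (lam / mu + mu / lam) := by
    have : lam / mu + mu / lam = s ^ 2 + (1 / s) ^ 2 := by
      rw [ha2, hb2, hs]; field_simp; ring
    rw [this]
    nlinarith [sq_nonneg (s - 1 / s)]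
  have hsV := mul_le_mul_of_nonneg_right hs2 hV0
  have hbound : X ≤ 100 * V * (lam / mu + mu / lam) := by
    have : 0 ≤ (lam / mu + mu / lam) * V := by positivity
    nlinarith
  refine ⟨hbound, ?_⟩
  have hg := grad_limit hO hB hv cv' v0 hvn (by positivity) env
  refine hg.trans ?_
  have := mul_le_mul_of_nonneg_left hbound hlam.le
  nlinarith
end
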